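/- (Main Lemma) Let μ be a compactly supported finite Borel measure in ℝ^d with growth of degree n such that the lower density θ^n_*(x,μ) = liminf_{r→0} r^{−n} μ(B(x,r)) is positive for μ-a.e. x ∈ ℝ^d. Suppose that the n-dimensional Riesz transform R_μ is bounded in L²(μ). Then there exist finite Borel measures μ_k, k ≥ 1, such that (a) μ ≤ Σ_{k≥1} μ_k (i.e., μ(A) ≤ Σ_k μ_k(A) for every Borel set A); (b) each μ_k is Ahlfors–David regular of dimension n (with AD-regularity constant depending on k); and (c) for each k, R_{μ_k} is bounded in L²(μ_k). -/

import Mathlib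

open MeasureTheory Metric Set Filter
open scoped ENNReal NNReal Topology

noncomputable section

abbrev Euc (d : ℕ) := EuclideanSpace ℝ (Fin d)

/-- The `ε`-truncated `n`-dimensional Riesz transform of `f μ`. -/
def truncRiesz (n : ℕ) {d : ℕ} (μ : Measure (Euc d)) (ε : ℝ) (f : Euc d → ℝ)
    (x : Euc d) : Euc d :=
  ∫ y in {y : Euc d | ε < ‖x - y‖}, (‖x - y‖ ^ (n + 1))⁻¹ • f y • (x - y) ∂μ

/-- The `ε`-regularized `n`-dimensional Riesz transform of `f μ`, with kernel
`K_ε(x) = x / max(|x|, ε)^(n+1)`. -/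
def regRiesz (n : ℕ) {d : ℕ} (μ : Measure (Euc d)) (ε : ℝ) (f : Euc d → ℝ)
    (x : Euc d) : Euc d :=
  ∫ y, ((max ‖x - y‖ ε) ^ (n + 1))⁻¹ • f y • (x - y) ∂μ

/-- `R_μ` is bounded in `L²(μ)`: the truncated operators are bounded uniformly in `ε > 0`. -/
def RieszBounded (n : ℕ) {d : ℕ} (μ : Measure (Euc d)) : Prop :=
  ∃ C : ℝ, 0 < C ∧ ∀ ε : ℝ, 0 < ε → ∀ f : Euc d → ℝ, Measurable f →
    ∫⁻ x, (‖truncRiesz n μ ε f x‖₊ : ℝ≥0∞) ^ 2 ∂μ ≤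
      ENNReal.ofReal C * ∫⁻ x, (‖f x‖₊ : ℝ≥0∞) ^ 2 ∂μ

/-- The regularized operators `R̃_{μ,ε}` are bounded in `L²(μ)` uniformly in `ε > 0`. -/
def RegRieszBounded (n : ℕ) {d : ℕ} (μ : Measure (Euc d)) : Prop :=
  ∃ C : ℝ, 0 < C ∧ ∀ ε : ℝ, 0 < ε → ∀ f : Euc d → ℝ, Measurable f →
    ∫⁻ x, (‖regRiesz n μ ε f x‖₊ : ℝ≥0∞) ^ 2 ∂μ ≤
      ENNReal.ofReal C * ∫⁻ x, (‖f x‖₊ : ℝ≥0∞) ^ 2 ∂μ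

/-- `μ` has growth of degree `n` with constant `c`. -/
def GrowthDeg (n : ℕ) {d : ℕ} (μ : Measure (Euc d)) (c : ℝ) : Prop :=
  ∀ (x : Euc d) (r : ℝ), 0 < r → μ (closedBall x r) ≤ ENNReal.ofReal (c * r ^ n)

/-- A set is `n`-rectifiable: up to an `H^n`-null set it is contained in a countable union of
Lipschitz images of `ℝ^n`. -/
def IsRectifiable (n : ℕ) {d : ℕ} (E : Set (Euc d)) : Prop :=
  ∃ (f : ℕ → EuclideanSpace ℝ (Fin n) → Euc d) (K : ℕ → ℝ≥0),
    (∀ i, LipschitzWith (K i) (f i)) ∧ μH[(n : ℝ)] (E \ ⋃ i, Set.range (f i)) = 0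

/-- Every `n`-rectifiable subset has `H^n` measure zero. -/
def PurelyUnrectifiable (n : ℕ) {d : ℕ} (E : Set (Euc d)) : Prop :=
  ∀ F, F ⊆ E → IsRectifiable n F → μH[(n : ℝ)] F = 0

/-- The support of a measure. -/
def measureSupport {d : ℕ} (μ : Measure (Euc d)) : Set (Euc d) :=
  {x | ∀ r : ℝ, 0 < r → 0 < μ (ball x r)}

/-- The lower `n`-dimensional density `θⁿ_*(x, μ)`. -/
def lowerDensity (n : ℕ) {d : ℕ} (μ : Measure (Euc d)) (x : Euc d) : ℝ≥0∞ :=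
  Filter.liminf (fun r : ℝ => μ (closedBall x r) / ENNReal.ofReal (r ^ n)) (𝓝[>] (0 : ℝ))

/-- `μ` is Ahlfors–David regular of dimension `n`. -/
def ADRegular (n : ℕ) {d : ℕ} (μ : Measure (Euc d)) : Prop :=
  ∃ c : ℝ, 1 ≤ c ∧ ∀ x ∈ measureSupport μ, ∀ r : ℝ, 0 < r →
    ENNReal.ofReal r ≤ EMetric.diam (measureSupport μ) →
    ENNReal.ofReal (c⁻¹ * r ^ n) ≤ μ (closedBall x r) ∧
      μ (closedBall x r) ≤ ENNReal.ofReal (c * r ^ n)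

/-- An `n`-dimensional affine plane in `ℝ^d`. -/
def IsAffineNPlane (n : ℕ) {d : ℕ} (W : Set (Euc d)) : Prop :=
  ∃ (a : Euc d) (V : Submodule ℝ (Euc d)), Module.finrank ℝ V = n ∧
    W = (fun v => a + v) '' (V : Set (Euc d))

/-- The centered Hardy–Littlewood maximal operator with respect to `μ`. -/
def maximalOp {d : ℕ} (μ : Measure (Euc d)) (f : Euc d → ℝ) (x : Euc d) : ℝ≥0∞ :=
  ⨆ (r : ℝ) (_ : 0 < r),
    (μ (closedBall x r))⁻¹ * ∫⁻ y in closedBall x r, (‖f y‖₊ : ℝ≥0∞) ∂μ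

/-- Harmonicity on a set, expressed through continuity together with the mean value property
over closed balls. -/
def MeanValueHarmonicOn {d : ℕ} (f : Euc d → ℝ) (U : Set (Euc d)) : Prop :=
  ContinuousOn f U ∧ ∀ x ∈ U, ∀ r : ℝ, 0 < r → closedBall x r ⊆ U →
    f x = ⨍ y in closedBall x r, f y ∂volume

/-- `E` is removable for Lipschitz harmonic functions. -/
def RemovableForLipschitzHarmonic {d : ℕ} (E : Set (Euc d)) : Prop :=
  ∀ Ω : Set (Euc d), IsOpen Ω → ∀ f : Euc d → ℝ,
    (∃ K : ℝ≥0, LipschitzOnWith K f Ω) →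
    MeanValueHarmonicOn f (Ω \ E) → MeanValueHarmonicOn f Ω

/-- The distance between two sets. -/
def ballsDist {d : ℕ} (A B : Set (Euc d)) : ℝ :=
  sInf (Set.image2 dist A B)

end

/-- Cauchy–Schwarz for `lintegral`, in squared form. -/
theorem sq_lintegral_mul_le {α : Type*} [MeasurableSpace α] (μ : Measure α) {f g : α → ℝ≥0∞}
    (hf : AEMeasurable f μ) (hg : AEMeasurable g μ) :
    (∫⁻ a, f a * g a ∂μ) ^ 2 ≤ (∫⁻ a, f a ^ 2 ∂μ) * ∫⁻ a, g a ^ 2 ∂μ := by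
  have h := ENNReal.lintegral_mul_le_Lp_mul_Lq μ Real.HolderConjugate.two_two hf hg
  simp only [Pi.mul_apply, ENNReal.rpow_two] at h
  calc _ ≤ ((∫⁻ a, f a ^ 2 ∂μ) ^ (1 / (2:ℝ)) * (∫⁻ a, g a ^ 2 ∂μ) ^ (1 / (2:ℝ))) ^ 2 := by gcongr
    _ = _ := by
      rw [mul_pow, ← ENNReal.rpow_two, ← ENNReal.rpow_two, ← ENNReal.rpow_mul, ← ENNReal.rpow_mul]
      norm_num

theorem ENNReal.le_of_sq_le_mul {a b : ℝ≥0∞} (ha : a ≠ ⊤) (h : a ^ 2 ≤ b * a) : a ≤ b := by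
  rcases eq_or_ne a 0 with h0 | h0
  · simp [h0]
  · rw [sq] at h
    exact (ENNReal.mul_le_mul_iff_left h0 ha).1 h

/-- A positive kernel with uniformly bounded column integrals which satisfies a quasi-triangle
inequality is bounded in `L²`, provided that the input is such that the output has finite norm. -/
theorem lintegral_sq_kernel_le_of_ne_top {α : Type*} [MeasurableSpace α] (μ : Measure α) [SFinite μ]
    {k : α → α → ℝ≥0∞} (hk : Measurable (Function.uncurry k)) {S M : ℝ≥0∞}
    (hS : ∀ y, ∫⁻ x, k x y ∂μ ≤ S)
    (hM : ∀ x y z, k x y * k x z ≤ M * (k y z * k x y + k z y * k x z))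
    {f : α → ℝ≥0∞} (hf : Measurable f)
    (hfin : ∫⁻ x, (∫⁻ y, k x y * f y ∂μ) ^ 2 ∂μ ≠ ⊤) :
    ∫⁻ x, (∫⁻ y, k x y * f y ∂μ) ^ 2 ∂μ ≤ (2 * M * S) ^ 2 * ∫⁻ x, f x ^ 2 ∂μ := by
  have hk1 : ∀ x, Measurable (k x) := fun x => hk.comp measurable_prodMk_left
  have hk2 : ∀ y, Measurable (fun x => k x y) := fun y => hk.comp measurable_prodMk_right
  have hAf : Measurable fun x => ∫⁻ y, k x y * f y ∂μ := by
    apply Measurable.lintegral_prod_right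
    exact hk.mul (hf.comp measurable_snd)
  have key : ∫⁻ x, (∫⁻ y, k x y * f y ∂μ) ^ 2 ∂μ ≤
      (2 * M * S) * ∫⁻ x, f x * ∫⁻ y, k x y * f y ∂μ ∂μ := by
    have e1 : ∀ x, (∫⁻ y, k x y * f y ∂μ) ^ 2
        = ∫⁻ y, ∫⁻ z, (k x y * f y) * (k x z * f z) ∂μ ∂μ := by
      intro x
      rw [sq, ← lintegral_mul_const _ (by fun_prop)]
      refine lintegral_congr fun y => ?_
      rw [lintegral_const_mul _ (by fun_prop)]
    have e2 : ∀ x, (∫⁻ y, k x y * f y ∂μ) ^ 2 ≤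
        ∫⁻ y, ∫⁻ z, M * (k y z * k x y + k z y * k x z) * (f y * f z) ∂μ ∂μ := by
      intro x
      rw [e1]
      refine lintegral_mono fun y => lintegral_mono fun z => ?_
      calc (k x y * f y) * (k x z * f z) = (k x y * k x z) * (f y * f z) := by ring
        _ ≤ _ := mul_le_mul_left (hM x y z) _
    calc ∫⁻ x, (∫⁻ y, k x y * f y ∂μ) ^ 2 ∂μ
        ≤ ∫⁻ x, ∫⁻ y, ∫⁻ z, M * (k y z * k x y + k z y * k x z) * (f y * f z) ∂μ ∂μ ∂μ :=
          lintegral_mono e2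
      _ = ∫⁻ y, ∫⁻ z, ∫⁻ x, M * (k y z * k x y + k z y * k x z) * (f y * f z) ∂μ ∂μ ∂μ := by
          rw [lintegral_lintegral_swap]
          · refine lintegral_congr fun y => ?_
            rw [lintegral_lintegral_swap]
            exact Measurable.aemeasurable (by fun_prop)
          · refine (Measurable.lintegral_prod_right' (f := fun q : (α × α) × α =>
              M * (k q.1.2 q.2 * k q.1.1 q.1.2 + k q.2 q.1.2 * k q.1.1 q.2) * (f q.1.2 * f q.2))
              ?_).aemeasurable
            fun_prop
      _ ≤ ∫⁻ y, ∫⁻ z, (M * S) * (k y z * (f y * f z) + k z y * (f y * f z)) ∂μ ∂μ := by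
          refine lintegral_mono fun y => lintegral_mono fun z => ?_
          rw [lintegral_mul_const _ (by fun_prop), lintegral_const_mul _ (by fun_prop),
            lintegral_add_left (by fun_prop), lintegral_const_mul _ (hk2 y),
            lintegral_const_mul _ (hk2 z)]
          calc M * (k y z * ∫⁻ x, k x y ∂μ + k z y * ∫⁻ x, k x z ∂μ) * (f y * f z)
              ≤ M * (k y z * S + k z y * S) * (f y * f z) := by
                gcongr
                · exact hS y
                · exact hS z
            _ = _ := by ring
      _ = (M * S) * (∫⁻ y, ∫⁻ z, k y z * (f y * f z) ∂μ ∂μ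
            + ∫⁻ y, ∫⁻ z, k z y * (f y * f z) ∂μ ∂μ) := by
          have h1 : Measurable fun y => ∫⁻ z, k y z * (f y * f z) ∂μ :=
            Measurable.lintegral_prod_right' (f := fun q : α × α => k q.1 q.2 * (f q.1 * f q.2))
              (by fun_prop)
          have h2 : Measurable fun y => ∫⁻ z, k z y * (f y * f z) ∂μ :=
            Measurable.lintegral_prod_right' (f := fun q : α × α => k q.2 q.1 * (f q.1 * f q.2))
              (by fun_prop)
          rw [← lintegral_add_left h1, ← lintegral_const_mul _ (by fun_prop)]
          refine lintegral_congr fun y => ?_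
          rw [← lintegral_add_left (by fun_prop), ← lintegral_const_mul _ (by fun_prop)]
      _ = (M * S) * (∫⁻ y, ∫⁻ z, k y z * (f y * f z) ∂μ ∂μ
            + ∫⁻ y, ∫⁻ z, k y z * (f y * f z) ∂μ ∂μ) := by
          congr 2
          rw [lintegral_lintegral_swap]
          · exact lintegral_congr fun y => lintegral_congr fun z => by rw [mul_comm (f z)]
          · exact Measurable.aemeasurable (by fun_prop)
      _ = _ := by
          rw [← two_mul, ← mul_assoc, mul_comm (M * S), ← mul_assoc]
          congr 1
          refine lintegral_congr fun y => ?_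
          rw [← lintegral_const_mul _ (by fun_prop)]
          exact lintegral_congr fun z => by ring
  refine ENNReal.le_of_sq_le_mul hfin ?_
  calc _ ≤ ((2 * M * S) * ∫⁻ x, f x * ∫⁻ y, k x y * f y ∂μ ∂μ) ^ 2 := by gcongr
    _ ≤ (2 * M * S) ^ 2 * ((∫⁻ x, f x ^ 2 ∂μ) * ∫⁻ x, (∫⁻ y, k x y * f y ∂μ) ^ 2 ∂μ) := by
      rw [mul_pow]
      gcongr
      exact sq_lintegral_mul_le μ hf.aemeasurable hAf.aemeasurable
    _ = _ := by ring

/-- Removing the finiteness assumption by truncation. -/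
theorem lintegral_sq_kernel_le {α : Type*} [MeasurableSpace α] (μ : Measure α) [IsFiniteMeasure μ]
    {k : α → α → ℝ≥0∞} (hk : Measurable (Function.uncurry k)) {S M : ℝ≥0∞}
    (hS : ∀ y, ∫⁻ x, k x y ∂μ ≤ S)
    (hM : ∀ x y z, k x y * k x z ≤ M * (k y z * k x y + k z y * k x z))
    {s : ℕ → Set α} (hs : ∀ N, MeasurableSet (s N)) (hmono : Monotone s)
    (hbdd : ∀ N, ∃ B : ℝ≥0∞, B ≠ ⊤ ∧ ∀ x, ∀ y ∈ s N, k x y ≤ B)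
    (hzero : ∀ x y, y ∉ ⋃ N, s N → k x y = 0)
    {f : α → ℝ≥0∞} (hf : Measurable f) :
    ∫⁻ x, (∫⁻ y, k x y * f y ∂μ) ^ 2 ∂μ ≤ (2 * M * S) ^ 2 * ∫⁻ x, f x ^ 2 ∂μ := by
  set g : ℕ → α → ℝ≥0∞ := fun N => (s N).indicator fun y => min (f y) N with hg
  have gm : ∀ N, Measurable (g N) := fun N => (hf.min measurable_const).indicator (hs N)
  have gle : ∀ N y, g N y ≤ f y := fun N y =>
    (indicator_le_self' (fun _ _ => zero_le) _).trans (min_le_left _ _)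
  have gmono : ∀ y, Monotone fun N => g N y := by
    intro y N N' h
    refine (indicator_le_indicator_of_subset (hmono h) (fun _ => zero_le) y).trans ?_
    refine indicator_le_indicator ?_
    gcongr
  have glim : ∀ x y, ⨆ N, k x y * g N y = k x y * f y := by
    intro x y
    rw [← ENNReal.mul_iSup]
    by_cases hy : y ∈ ⋃ N, s N
    · congr 1
      refine le_antisymm (iSup_le fun N => gle N y) ?_
      obtain ⟨N0, hN0⟩ := mem_iUnion.1 hy
      refine le_of_forall_lt fun c hc => ?_
      obtain ⟨N1, hN1⟩ := ENNReal.exists_nat_gt (hc.trans_le le_top).ne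
      refine lt_of_lt_of_le ?_ (le_iSup _ (max N0 N1))
      rw [hg]
      simp only
      rw [indicator_of_mem (hmono (le_max_left _ _) hN0)]
      refine lt_min hc (hN1.trans_le ?_)
      exact_mod_cast le_max_right _ _
    · simp [hzero x y hy]
  have hk1 : ∀ x, Measurable (k x) := fun x => hk.comp measurable_prodMk_left
  have Am : ∀ N, Measurable fun x => ∫⁻ y, k x y * g N y ∂μ := fun N =>
    Measurable.lintegral_prod_right (hk.mul ((gm N).comp measurable_snd))
  have e1 : ∀ x, ∫⁻ y, k x y * f y ∂μ = ⨆ N, ∫⁻ y, k x y * g N y ∂μ := by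
    intro x
    rw [← lintegral_iSup (fun N => by fun_prop)]
    · exact lintegral_congr fun y => (glim x y).symm
    · intro N N' h y
      exact mul_le_mul_right (gmono y h) _
  have Amono : ∀ x, Monotone fun N => ∫⁻ y, k x y * g N y ∂μ := fun x N N' h =>
    lintegral_mono fun y => mul_le_mul_right (gmono y h) _
  have e2 : ∫⁻ x, (∫⁻ y, k x y * f y ∂μ) ^ 2 ∂μ
      = ⨆ N, ∫⁻ x, (∫⁻ y, k x y * g N y ∂μ) ^ 2 ∂μ := by
    rw [← lintegral_iSup (fun N => (Am N).pow_const 2)]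
    · refine lintegral_congr fun x => ?_
      rw [e1, ENNReal.iSup_pow]
    · intro N N' h x
      exact pow_le_pow_left' (Amono x h) 2
  rw [e2]
  refine iSup_le fun N => ?_
  refine (lintegral_sq_kernel_le_of_ne_top μ hk hS hM (gm N) ?_).trans ?_
  · obtain ⟨B, hB, hkB⟩ := hbdd N
    have : ∀ x, ∫⁻ y, k x y * g N y ∂μ ≤ B * N * μ univ := by
      intro x
      calc _ ≤ ∫⁻ _, B * N ∂μ := by
            refine lintegral_mono fun y => ?_
            by_cases hy : y ∈ s N
            · refine mul_le_mul' (hkB x y hy) ?_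
              rw [hg]; simp only; rw [indicator_of_mem hy]; exact min_le_right _ _
            · rw [hg]; simp only; rw [indicator_of_notMem hy]; simp
        _ = _ := by simp
    refine ((lintegral_mono fun x => pow_le_pow_left' (this x) 2).trans_lt ?_).ne
    rw [lintegral_const]
    have := measure_lt_top μ univ
    finiteness
  · gcongr with x
    exact gle N x

/-- The transpose of an `L²`-bounded positive kernel is `L²`-bounded with the same constant. -/
theorem lintegral_sq_kernel_transpose_le {α : Type*} [MeasurableSpace α] (μ : Measure α)
    [IsFiniteMeasure μ] {k : α → α → ℝ≥0∞} (hk : Measurable (Function.uncurry k)) {C : ℝ≥0∞}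
    (hC : ∀ f : α → ℝ≥0∞, Measurable f →
      ∫⁻ x, (∫⁻ y, k x y * f y ∂μ) ^ 2 ∂μ ≤ C * ∫⁻ x, f x ^ 2 ∂μ)
    {f : α → ℝ≥0∞} (hf : Measurable f) :
    ∫⁻ x, (∫⁻ y, k y x * f y ∂μ) ^ 2 ∂μ ≤ C * ∫⁻ x, f x ^ 2 ∂μ := by
  set φ : α → ℝ≥0∞ := fun x => ∫⁻ y, k y x * f y ∂μ with hφ
  have φm : Measurable φ :=
    Measurable.lintegral_prod_right' (f := fun q : α × α => k q.2 q.1 * f q.2) (by fun_prop)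
  have hlim : ∀ x, ⨆ N : ℕ, min (φ x) N = φ x := by
    intro x
    refine le_antisymm (iSup_le fun N => min_le_left _ _) ?_
    refine le_of_forall_lt fun c hc => ?_
    obtain ⟨N, hN⟩ := ENNReal.exists_nat_gt (hc.trans_le le_top).ne
    exact (lt_min hc hN).trans_le (le_iSup (fun N : ℕ => min (φ x) (N : ℝ≥0∞)) N)
  have e : ∫⁻ x, φ x ^ 2 ∂μ = ⨆ N : ℕ, ∫⁻ x, min (φ x) N ^ 2 ∂μ := by
    rw [← lintegral_iSup (fun N => by fun_prop)]
    · refine lintegral_congr fun x => ?_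
      rw [← ENNReal.iSup_pow, hlim]
    · intro N N' h x
      simp only
      gcongr
  rw [e]
  refine iSup_le fun N => ?_
  have hm : Measurable fun x => min (φ x) (N : ℝ≥0∞) := by fun_prop
  have hfin : ∫⁻ x, min (φ x) (N : ℝ≥0∞) ^ 2 ∂μ ≠ ⊤ := by
    refine ((lintegral_mono fun x => pow_le_pow_left' (min_le_right _ _) 2).trans_lt ?_).ne
    rw [lintegral_const]
    have := measure_lt_top μ univ
    finiteness
  have Am : Measurable fun y => ∫⁻ x, k y x * min (φ x) N ∂μ :=
    Measurable.lintegral_prod_right' (f := fun q : α × α => k q.1 q.2 * min (φ q.2) N)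
      (by fun_prop)
  refine ENNReal.le_of_sq_le_mul hfin ?_
  calc (∫⁻ x, min (φ x) (N : ℝ≥0∞) ^ 2 ∂μ) ^ 2
      ≤ (∫⁻ x, φ x * min (φ x) N ∂μ) ^ 2 := by
        gcongr with x
        rw [sq]
        gcongr
        exact min_le_left _ _
    _ = (∫⁻ y, f y * ∫⁻ x, k y x * min (φ x) N ∂μ ∂μ) ^ 2 := by
        congr 1
        have : ∀ x, φ x * min (φ x) N = ∫⁻ y, k y x * f y * min (φ x) N ∂μ := fun x => by
          rw [lintegral_mul_const _ (by fun_prop)]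
        simp_rw [this]
        rw [lintegral_lintegral_swap (Measurable.aemeasurable (by fun_prop))]
        refine lintegral_congr fun y => ?_
        rw [← lintegral_const_mul _ (by fun_prop)]
        exact lintegral_congr fun x => by ring
    _ ≤ (∫⁻ y, f y ^ 2 ∂μ) * ∫⁻ y, (∫⁻ x, k y x * min (φ x) N ∂μ) ^ 2 ∂μ :=
        sq_lintegral_mul_le μ hf.aemeasurable Am.aemeasurable
    _ ≤ (∫⁻ y, f y ^ 2 ∂μ) * (C * ∫⁻ x, min (φ x) (N : ℝ≥0∞) ^ 2 ∂μ) := by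
        gcongr
        exact hC _ hm
    _ = _ := by ring

/-- The Poisson-like bump of height `r⁻ⁿ` and width `r`. -/
noncomputable def poissonBump (n : ℕ) (r t : ℝ) : ℝ := r / (max t r) ^ (n + 1)

theorem poissonBump_nonneg (n : ℕ) {r t : ℝ} (hr : 0 ≤ r) : 0 ≤ poissonBump n r t :=
  div_nonneg hr (pow_nonneg (hr.trans (le_max_right _ _)) _)

theorem poissonBump_le (n : ℕ) {r t : ℝ} (hr : 0 < r) : poissonBump n r t ≤ (r ^ n)⁻¹ := by
  unfold poissonBump
  calc r / (max t r) ^ (n + 1) ≤ r / r ^ (n + 1) := by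
        gcongr
        exact le_max_right _ _
    _ = _ := by field_simp; ring

@[fun_prop]
theorem Measurable.poissonBump {α : Type*} [MeasurableSpace α] (n : ℕ) {f g : α → ℝ}
    (hf : Measurable f) (hg : Measurable g) :
    Measurable fun x => poissonBump n (f x) (g x) := by
  unfold _root_.poissonBump
  fun_prop

theorem poissonBump_mul_le (n : ℕ) {r s a b t : ℝ} (hr : 0 ≤ r) (hs : 0 ≤ s) (h : t ≤ a + b) :
    poissonBump n r a * poissonBump n s b ≤
      2 ^ (n + 1) *
        (poissonBump n s t * poissonBump n r a + poissonBump n r t * poissonBump n s b) := by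
  have aux : ∀ {r a t : ℝ}, 0 ≤ r → t ≤ 2 * a →
      poissonBump n r a ≤ 2 ^ (n + 1) * poissonBump n r t := by
    intro r a t hr h
    rcases hr.eq_or_lt with rfl | hr'
    · simp [poissonBump]
    have h1 : max t r ≤ 2 * max a r := by
      refine max_le (h.trans ?_) ?_
      · gcongr; exact le_max_left _ _
      · linarith [le_max_right a r]
    have h2 : 0 < max t r := lt_of_lt_of_le hr' (le_max_right _ _)
    have h3 : 0 < max a r := lt_of_lt_of_le hr' (le_max_right _ _)
    unfold poissonBump
    rw [mul_div_assoc', div_le_div_iff₀ (by positivity) (by positivity)]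
    calc r * (max t r) ^ (n + 1) ≤ r * (2 * max a r) ^ (n + 1) := by gcongr
      _ = _ := by rw [mul_pow]; ring
  have p1 := poissonBump_nonneg n (t := a) hr
  have p2 := poissonBump_nonneg n (t := b) hs
  have p3 := poissonBump_nonneg n (t := t) hr
  have p4 := poissonBump_nonneg n (t := t) hs
  rcases le_total a b with hab | hab
  · have := aux hs (show t ≤ 2 * b by linarith)
    calc _ ≤ poissonBump n r a * (2 ^ (n + 1) * poissonBump n s t) := by gcongr
      _ = 2 ^ (n + 1) * (poissonBump n s t * poissonBump n r a + 0) := by ring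
      _ ≤ _ := by gcongr; positivity
  · have := aux hr (show t ≤ 2 * a by linarith)
    calc _ ≤ (2 ^ (n + 1) * poissonBump n r t) * poissonBump n s b := by gcongr
      _ = 2 ^ (n + 1) * (0 + poissonBump n r t * poissonBump n s b) := by ring
      _ ≤ _ := by gcongr; positivity

theorem poissonBump_le_tsum (n : ℕ) {r t : ℝ} (hr : 0 < r) :
    ENNReal.ofReal (poissonBump n r t) ≤
      ∑' k : ℕ, {s : ℝ | s ≤ 2 ^ (k + 1) * r}.indicator
        (fun _ => ENNReal.ofReal ((r ^ n)⁻¹ * ((2 ^ (k * (n + 1)))⁻¹))) t := by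
  obtain ⟨k, hk1, hk2⟩ : ∃ k : ℕ, t ≤ 2 ^ (k + 1) * r ∧ 2 ^ k * r ≤ max t r := by
    have hex : ∃ k : ℕ, t ≤ 2 ^ (k + 1) * r := by
      obtain ⟨k, hk⟩ := pow_unbounded_of_one_lt (t / r) (one_lt_two)
      refine ⟨k, ?_⟩
      rw [div_lt_iff₀ hr] at hk
      refine hk.le.trans ?_
      gcongr
      · norm_num
      · omega
    classical
    refine ⟨Nat.find hex, Nat.find_spec hex, ?_⟩
    rcases Nat.eq_zero_or_pos (Nat.find hex) with h0 | h0
    · rw [h0]; simp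
    · have := Nat.find_min hex (m := Nat.find hex - 1) (by omega)
      rw [Nat.sub_add_cancel h0] at this
      exact (not_le.1 this).le.trans (le_max_left _ _)
  refine le_trans ?_ (ENNReal.le_tsum k)
  rw [indicator_of_mem (show t ∈ {s : ℝ | s ≤ 2 ^ (k + 1) * r} from hk1)]
  apply ENNReal.ofReal_le_ofReal
  unfold poissonBump
  calc r / (max t r) ^ (n + 1) ≤ r / (2 ^ k * r) ^ (n + 1) := by gcongr
    _ = _ := by rw [mul_pow, ← pow_mul]; field_simp; ring

/-- The integral of a Poisson-like bump against a measure of growth `n`. -/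
theorem lintegral_poissonBump_le {d n : ℕ} {μ : Measure (Euc d)} {c : ℝ} (hc : 0 ≤ c)
    (hμ : GrowthDeg n μ c) {r : ℝ} (hr : 0 ≤ r) (x : Euc d) :
    ∫⁻ y, ENNReal.ofReal (poissonBump n r ‖y - x‖) ∂μ ≤ ENNReal.ofReal (c * 2 ^ (n + 1)) := by
  rcases hr.eq_or_lt with rfl | hr'
  · simp [poissonBump]
  calc ∫⁻ y, ENNReal.ofReal (poissonBump n r ‖y - x‖) ∂μ
      ≤ ∫⁻ y, ∑' k : ℕ, (closedBall x (2 ^ (k + 1) * r)).indicator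
        (fun _ => ENNReal.ofReal ((r ^ n)⁻¹ * ((2 ^ (k * (n + 1)))⁻¹))) y ∂μ := by
        refine lintegral_mono fun y => (poissonBump_le_tsum n hr').trans (le_of_eq ?_)
        refine tsum_congr fun k => ?_
        simp only [indicator, mem_ofPred_eq, mem_closedBall, dist_eq_norm]
    _ = ∑' k : ℕ, ENNReal.ofReal ((r ^ n)⁻¹ * ((2 ^ (k * (n + 1)))⁻¹)) *
          μ (closedBall x (2 ^ (k + 1) * r)) := by
        rw [lintegral_tsum fun k =>
          (measurable_const.indicator measurableSet_closedBall).aemeasurable]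
        refine tsum_congr fun k => ?_
        rw [lintegral_indicator_const measurableSet_closedBall]
    _ ≤ ∑' k : ℕ, ENNReal.ofReal (c * 2 ^ n * (1 / 2) ^ k) := by
        refine ENNReal.tsum_le_tsum fun k => ?_
        refine (mul_le_mul_right (hμ x _ (by positivity)) _).trans ?_
        rw [← ENNReal.ofReal_mul (by positivity)]
        apply ENNReal.ofReal_le_ofReal
        apply le_of_eq
        rw [mul_pow, mul_add, pow_add, ← pow_mul, add_mul, pow_add, one_div, inv_pow]
        field_simp
        ring
    _ = ENNReal.ofReal (∑' k : ℕ, c * 2 ^ n * (1 / 2) ^ k) := by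
        rw [ENNReal.ofReal_tsum_of_nonneg (fun k => by positivity)]
        exact (summable_geometric_of_lt_one (by norm_num) (by norm_num)).mul_left _
    _ = _ := by
        rw [tsum_mul_left, tsum_geometric_two]
        congr 1
        ring

/-- `L²`-boundedness of the Poisson-like operator with variable scale, for measures of growth
`n`. The constant depends only on `n` and the growth constant. -/
theorem lintegral_sq_poissonBump_le {d n : ℕ} {μ : Measure (Euc d)} [IsFiniteMeasure μ] {c : ℝ}
    (hc : 0 ≤ c) (hμ : GrowthDeg n μ c) {ρ : Euc d → ℝ} (hρ : Measurable ρ) (hρ0 : ∀ x, 0 ≤ ρ x)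
    {f : Euc d → ℝ≥0∞} (hf : Measurable f) :
    ∫⁻ x, (∫⁻ y, ENNReal.ofReal (poissonBump n (ρ y) ‖x - y‖) * f y ∂μ) ^ 2 ∂μ ≤
      (2 * ENNReal.ofReal (2 ^ (n + 1)) * ENNReal.ofReal (c * 2 ^ (n + 1))) ^ 2 *
        ∫⁻ x, f x ^ 2 ∂μ := by
  refine lintegral_sq_kernel_le μ
    (k := fun x y => ENNReal.ofReal (poissonBump n (ρ y) ‖x - y‖))
    (s := fun N : ℕ => {y | 1 / (N + 1 : ℝ) ≤ ρ y}) ?_ ?_ ?_ ?_ ?_ ?_ ?_ hf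
  · simp only [Function.uncurry_def]
    fun_prop
  · exact fun y => lintegral_poissonBump_le hc hμ (hρ0 y) y
  · intro x y z
    rw [← ENNReal.ofReal_mul (poissonBump_nonneg _ (hρ0 _)),
      ← ENNReal.ofReal_mul (poissonBump_nonneg _ (hρ0 _)),
      ← ENNReal.ofReal_mul (poissonBump_nonneg _ (hρ0 _)), ← ENNReal.ofReal_add
        (mul_nonneg (poissonBump_nonneg _ (hρ0 _)) (poissonBump_nonneg _ (hρ0 _)))
        (mul_nonneg (poissonBump_nonneg _ (hρ0 _)) (poissonBump_nonneg _ (hρ0 _))),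
      ← ENNReal.ofReal_mul (by positivity)]
    apply ENNReal.ofReal_le_ofReal
    rw [norm_sub_rev z y]
    refine poissonBump_mul_le n (hρ0 y) (hρ0 z) ?_
    calc ‖y - z‖ = ‖(x - z) - (x - y)‖ := by congr 1; abel
      _ ≤ _ := by rw [add_comm]; exact norm_sub_le _ _
  · intro N
    exact measurableSet_le measurable_const hρ
  · intro N N' h y hy
    simp only [mem_ofPred_eq] at hy ⊢
    refine le_trans ?_ hy
    gcongr
  · intro N
    refine ⟨ENNReal.ofReal (((1 / (N + 1 : ℝ)) ^ n)⁻¹), by finiteness, fun x y hy => ?_⟩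
    apply ENNReal.ofReal_le_ofReal
    have h1 : (0:ℝ) < 1 / (N + 1 : ℝ) := by positivity
    have hy' : 1 / (N + 1 : ℝ) ≤ ρ y := hy
    refine (poissonBump_le n (h1.trans_le hy')).trans ?_
    gcongr
  · intro x y hy
    have : ρ y = 0 := by
      refine le_antisymm (le_of_not_gt fun h => hy ?_) (hρ0 y)
      obtain ⟨N, hN⟩ := exists_nat_one_div_lt h
      exact mem_iUnion.2 ⟨N, hN.le⟩
    simp [poissonBump, this]

theorem ENNReal.add_sq_le_two_mul (a b : ℝ≥0∞) : (a + b) ^ 2 ≤ 2 * (a ^ 2 + b ^ 2) := by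
  have h := ENNReal.rpow_add_le_mul_rpow_add_rpow a b (p := 2) (by norm_num)
  norm_num at h
  exact h

/-- The smoothly regularized Riesz kernel `x / (|x|² + ε²)^((n+1)/2)`. -/
noncomputable def rieszKer (n : ℕ) {d : ℕ} (ε : ℝ) (x : Euc d) : Euc d :=
  (√(‖x‖ ^ 2 + ε ^ 2) ^ (n + 1))⁻¹ • x

/-- The smoothly regularized Riesz transform of `f μ`. -/
noncomputable def smoothRiesz (n : ℕ) {d : ℕ} (μ : Measure (Euc d)) (ε : ℝ) (f : Euc d → ℝ)
    (x : Euc d) : Euc d :=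
  ∫ y, f y • rieszKer n ε (x - y) ∂μ

/-- Uniform `L²`-boundedness of the smoothly regularized Riesz transforms. -/
def SmoothRieszBounded (n : ℕ) {d : ℕ} (μ : Measure (Euc d)) : Prop :=
  ∃ C : ℝ≥0∞, C ≠ ⊤ ∧ ∀ ε : ℝ, 0 < ε → ∀ f : Euc d → ℝ, Measurable f →
    ∫⁻ x, ‖f x‖ₑ ^ 2 ∂μ ≠ ⊤ →
    ∫⁻ x, ‖smoothRiesz n μ ε f x‖ₑ ^ 2 ∂μ ≤ C * ∫⁻ x, ‖f x‖ₑ ^ 2 ∂μ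

theorem continuous_rieszKer (n : ℕ) {d : ℕ} {ε : ℝ} (hε : 0 < ε) :
    Continuous (rieszKer n ε : Euc d → Euc d) := by
  have h : Continuous fun x : Euc d => (√(‖x‖ ^ 2 + ε ^ 2) ^ (n + 1))⁻¹ :=
    Continuous.inv₀ (by fun_prop) fun x => by positivity
  exact h.smul continuous_id

theorem abs_inv_pow_sub_inv_pow_mul_le {N : ℕ} {a b : ℝ} (ha : 0 < a) (hb : 0 < b) :
    |(a ^ N)⁻¹ - (b ^ N)⁻¹| * b ≤ N * |a - b| / (min a b) ^ N := by
  have key : ∀ {a b : ℝ}, 0 < a → 0 < b → a ≤ b →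
      0 ≤ (a ^ N)⁻¹ - (b ^ N)⁻¹ ∧ ((a ^ N)⁻¹ - (b ^ N)⁻¹) * b ≤ N * (b - a) / a ^ N := by
    intro a b ha hb hab
    refine ⟨sub_nonneg.2 (by gcongr), ?_⟩
    have h1 := one_add_mul_le_pow (a := a / b - 1) (by have := div_pos ha hb; linarith) N
    have h2 : ((a ^ N)⁻¹ - (b ^ N)⁻¹) * b = (a ^ N)⁻¹ * ((1 - (a / b) ^ N) * b) := by
      rw [div_pow]; field_simp
    have h4 : (1 + (a / b - 1)) = a / b := by ring
    rw [h4] at h1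
    have h3 : (1 - (a / b) ^ N) * b ≤ N * (b - a) := by
      calc (1 - (a / b) ^ N) * b ≤ (- (N * (a / b - 1))) * b := by
            gcongr; linarith
        _ = _ := by field_simp; ring
    rw [h2]
    exact (mul_le_mul_of_nonneg_left h3 (by positivity)).trans_eq (by ring)
  rcases le_total a b with h | h
  · obtain ⟨k1, k2⟩ := key ha hb h
    rw [abs_of_nonneg k1, abs_sub_comm, abs_of_nonneg (sub_nonneg.2 h), min_eq_left h]
    exact k2
  · obtain ⟨k1, k2⟩ := key hb ha h
    rw [abs_sub_comm, abs_of_nonneg k1, abs_of_nonneg (sub_nonneg.2 h), min_eq_right h]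
    refine le_trans ?_ k2
    gcongr

theorem norm_inv_pow_smul_sub_le {E : Type*} [NormedAddCommGroup E] [NormedSpace ℝ E] {N : ℕ}
    {a b : ℝ} (ha : 0 < a) (hb : 0 < b) {x y : E} (hy : ‖y‖ ≤ b) :
    ‖(a ^ N)⁻¹ • x - (b ^ N)⁻¹ • y‖ ≤ (‖x - y‖ + N * |a - b|) / (min a b) ^ N := by
  have hm : 0 < min a b := lt_min ha hb
  calc ‖(a ^ N)⁻¹ • x - (b ^ N)⁻¹ • y‖
      = ‖(a ^ N)⁻¹ • (x - y) + ((a ^ N)⁻¹ - (b ^ N)⁻¹) • y‖ := by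
        congr 1; rw [smul_sub, sub_smul]; abel
    _ ≤ ‖(a ^ N)⁻¹ • (x - y)‖ + ‖((a ^ N)⁻¹ - (b ^ N)⁻¹) • y‖ := norm_add_le _ _
    _ = (a ^ N)⁻¹ * ‖x - y‖ + |(a ^ N)⁻¹ - (b ^ N)⁻¹| * ‖y‖ := by
        rw [norm_smul, norm_smul, Real.norm_eq_abs, Real.norm_eq_abs,
          abs_of_pos (inv_pos.2 (pow_pos ha N))]
    _ ≤ ((min a b) ^ N)⁻¹ * ‖x - y‖ + |(a ^ N)⁻¹ - (b ^ N)⁻¹| * b := by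
        gcongr
        exact min_le_left _ _
    _ ≤ ((min a b) ^ N)⁻¹ * ‖x - y‖ + N * |a - b| / (min a b) ^ N := by
        gcongr
        exact abs_inv_pow_sub_inv_pow_mul_le ha hb
    _ = _ := by ring

theorem abs_sqrt_sq_add_sub_le {a b ε : ℝ} (ha : 0 ≤ a) (hb : 0 ≤ b) (hε : 0 < ε) :
    |√(a ^ 2 + ε ^ 2) - √(b ^ 2 + ε ^ 2)| ≤ |a - b| := by
  have key : ∀ {a b : ℝ}, 0 ≤ a → 0 ≤ b → a ≤ b →
      √(b ^ 2 + ε ^ 2) ≤ √(a ^ 2 + ε ^ 2) + (b - a) := by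
    intro a b ha hb hab
    have h1 : a ≤ √(a ^ 2 + ε ^ 2) := Real.le_sqrt_of_sq_le (by nlinarith)
    apply Real.sqrt_le_iff.2
    refine ⟨by linarith, ?_⟩
    have h2 := Real.sq_sqrt (show 0 ≤ a ^ 2 + ε ^ 2 by positivity)
    nlinarith
  have mono : ∀ {a b : ℝ}, 0 ≤ a → a ≤ b → √(a ^ 2 + ε ^ 2) ≤ √(b ^ 2 + ε ^ 2) :=
    fun ha hab => Real.sqrt_le_sqrt (by gcongr)
  rcases le_total a b with h | h
  · rw [abs_sub_comm, abs_sub_comm a b, abs_of_nonneg (sub_nonneg.2 h),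
      abs_of_nonneg (sub_nonneg.2 (mono ha h))]
    linarith [key ha hb h]
  · rw [abs_of_nonneg (sub_nonneg.2 h), abs_of_nonneg (sub_nonneg.2 (mono hb h))]
    linarith [key hb ha h]

theorem le_sqrt_sq_add {a ε : ℝ} : a ≤ √(a ^ 2 + ε ^ 2) :=
  Real.le_sqrt_of_sq_le (by nlinarith [sq_nonneg ε])

theorem le_sqrt_sq_add' {a ε : ℝ} : ε ≤ √(a ^ 2 + ε ^ 2) :=
  Real.le_sqrt_of_sq_le (by nlinarith [sq_nonneg a])

/-- Smoothness estimate for the regularized Riesz kernel, uniform in `ε`. -/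
theorem norm_rieszKer_sub_le (n : ℕ) {d : ℕ} {ε r : ℝ} (hε : 0 < ε) (hr : 0 < r) {x y : Euc d}
    (hx : r ≤ ‖x‖) (hy : r ≤ ‖y‖) :
    ‖rieszKer n ε x - rieszKer n ε y‖ ≤ (n + 2) * ‖x - y‖ / r ^ (n + 1) := by
  have h1 : r ≤ min √(‖x‖ ^ 2 + ε ^ 2) √(‖y‖ ^ 2 + ε ^ 2) :=
    le_min (hx.trans le_sqrt_sq_add) (hy.trans le_sqrt_sq_add)
  refine (norm_inv_pow_smul_sub_le (by positivity) (by positivity) le_sqrt_sq_add).trans ?_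
  have h2 : |√(‖x‖ ^ 2 + ε ^ 2) - √(‖y‖ ^ 2 + ε ^ 2)| ≤ ‖x - y‖ :=
    (abs_sqrt_sq_add_sub_le (norm_nonneg _) (norm_nonneg _) hε).trans (abs_norm_sub_norm_le _ _)
  calc _ ≤ (‖x - y‖ + (n + 1 : ℕ) * ‖x - y‖) / r ^ (n + 1) := by gcongr
    _ = _ := by push_cast; ring

theorem norm_rieszKer_le (n : ℕ) {d : ℕ} {ε : ℝ} (hε : 0 < ε) (x : Euc d) :
    ‖rieszKer n ε x‖ ≤ (ε ^ n)⁻¹ := by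
  unfold rieszKer
  rw [norm_smul, Real.norm_eq_abs, abs_of_pos (by positivity), pow_succ, mul_inv, mul_assoc]
  have h0 : 0 < √(‖x‖ ^ 2 + ε ^ 2) := by positivity
  calc _ ≤ (ε ^ n)⁻¹ * 1 := by
        gcongr
        · exact le_sqrt_sq_add'
        · rw [inv_mul_le_one₀ h0]
          exact le_sqrt_sq_add
    _ = _ := mul_one _

/-- The smooth regularization and the sharp truncation of the Riesz kernel differ by a
Poisson-like bump. -/
theorem norm_rieszKer_sub_trunc_le (n : ℕ) {d : ℕ} {ε : ℝ} (hε : 0 < ε) (x : Euc d) :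
    ‖rieszKer n ε x - {z : Euc d | ε < ‖z‖}.indicator (fun z => (‖z‖ ^ (n + 1))⁻¹ • z) x‖ ≤
      (n + 1) * poissonBump n ε ‖x‖ := by
  by_cases hx : ε < ‖x‖
  · rw [indicator_of_mem (show x ∈ {z : Euc d | ε < ‖z‖} from hx)]
    have h0 : 0 < ‖x‖ := hε.trans hx
    refine (norm_inv_pow_smul_sub_le (by positivity) h0 le_rfl).trans ?_
    rw [min_eq_right le_sqrt_sq_add, poissonBump, max_eq_left hx.le, sub_self, norm_zero, zero_add]
    have h1 : |√(‖x‖ ^ 2 + ε ^ 2) - ‖x‖| ≤ ε := by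
      rw [abs_of_nonneg (sub_nonneg.2 le_sqrt_sq_add)]
      have : √(‖x‖ ^ 2 + ε ^ 2) ≤ ‖x‖ + ε := by
        apply Real.sqrt_le_iff.2
        constructor
        · positivity
        · nlinarith
      linarith
    calc _ ≤ ((n + 1 : ℕ) * ε) / ‖x‖ ^ (n + 1) := by gcongr
      _ = _ := by push_cast; ring
  · rw [indicator_of_notMem (show x ∉ {z : Euc d | ε < ‖z‖} from hx), sub_zero]
    refine (norm_rieszKer_le n hε x).trans ?_
    rw [poissonBump, max_eq_right (not_lt.1 hx)]
    have : ε / ε ^ (n + 1) = (ε ^ n)⁻¹ := by field_simp; ring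
    rw [this]
    have h2 : 0 ≤ (ε ^ n)⁻¹ := by positivity
    have h3 : (0:ℝ) ≤ n := by positivity
    nlinarith

theorem integrable_of_lintegral_sq_ne_top {α E : Type*} [MeasurableSpace α] {μ : Measure α}
    [IsFiniteMeasure μ] [NormedAddCommGroup E] {f : α → E} (hf : AEStronglyMeasurable f μ)
    (h : ∫⁻ x, ‖f x‖ₑ ^ 2 ∂μ ≠ ⊤) : Integrable f μ := by
  have : MemLp f 2 μ := by
    refine ⟨hf, ?_⟩
    rw [eLpNorm_lt_top_iff_lintegral_rpow_enorm_lt_top (by norm_num) (by norm_num)]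
    simpa using h.lt_top
  exact this.integrable (by norm_num)

/-- The pointwise difference of the sharp and the smooth truncations. -/
theorem enorm_truncRiesz_sub_smoothRiesz_le (n : ℕ) {d : ℕ} {μ : Measure (Euc d)} {ε : ℝ}
    (hε : 0 < ε) {f : Euc d → ℝ} (hf : Integrable f μ) (x : Euc d) :
    ‖smoothRiesz n μ ε f x - truncRiesz n μ ε f x‖ₑ ≤
      ENNReal.ofReal (n + 1) *
        ∫⁻ y, ENNReal.ofReal (poissonBump n ε ‖x - y‖) * ‖f y‖ₑ ∂μ := by
  set K : Euc d → Euc d := {z : Euc d | ε < ‖z‖}.indicator (fun z => (‖z‖ ^ (n + 1))⁻¹ • z) with hK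
  have hS : MeasurableSet {z : Euc d | ε < ‖z‖} :=
    measurableSet_lt measurable_const measurable_norm
  have Km : Measurable K := by
    refine Measurable.indicator ?_ hS
    fun_prop
  have e : truncRiesz n μ ε f x = ∫ y, f y • K (x - y) ∂μ := by
    unfold truncRiesz
    rw [← integral_indicator (measurableSet_lt measurable_const (by fun_prop))]
    refine integral_congr_ae (Eventually.of_forall fun y => ?_)
    simp only [hK, indicator, mem_ofPred_eq]
    split_ifs
    · rw [smul_comm]
    · simp
  have i1 : Integrable (fun y => f y • rieszKer n ε (x - y)) μ := by
    refine Integrable.smul_bdd (C := (ε ^ n)⁻¹) hf ?_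
      (Eventually.of_forall fun y => norm_rieszKer_le n hε _)
    exact ((continuous_rieszKer n hε).comp (by fun_prop)).aestronglyMeasurable
  have i2 : Integrable (fun y => f y • K (x - y)) μ := by
    refine Integrable.smul_bdd (C := (ε ^ n)⁻¹) hf ?_ (Eventually.of_forall fun y => ?_)
    · exact (Km.comp (by fun_prop)).aestronglyMeasurable
    · rw [hK]
      by_cases h : ε < ‖x - y‖
      · rw [indicator_of_mem (show x - y ∈ {z : Euc d | ε < ‖z‖} from h), norm_smul, norm_inv,
          norm_pow, norm_norm, pow_succ, mul_inv, mul_assoc, inv_mul_cancel₀ (hε.trans h).ne',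
          mul_one]
        gcongr
      · rw [indicator_of_notMem (show x - y ∉ {z : Euc d | ε < ‖z‖} from h), norm_zero]
        positivity
  unfold smoothRiesz
  rw [e, ← integral_sub i1 i2]
  refine (enorm_integral_le_lintegral_enorm _).trans ?_
  rw [← lintegral_const_mul' _ _ (by finiteness)]
  refine lintegral_mono fun y => ?_
  rw [← smul_sub, enorm_smul, ← mul_assoc, mul_comm]
  gcongr
  rw [← ENNReal.ofReal_mul (by positivity), ← ofReal_norm]
  exact ENNReal.ofReal_le_ofReal (norm_rieszKer_sub_trunc_le n hε (x - y))

theorem lintegral_sq_le_of_enorm_sub_le {α E : Type*} [MeasurableSpace α] {μ : Measure α}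
    [NormedAddCommGroup E] {F G : α → E} {P : α → ℝ≥0∞} (hP : Measurable P)
    (h : ∀ x, ‖F x - G x‖ₑ ≤ P x) :
    ∫⁻ x, ‖F x‖ₑ ^ 2 ∂μ ≤ 2 * (∫⁻ x, ‖G x‖ₑ ^ 2 ∂μ + ∫⁻ x, P x ^ 2 ∂μ) := by
  rw [← lintegral_add_right _ (by fun_prop), ← lintegral_const_mul' _ _ (by norm_num)]
  refine lintegral_mono fun x => ?_
  refine le_trans ?_ (ENNReal.add_sq_le_two_mul _ _)
  gcongr
  calc ‖F x‖ₑ = ‖G x + (F x - G x)‖ₑ := by congr 1; abel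
    _ ≤ ‖G x‖ₑ + ‖F x - G x‖ₑ := enorm_add_le _ _
    _ ≤ _ := by gcongr; exact h x

theorem lintegral_sq_const_poissonBump_le {d n : ℕ} {μ : Measure (Euc d)} [IsFiniteMeasure μ]
    {c : ℝ} (hc : 0 ≤ c) (hμ : GrowthDeg n μ c) : ∃ C : ℝ≥0∞, C ≠ ⊤ ∧ ∀ ε : ℝ, 0 < ε →
    ∀ f : Euc d → ℝ, Measurable f →
    ∫⁻ x, (ENNReal.ofReal (n + 1) *
        ∫⁻ y, ENNReal.ofReal (poissonBump n ε ‖x - y‖) * ‖f y‖ₑ ∂μ) ^ 2 ∂μ ≤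
      C * ∫⁻ x, ‖f x‖ₑ ^ 2 ∂μ := by
  refine ⟨ENNReal.ofReal (n + 1) ^ 2 *
    (2 * ENNReal.ofReal (2 ^ (n + 1)) * ENNReal.ofReal (c * 2 ^ (n + 1))) ^ 2,
    by finiteness, fun ε hε f hf => ?_⟩
  simp_rw [mul_pow _ _ 2]
  rw [lintegral_const_mul' _ _ (by finiteness), mul_assoc]
  gcongr
  have := lintegral_sq_poissonBump_le hc hμ (ρ := fun _ => ε) measurable_const (fun _ => hε.le)
    (f := fun y => ‖f y‖ₑ) (by fun_prop)
  simpa only [mul_pow] using this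

theorem measurable_lintegral_poissonBump {d n : ℕ} {μ : Measure (Euc d)} [IsFiniteMeasure μ]
    (ε : ℝ) {f : Euc d → ℝ} (hf : Measurable f) :
    Measurable fun x => ENNReal.ofReal (n + 1) *
        ∫⁻ y, ENNReal.ofReal (poissonBump n ε ‖x - y‖) * ‖f y‖ₑ ∂μ := by
  refine Measurable.const_mul (Measurable.lintegral_prod_right' (f := fun q : Euc d × Euc d =>
    ENNReal.ofReal (poissonBump n ε ‖q.1 - q.2‖) * ‖f q.2‖ₑ) ?_) _
  fun_prop

theorem RieszBounded.smooth {d n : ℕ} {μ : Measure (Euc d)} [IsFiniteMeasure μ]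
    {c : ℝ} (hc : 0 ≤ c) (hμ : GrowthDeg n μ c) (h : RieszBounded n μ) :
    SmoothRieszBounded n μ := by
  obtain ⟨C, -, hC⟩ := h
  obtain ⟨C', hC', hP⟩ := lintegral_sq_const_poissonBump_le hc hμ
  refine ⟨2 * (ENNReal.ofReal C + C'), by finiteness, fun ε hε f hf hfin => ?_⟩
  have hi := integrable_of_lintegral_sq_ne_top hf.aestronglyMeasurable hfin
  refine (lintegral_sq_le_of_enorm_sub_le (measurable_lintegral_poissonBump ε hf)
    (enorm_truncRiesz_sub_smoothRiesz_le n hε hi)).trans ?_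
  rw [mul_assoc, add_mul]
  gcongr
  · exact hC ε hε f hf
  · exact hP ε hε f hf

theorem SmoothRieszBounded.riesz {d n : ℕ} {μ : Measure (Euc d)} [IsFiniteMeasure μ]
    {c : ℝ} (hc : 0 ≤ c) (hμ : GrowthDeg n μ c) (h : SmoothRieszBounded n μ) :
    RieszBounded n μ := by
  obtain ⟨C, hCt, hC⟩ := h
  obtain ⟨C', hC', hP⟩ := lintegral_sq_const_poissonBump_le hc hμ
  refine ⟨(2 * (C + C')).toReal + 1, by positivity, fun ε hε f hf => ?_⟩
  by_cases hfin : ∫⁻ x, ‖f x‖ₑ ^ 2 ∂μ = ⊤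
  · have : ∫⁻ x, (‖f x‖₊ : ℝ≥0∞) ^ 2 ∂μ = ⊤ := hfin
    rw [this, ENNReal.mul_top]
    · exact le_top
    · rw [Ne, ENNReal.ofReal_eq_zero, not_le]; positivity
  have hi := integrable_of_lintegral_sq_ne_top hf.aestronglyMeasurable hfin
  refine (lintegral_sq_le_of_enorm_sub_le (F := truncRiesz n μ ε f) (G := smoothRiesz n μ ε f)
    (measurable_lintegral_poissonBump (n := n) (μ := μ) ε hf)
    (fun x => ?_)).trans (?_ : _ ≤ _ * ∫⁻ x, ‖f x‖ₑ ^ 2 ∂μ)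
  · rw [← enorm_neg, neg_sub]
    exact enorm_truncRiesz_sub_smoothRiesz_le n hε hi x
  · calc _ ≤ 2 * (C * ∫⁻ x, ‖f x‖ₑ ^ 2 ∂μ + C' * ∫⁻ x, ‖f x‖ₑ ^ 2 ∂μ) := by
          gcongr
          · exact hC ε hε f hf hfin
          · exact hP ε hε f hf
      _ = (2 * (C + C')) * ∫⁻ x, ‖f x‖ₑ ^ 2 ∂μ := by ring
      _ ≤ _ := by
          gcongr
          rw [ENNReal.ofReal_add (by positivity) (by norm_num),
            ENNReal.ofReal_toReal (by finiteness)]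
          exact le_self_add

section FourierBilinear

open scoped FourierTransform RealInnerProductSpace

variable {V : Type*} [NormedAddCommGroup V] [InnerProductSpace ℝ V] [FiniteDimensional ℝ V]
  [MeasurableSpace V] [BorelSpace V]

theorem Real.continuous_fourier_of_integrable {f : V → ℂ} (hf : Integrable f) :
    Continuous (𝓕 f) :=
  VectorFourier.fourierIntegral_continuous Real.continuous_fourierChar
    (by exact continuous_inner) hf

theorem Real.integral_fourier_mul_eq_flip {f g : V → ℂ} (hf : Integrable f) (hg : Integrable g) :
    ∫ x, 𝓕 f x * g x = ∫ x, f x * 𝓕 g x := by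
  simpa using! (VectorFourier.integral_fourierIntegral_smul_eq_flip (L := innerₗ V)
    Real.continuous_fourierChar continuous_inner hf hg)

theorem Real.norm_fourier_le (f : V → ℂ) (w : V) : ‖𝓕 f w‖ ≤ ∫ v, ‖f v‖ :=
  VectorFourier.norm_fourierIntegral_le_integral_norm _ _ _ _ _

theorem integrable_mul_fourier {H f : V → ℂ} (hH : Integrable H) (hf : Integrable f) :
    Integrable (fun v => H v * 𝓕 f v) :=
  hH.mul_bdd (c := ∫ v, ‖f v‖) (Real.continuous_fourier_of_integrable hf).aestronglyMeasurable
    (Eventually.of_forall (Real.norm_fourier_le f))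

/-- Convolution against a Fourier transform. -/
theorem integral_fourier_sub_mul {H f : V → ℂ} (hH : Integrable H) (hf : Integrable f) (x : V) :
    ∫ y, 𝓕 H (x - y) * f y = 𝓕 (fun v => H v * 𝓕 (fun y => f (-y)) v) x := by
  have h1 : ∀ y, 𝓕 H (x - y) = 𝓕 (fun v => (Real.fourierChar (-⟪v, x⟫)) • H v) (-y) := by
    intro y
    simp only [Real.fourier_eq]
    congr 1; ext v
    rw [smul_smul, ← AddChar.map_add_eq_mul]
    congr 2
    rw [inner_sub_right, inner_neg_right]; ring
  have hH' : Integrable (fun v => (Real.fourierChar (-⟪v, x⟫)) • H v) :=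
    (Real.fourierIntegral_convergent_iff x).2 hH
  simp_rw [h1]
  rw [← integral_neg_eq_self]
  simp only [neg_neg]
  rw [Real.integral_fourier_mul_eq_flip hH' hf.comp_neg, Real.fourier_eq]
  congr 1; ext v
  simp only [Circle.smul_def, smul_eq_mul]; ring

theorem integral_prod_fourier_sub_mul {H f g : V → ℂ} (hH : Integrable H) (hf : Integrable f)
    (hg : Integrable g) :
    ∫ p : V × V, 𝓕 H (p.1 - p.2) * (g p.1 * f p.2) ∂(volume.prod volume) =
      ∫ v, H v * 𝓕 (fun y => f (-y)) v * 𝓕 g v := by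
  have hi : Integrable (fun p : V × V => 𝓕 H (p.1 - p.2) * (g p.1 * f p.2))
      (volume.prod volume) :=
    (hg.mul_prod hf).bdd_mul (c := ∫ v, ‖H v‖)
      ((Real.continuous_fourier_of_integrable hH).comp (by fun_prop)).aestronglyMeasurable
      (Eventually.of_forall fun p => Real.norm_fourier_le H _)
  rw [integral_prod _ hi]
  have : ∀ x, ∫ y, 𝓕 H (x - y) * (g x * f y) =
      𝓕 (fun v => H v * 𝓕 (fun y => f (-y)) v) x * g x := by
    intro x
    rw [← integral_fourier_sub_mul hH hf, ← integral_mul_const]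
    congr 1; ext y; ring
  simp_rw [this]
  rw [Real.integral_fourier_mul_eq_flip (integrable_mul_fourier hH hf.comp_neg) hg]

theorem fourier_comp_neg_eq_conj (f : V → ℝ) (w : V) :
    𝓕 (fun y => (f (-y) : ℂ)) w = (starRingEnd ℂ) (𝓕 (fun y => (f y : ℂ)) w) := by
  rw [Real.fourier_eq, Real.fourier_eq, ← integral_conj, ← integral_neg_eq_self]
  congr 1; ext v
  simp only [neg_neg, inner_neg_left, Circle.smul_def, smul_eq_mul, map_mul, Complex.conj_ofReal]
  rw [AddChar.map_neg_eq_inv, Circle.coe_inv_eq_conj]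
  simp

/-- A convolution form against an integrable kernel is bounded on `L²`. -/
theorem lintegral_prod_sub_mul_le {k : V → ℝ≥0∞} (hk : Measurable k) {f : V → ℝ≥0∞}
    (hf : Measurable f) :
    ∫⁻ p : V × V, k (p.1 - p.2) * (f p.1 * f p.2) ∂(volume.prod volume) ≤
      (∫⁻ v, k v) * ∫⁻ v, f v ^ 2 := by
  have h1 : ∀ a b : ℝ≥0∞, 2 * (a * b) ≤ a ^ 2 + b ^ 2 := by
    intro a b
    rcases eq_or_ne a ⊤ with rfl | ha
    · simp
    rcases eq_or_ne b ⊤ with rfl | hb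
    · simp
    lift a to ℝ≥0 using ha
    lift b to ℝ≥0 using hb
    have := two_mul_le_add_sq (a : ℝ) b
    rw [mul_assoc] at this
    exact_mod_cast this
  have h2 : (2 : ℝ≥0∞) * ∫⁻ p : V × V, k (p.1 - p.2) * (f p.1 * f p.2) ∂(volume.prod volume) ≤
      2 * ((∫⁻ v, k v) * ∫⁻ v, f v ^ 2) := by
    calc _ = ∫⁻ p : V × V, k (p.1 - p.2) * (2 * (f p.1 * f p.2)) ∂(volume.prod volume) := by
          rw [← lintegral_const_mul' _ _ (by norm_num)]
          congr 1; ext p; ring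
      _ ≤ ∫⁻ p : V × V, (k (p.1 - p.2) * f p.1 ^ 2 + k (p.1 - p.2) * f p.2 ^ 2)
            ∂(volume.prod volume) := by
          refine lintegral_mono fun p => ?_
          rw [← mul_add]; gcongr; exact h1 _ _
      _ = (∫⁻ v, k v) * (∫⁻ v, f v ^ 2) + (∫⁻ v, k v) * ∫⁻ v, f v ^ 2 := by
          rw [lintegral_add_left (by fun_prop)]
          congr 1
          · rw [lintegral_prod _ (by fun_prop), ← lintegral_const_mul _ (by fun_prop)]
            congr 1; ext x
            simp only
            rw [lintegral_mul_const _ (by fun_prop), lintegral_sub_left_eq_self k x]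
          · rw [lintegral_prod_symm _ (by fun_prop), ← lintegral_const_mul _ (by fun_prop)]
            congr 1; ext x
            simp only
            rw [lintegral_mul_const _ (by fun_prop), lintegral_sub_right_eq_self k x]
      _ = _ := by ring
  exact (ENNReal.mul_le_mul_iff_right (by norm_num) (by norm_num)).1 h2

theorem integrable_cexp_neg_mul_sq_norm {b : ℝ} (hb : 0 < b) :
    Integrable fun v : V => Complex.exp (-b * ‖v‖ ^ 2) := by
  simpa using GaussianFourier.integrable_cexp_neg_mul_sq_norm_add (V := V) (b := b) (by simpa) 0 0

theorem lintegral_enorm_fourier_gaussian {b : ℝ} (hb : 0 < b) :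
    ∫⁻ w : V, ‖𝓕 (fun v : V => Complex.exp (-b * ‖v‖ ^ 2)) w‖ₑ = 1 := by
  have h1 : ∀ w : V, 𝓕 (fun v : V => Complex.exp (-b * ‖v‖ ^ 2)) w =
      (((Real.pi / b) ^ (Module.finrank ℝ V / 2 : ℝ) *
        Real.exp (-(Real.pi ^ 2 / b) * ‖w‖ ^ 2) : ℝ) : ℂ) := by
    intro w
    rw [fourier_gaussian_innerProductSpace (by simpa)]
    push_cast
    rw [Complex.ofReal_cpow (by positivity)]
    push_cast
    congr 2; ring
  simp_rw [h1]
  have hpos : 0 < Real.pi ^ 2 / b := by positivity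
  have hi : Integrable fun w : V => (Real.pi / b) ^ (Module.finrank ℝ V / 2 : ℝ) *
        Real.exp (-(Real.pi ^ 2 / b) * ‖w‖ ^ 2) := by
    have := (integrable_cexp_neg_mul_sq_norm (V := V) hpos).norm
    refine Integrable.const_mul ?_ _
    convert this using 2 with w
    rw [Complex.norm_exp]
    congr 1
    norm_cast
  have h2 : ∀ w : V, ‖(((Real.pi / b) ^ (Module.finrank ℝ V / 2 : ℝ) *
        Real.exp (-(Real.pi ^ 2 / b) * ‖w‖ ^ 2) : ℝ) : ℂ)‖ₑ =
      ENNReal.ofReal ((Real.pi / b) ^ (Module.finrank ℝ V / 2 : ℝ) *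
        Real.exp (-(Real.pi ^ 2 / b) * ‖w‖ ^ 2)) := by
    intro w
    rw [← ofReal_norm, Complex.norm_real, Real.norm_of_nonneg (by positivity)]
  simp_rw [h2]
  rw [← ofReal_integral_eq_lintegral_ofReal hi (Eventually.of_forall fun w => by positivity),
    integral_const_mul, GaussianFourier.integral_rexp_neg_mul_sq_norm hpos,
    ← Real.mul_rpow (by positivity) (by positivity)]
  have : Real.pi / b * (Real.pi / (Real.pi ^ 2 / b)) = 1 := by field_simp
  rw [this]; simp

/-- The Plancherel inequality for real functions in `L¹ ∩ L²`. -/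
theorem lintegral_sq_fourier_le {f : V → ℝ} (hfm : Measurable f) (hf : Integrable f) :
    ∫⁻ w, ‖𝓕 (fun y => (f y : ℂ)) w‖ₑ ^ 2 ≤ ∫⁻ v, ‖f v‖ₑ ^ 2 := by
  set F := 𝓕 (fun y => (f y : ℂ)) with hF
  have hfc : Integrable fun y => (f y : ℂ) := hf.ofReal
  have hFc : Continuous F := Real.continuous_fourier_of_integrable hfc
  have key : ∀ b : ℝ, 0 < b →
      ∫⁻ w, ENNReal.ofReal (Real.exp (-b * ‖w‖ ^ 2)) * ‖F w‖ₑ ^ 2 ≤ ∫⁻ v, ‖f v‖ₑ ^ 2 := by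
    intro b hb
    have hH := integrable_cexp_neg_mul_sq_norm (V := V) hb
    have h1 := integral_prod_fourier_sub_mul hH hfc hfc
    have h2 : ∀ v : V, Complex.exp (-b * ‖v‖ ^ 2) * 𝓕 (fun y => (f (-y) : ℂ)) v * F v =
        ((Real.exp (-b * ‖v‖ ^ 2) * ‖F v‖ ^ 2 : ℝ) : ℂ) := by
      intro v
      rw [fourier_comp_neg_eq_conj, mul_assoc, ← Complex.normSq_eq_conj_mul_self,
        Complex.normSq_eq_norm_sq]
      push_cast; rfl
    have hi : Integrable fun v : V => Real.exp (-b * ‖v‖ ^ 2) * ‖F v‖ ^ 2 := by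
      have := integrable_mul_fourier (integrable_mul_fourier hH hfc.comp_neg) hfc
      rw [← hF] at this
      simp_rw [h2] at this
      exact_mod_cast this.re
    simp_rw [← hF, h2] at h1
    rw [integral_complex_ofReal] at h1
    have h3 : ∫⁻ w, ENNReal.ofReal (Real.exp (-b * ‖w‖ ^ 2)) * ‖F w‖ₑ ^ 2 =
        ‖((∫ v : V, Real.exp (-b * ‖v‖ ^ 2) * ‖F v‖ ^ 2 : ℝ) : ℂ)‖ₑ := by
      rw [← ofReal_norm, Complex.norm_real, Real.norm_of_nonneg
        (integral_nonneg fun v => by positivity),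
        ofReal_integral_eq_lintegral_ofReal hi (Eventually.of_forall fun w => by positivity)]
      congr 1; ext w
      rw [ENNReal.ofReal_mul (by positivity), ENNReal.ofReal_pow (by positivity), ofReal_norm]
    rw [h3, ← h1]
    refine (enorm_integral_le_lintegral_enorm _).trans ?_
    have h4 := lintegral_prod_sub_mul_le
      (k := fun v : V => ‖𝓕 (fun v : V => Complex.exp (-b * ‖v‖ ^ 2)) v‖ₑ)
      (Real.continuous_fourier_of_integrable hH).measurable.enorm (f := fun v => ‖f v‖ₑ)
      (by fun_prop)
    rw [lintegral_enorm_fourier_gaussian hb, one_mul] at h4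
    refine le_trans (lintegral_mono fun p => ?_) h4
    simp only [enorm_mul]
    gcongr <;> simp [← ofReal_norm]
  have hlim : ∀ w : V, Tendsto (fun k : ℕ => ENNReal.ofReal
      (Real.exp (-(1 / ((k : ℝ) + 1)) * ‖w‖ ^ 2)) * ‖F w‖ₑ ^ 2) atTop (𝓝 (‖F w‖ₑ ^ 2)) := by
    intro w
    have h0 : Tendsto (fun k : ℕ => Real.exp (-(1 / ((k : ℝ) + 1)) * ‖w‖ ^ 2)) atTop
        (𝓝 (Real.exp (-0 * ‖w‖ ^ 2))) :=
      (Real.continuous_exp.tendsto _).comp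
        ((tendsto_one_div_add_atTop_nhds_zero_nat.neg).mul_const _)
    have h1 := ENNReal.Tendsto.mul_const (b := ‖F w‖ₑ ^ 2) (ENNReal.tendsto_ofReal h0)
      (Or.inr (by finiteness))
    simpa using h1
  calc ∫⁻ w, ‖F w‖ₑ ^ 2 = ∫⁻ w, liminf (fun k : ℕ => ENNReal.ofReal
      (Real.exp (-(1 / ((k : ℝ) + 1)) * ‖w‖ ^ 2)) * ‖F w‖ₑ ^ 2) atTop := by
        congr 1; ext w; exact (hlim w).liminf_eq.symm
    _ ≤ liminf (fun k : ℕ => ∫⁻ w, ENNReal.ofReal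
      (Real.exp (-(1 / ((k : ℝ) + 1)) * ‖w‖ ^ 2)) * ‖F w‖ₑ ^ 2) atTop := by
        refine lintegral_liminf_le fun k => ?_
        have := hFc.measurable
        fun_prop
    _ ≤ _ := by
        refine (liminf_le_liminf (Eventually.of_forall fun k => key _ (by positivity))).trans ?_
        simp

end FourierBilinear

theorem hasFDerivAt_cexp_neg_mul_sq_norm {V : Type*} [NormedAddCommGroup V]
    [InnerProductSpace ℝ V] (b : ℝ) (v : V) :
    HasFDerivAt (fun v : V => Complex.exp (-b * ‖v‖ ^ 2))
      ((-(2 * b) * Complex.exp (-b * ‖v‖ ^ 2)) • Complex.ofRealCLM.comp (innerSL ℝ v)) v := by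
  have h0 : HasFDerivAt (fun v : V => -b * ‖v‖ ^ 2) ((-b) • (2 • innerSL ℝ v)) v :=
    (hasStrictFDerivAt_norm_sq v).hasFDerivAt.const_mul (-b)
  have h1 := (Complex.ofRealCLM.hasFDerivAt.comp v h0).cexp
  convert h1 using 1
  · ext v; simp
  · ext w
    simp
    ring

section RieszFourier

open scoped FourierTransform RealInnerProductSpace

variable {V : Type*} [NormedAddCommGroup V] [InnerProductSpace ℝ V] [FiniteDimensional ℝ V]
  [MeasurableSpace V] [BorelSpace V]

theorem integrable_norm_mul_cexp_neg_mul_sq_norm {b : ℝ} (hb : 0 < b) :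
    Integrable fun v : V => ‖v‖ * ‖Complex.exp (-b * ‖v‖ ^ 2)‖ := by
  have h1 := ((integrable_cexp_neg_mul_sq_norm (V := V) (half_pos hb)).norm).const_mul (1 + 2 / b)
  have hn : ∀ (b : ℝ) (v : V), ‖Complex.exp (-b * ‖v‖ ^ 2)‖ = Real.exp (-b * ‖v‖ ^ 2) := by
    intro b v
    rw [Complex.norm_exp]; congr 1; norm_cast
  refine h1.mono' (by fun_prop) (Eventually.of_forall fun v => ?_)
  rw [norm_mul, norm_norm, norm_norm, hn]
  rw [hn (b / 2) v, show -b * ‖v‖ ^ 2 = -(b / 2 * ‖v‖ ^ 2) + -(b / 2) * ‖v‖ ^ 2 by ring,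
    Real.exp_add, ← mul_assoc, Real.exp_neg]
  gcongr
  rw [← div_eq_mul_inv, div_le_iff₀ (Real.exp_pos _)]
  have h2 := Real.add_one_le_exp (b / 2 * ‖v‖ ^ 2)
  calc ‖v‖ ≤ 1 + ‖v‖ ^ 2 := by nlinarith [sq_nonneg (‖v‖ - 1)]
    _ ≤ (1 + 2 / b) * (b / 2 * ‖v‖ ^ 2 + 1) := by
      have : (1 + 2 / b) * (b / 2 * ‖v‖ ^ 2 + 1) = 1 + ‖v‖ ^ 2 + (b / 2 * ‖v‖ ^ 2 + 2 / b) := by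
        field_simp; ring
      rw [this]
      have : 0 ≤ b / 2 * ‖v‖ ^ 2 + 2 / b := by positivity
      linarith
    _ ≤ _ := by gcongr

theorem fourier_inner_mul_gaussian {b : ℝ} (hb : 0 < b) (e w : V) :
    𝓕 (fun v : V => (⟪v, e⟫ : ℂ) * Complex.exp (-b * ‖v‖ ^ 2)) w =
      -(Real.pi * Complex.I / b) * ⟪w, e⟫ *
        ((Real.pi / b) ^ (Module.finrank ℝ V / 2 : ℂ) *
          Complex.exp (-Real.pi ^ 2 * ‖w‖ ^ 2 / b)) := by
  have hd := hasFDerivAt_cexp_neg_mul_sq_norm (V := V) b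
  have hfd : fderiv ℝ (fun v : V => Complex.exp (-b * ‖v‖ ^ 2)) = fun v =>
      (-(2 * b) * Complex.exp (-b * ‖v‖ ^ 2)) • Complex.ofRealCLM.comp (innerSL ℝ v) := by
    ext1 v; exact (hd v).fderiv
  have h_int := integrable_cexp_neg_mul_sq_norm (V := V) hb
  have h_int' : Integrable (fderiv ℝ (fun v : V => Complex.exp (-b * ‖v‖ ^ 2))) := by
    rw [hfd]
    refine ((integrable_norm_mul_cexp_neg_mul_sq_norm (V := V) hb).const_mul (2 * b)).mono' ?_ ?_
    · refine Continuous.aestronglyMeasurable ?_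
      have h0 : Continuous fun v : V => (-(2 * b) * Complex.exp (-b * ‖v‖ ^ 2) : ℂ) := by fun_prop
      refine h0.smul ?_
      exact ((ContinuousLinearMap.compL ℝ V ℝ ℂ Complex.ofRealCLM).continuous).comp
        (innerSL ℝ).continuous
    · refine Eventually.of_forall fun v => ?_
      rw [norm_smul, norm_mul]
      have h1 : ‖Complex.ofRealCLM.comp (innerSL ℝ v)‖ ≤ ‖v‖ := by
        refine (ContinuousLinearMap.opNorm_comp_le _ _).trans ?_
        simp
      have h2 : ‖(-(2 * b) : ℂ)‖ = 2 * b := by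
        rw [norm_neg]
        rw [show (2 * b : ℂ) = ((2 * b : ℝ) : ℂ) by push_cast; rfl, Complex.norm_real,
          Real.norm_of_nonneg (by positivity)]
      rw [h2, mul_assoc, mul_comm ‖v‖]
      gcongr
  have h1 := congrFun (Real.fourier_fderiv h_int (fun v => (hd v).differentiableAt) h_int') w
  have h2 := congrArg (fun L : V →L[ℝ] ℂ => L e) h1
  have h3 : (𝓕 (fderiv ℝ (fun v : V => Complex.exp (-b * ‖v‖ ^ 2))) w) e =
      𝓕 (fun v => fderiv ℝ (fun v : V => Complex.exp (-b * ‖v‖ ^ 2)) v e) w :=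
    Real.fourierIntegral_continuousLinearMap_apply' (L := innerSL ℝ) h_int'
  rw [h3, hfd, VectorFourier.fourierSMulRight_apply,
    fourier_gaussian_innerProductSpace (by simpa)] at h2
  have h4 : (fun v : V => ((-(2 * b) * Complex.exp (-b * ‖v‖ ^ 2)) •
      Complex.ofRealCLM.comp (innerSL ℝ v)) e) =
      (-(2 * b) : ℂ) • fun v : V => (⟪v, e⟫ : ℂ) * Complex.exp (-b * ‖v‖ ^ 2) := by
    ext v
    simp
    ring
  have h5 : 𝓕 ((-(2 * b) : ℂ) • fun v : V => (⟪v, e⟫ : ℂ) * Complex.exp (-b * ‖v‖ ^ 2)) w =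
      (-(2 * b) : ℂ) * 𝓕 (fun v : V => (⟪v, e⟫ : ℂ) * Complex.exp (-b * ‖v‖ ^ 2)) w := by
    have := VectorFourier.fourierIntegral_const_smul Real.fourierChar (volume : Measure V)
      (innerₗ V) (fun v : V => (⟪v, e⟫ : ℂ) * Complex.exp (-b * ‖v‖ ^ 2)) (-(2 * b) : ℂ)
    exact congrFun this w
  rw [h4, h5] at h2
  have hb' : (-(2 * b) : ℂ) ≠ 0 := by
    simpa using hb.ne'
  apply mul_left_cancel₀ hb'
  rw [h2]
  have : (b : ℂ) ≠ 0 := by exact_mod_cast hb.ne'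
  simp
  field_simp
  rw [mul_comm]
  rfl

end RieszFourier

section RieszMultiplier

open scoped FourierTransform RealInnerProductSpace

variable {V : Type*} [NormedAddCommGroup V] [InnerProductSpace ℝ V] [FiniteDimensional ℝ V]
  [MeasurableSpace V] [BorelSpace V]

/-- The inverse Fourier transform of `s ^ finrank V * ⟪w, e⟫ * exp (-s² ‖w‖²)`. -/
noncomputable def gaussMultiplier (e : V) (s : ℝ) (v : V) : ℂ :=
  (Complex.I / Real.pi * (Real.pi ^ (Module.finrank ℝ V / 2 : ℝ) : ℝ) * (Real.pi ^ 2 / s ^ 2 : ℝ)) *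
    ((⟪v, e⟫ : ℂ) * Complex.exp (-(Real.pi ^ 2 / s ^ 2 : ℝ) * ‖v‖ ^ 2))

theorem integrable_gaussMultiplier (e : V) {s : ℝ} (hs : 0 < s) :
    Integrable (gaussMultiplier e s) := by
  unfold gaussMultiplier
  refine Integrable.const_mul ?_ _
  have hb : 0 < Real.pi ^ 2 / s ^ 2 := by positivity
  refine ((integrable_norm_mul_cexp_neg_mul_sq_norm (V := V) hb).const_mul ‖e‖).mono'
    (by fun_prop) (Eventually.of_forall fun v => ?_)
  rw [norm_mul, Complex.norm_real, ← mul_assoc, mul_comm ‖e‖]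
  gcongr
  exact norm_inner_le_norm v e

theorem fourier_gaussMultiplier (e : V) {s : ℝ} (hs : 0 < s) (w : V) :
    𝓕 (gaussMultiplier e s) w =
      ((s ^ Module.finrank ℝ V * Real.exp (-s ^ 2 * ‖w‖ ^ 2) * ⟪w, e⟫ : ℝ) : ℂ) := by
  have hb : 0 < Real.pi ^ 2 / s ^ 2 := by positivity
  have h1 : 𝓕 (gaussMultiplier e s) w =
      (Complex.I / Real.pi * (Real.pi ^ (Module.finrank ℝ V / 2 : ℝ) : ℝ) *
        (Real.pi ^ 2 / s ^ 2 : ℝ)) *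
      𝓕 (fun v : V => (⟪v, e⟫ : ℂ) * Complex.exp (-(Real.pi ^ 2 / s ^ 2 : ℝ) * ‖v‖ ^ 2)) w :=
    congrFun (VectorFourier.fourierIntegral_const_smul Real.fourierChar (volume : Measure V)
      (innerₗ V) (fun v : V => (⟪v, e⟫ : ℂ) * Complex.exp (-(Real.pi ^ 2 / s ^ 2 : ℝ) * ‖v‖ ^ 2))
      (Complex.I / Real.pi * (Real.pi ^ (Module.finrank ℝ V / 2 : ℝ) : ℝ) *
        (Real.pi ^ 2 / s ^ 2 : ℝ))) w
  rw [h1, fourier_inner_mul_gaussian hb]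
  have h2 : ((Real.pi : ℂ) / (Real.pi ^ 2 / s ^ 2 : ℝ)) ^ (Module.finrank ℝ V / 2 : ℂ) =
      ((s ^ Module.finrank ℝ V / Real.pi ^ (Module.finrank ℝ V / 2 : ℝ) : ℝ) : ℂ) := by
    have : ((Real.pi : ℂ) / (Real.pi ^ 2 / s ^ 2 : ℝ)) = ((s ^ 2 / Real.pi : ℝ) : ℂ) := by
      have := Real.pi_ne_zero
      norm_cast
      field_simp
    rw [this, show (Module.finrank ℝ V / 2 : ℂ) = ((Module.finrank ℝ V / 2 : ℝ) : ℂ) by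
      push_cast; rfl,
      ← Complex.ofReal_cpow (by positivity), Real.div_rpow (by positivity) (by positivity),
      ← Real.rpow_natCast s 2, ← Real.rpow_mul hs.le]
    have he : ((2 : ℕ) : ℝ) * (Module.finrank ℝ V / 2 : ℝ) = (Module.finrank ℝ V : ℕ) := by
      push_cast; ring
    rw [he, Real.rpow_natCast]
  have h3 : Complex.exp (-Real.pi ^ 2 * ‖w‖ ^ 2 / (Real.pi ^ 2 / s ^ 2 : ℝ)) =
      ((Real.exp (-s ^ 2 * ‖w‖ ^ 2) : ℝ) : ℂ) := by
    have := Real.pi_ne_zero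
    rw [Complex.ofReal_exp]
    congr 1
    norm_cast
    field_simp
  rw [h2, h3]
  have hpi : (Real.pi : ℂ) ≠ 0 := by exact_mod_cast Real.pi_ne_zero
  have hs' : (s : ℂ) ≠ 0 := by exact_mod_cast hs.ne'
  have hp : ((Real.pi ^ (Module.finrank ℝ V / 2 : ℝ) : ℝ) : ℂ) ≠ 0 := by
    exact_mod_cast (Real.rpow_pos_of_pos Real.pi_pos _).ne'
  push_cast
  field_simp
  rw [Complex.I_sq]; ring

theorem lintegral_inv_sq_mul_exp_neg_div_sq {a : ℝ} (ha : 0 < a) :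
    ∫⁻ s in Ioi (0 : ℝ), ENNReal.ofReal (1 / s ^ 2 * Real.exp (-a / s ^ 2)) =
      ENNReal.ofReal (√(Real.pi / a) / 2) := by
  have himg : (fun x : ℝ => x⁻¹) '' Ioi 0 = Ioi 0 := by
    ext x
    refine ⟨?_, fun hx => ⟨x⁻¹, inv_pos.2 (mem_Ioi.1 hx), inv_inv x⟩⟩
    rintro ⟨y, hy, rfl⟩
    exact inv_pos.2 (mem_Ioi.1 hy)
  have h := lintegral_image_eq_lintegral_abs_deriv_mul (s := Ioi (0 : ℝ)) (f := fun x => x⁻¹)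
    (f' := fun x => -(x ^ 2)⁻¹) measurableSet_Ioi
    (fun x hx => (hasDerivAt_inv (ne_of_gt hx)).hasDerivWithinAt) inv_injective.injOn
    (fun u => ENNReal.ofReal (Real.exp (-a * u ^ 2)))
  rw [himg, ← ofReal_integral_eq_lintegral_ofReal (integrable_exp_neg_mul_sq ha).integrableOn
    (Eventually.of_forall fun _ => (Real.exp_pos _).le), integral_gaussian_Ioi] at h
  rw [h]
  refine lintegral_congr fun s => ?_
  rw [← ENNReal.ofReal_mul (abs_nonneg _), abs_neg, abs_of_nonneg (by positivity)]
  congr 2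
  · simp
  · rw [inv_pow]; rfl

theorem lintegral_enorm_gaussMultiplier_le {V : Type*} [NormedAddCommGroup V]
    [InnerProductSpace ℝ V] (e v : V) :
    ∫⁻ s in Ioi (0 : ℝ), ‖gaussMultiplier e s v‖ₑ ≤
      ENNReal.ofReal (Real.pi ^ (Module.finrank ℝ V / 2 : ℝ) * Real.pi * ‖e‖) := by
  rcases eq_or_ne v 0 with rfl | hv
  · simp [gaussMultiplier]
  have hv' : 0 < ‖v‖ := norm_pos_iff.2 hv
  have h1 : ∀ s : ℝ, ‖gaussMultiplier e s v‖ₑ ≤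
      ENNReal.ofReal (Real.pi ^ (Module.finrank ℝ V / 2 : ℝ) * Real.pi * (‖v‖ * ‖e‖)) *
        ENNReal.ofReal (1 / s ^ 2 * Real.exp (-(Real.pi ^ 2 * ‖v‖ ^ 2) / s ^ 2)) := by
    intro s
    rw [← ENNReal.ofReal_mul (by positivity), ← ofReal_norm]
    refine ENNReal.ofReal_le_ofReal ?_
    unfold gaussMultiplier
    simp only [norm_mul, norm_div, Complex.norm_I, Complex.norm_real]
    rw [Complex.norm_exp, Real.norm_of_nonneg Real.pi_pos.le, Real.norm_of_nonneg (by positivity),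
      Real.norm_of_nonneg (by positivity)]
    have h2 : (-((Real.pi ^ 2 / s ^ 2 : ℝ) : ℂ) * (‖v‖ : ℂ) ^ 2).re =
        -(Real.pi ^ 2 * ‖v‖ ^ 2) / s ^ 2 := by
      norm_cast
      ring
    rw [h2, Real.norm_of_nonneg (sq_nonneg s)]
    calc _ ≤ 1 / Real.pi * Real.pi ^ (Module.finrank ℝ V / 2 : ℝ) * (Real.pi ^ 2 / s ^ 2) *
          ((‖v‖ * ‖e‖) * Real.exp (-(Real.pi ^ 2 * ‖v‖ ^ 2) / s ^ 2)) := by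
          have h4 := norm_inner_le_norm (𝕜 := ℝ) v e
          exact mul_le_mul_of_nonneg_left (mul_le_mul_of_nonneg_right h4 (Real.exp_pos _).le)
            (by positivity)
      _ = _ := by
        have := Real.pi_ne_zero
        field_simp
  refine (lintegral_mono h1).trans ?_
  rw [lintegral_const_mul' _ _ (by finiteness), lintegral_inv_sq_mul_exp_neg_div_sq (by positivity),
    ← ENNReal.ofReal_mul (by positivity)]
  refine ENNReal.ofReal_le_ofReal ?_
  have h3 : √(Real.pi / (Real.pi ^ 2 * ‖v‖ ^ 2)) ≤ 1 / ‖v‖ := by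
    rw [Real.sqrt_le_left (by positivity), div_pow, one_pow, div_le_div_iff₀ (by positivity)
      (by positivity)]
    have : Real.pi ≤ Real.pi ^ 2 := by nlinarith [Real.pi_gt_three]
    nlinarith [sq_nonneg ‖v‖]
  calc _ ≤ Real.pi ^ (Module.finrank ℝ V / 2 : ℝ) * Real.pi * (‖v‖ * ‖e‖) * (1 / ‖v‖) := by
        refine mul_le_mul_of_nonneg_left ?_ (by positivity)
        exact (half_le_self (Real.sqrt_nonneg _)).trans h3
    _ = _ := by field_simp

theorem integral_pow_mul_exp_neg_mul_sq (n : ℕ) : ∃ κ : ℝ, 0 < κ ∧ ∀ A : ℝ, 0 < A →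
    ∫ s in Ioi (0 : ℝ), s ^ n * Real.exp (-A * s ^ 2) = κ * (√A ^ (n + 1))⁻¹ := by
  refine ⟨1 / 2 * Real.Gamma ((n + 1) / 2), mul_pos (by norm_num) (Real.Gamma_pos_of_pos
    (by positivity)), fun A hA => ?_⟩
  have h := integral_rpow_mul_exp_neg_mul_rpow (p := 2) (q := n) (b := A) (by norm_num)
    (by have : (0 : ℝ) ≤ n := Nat.cast_nonneg n
        linarith) hA
  simp only [Real.rpow_natCast, Real.rpow_two] at h
  rw [h, Real.sqrt_eq_rpow, ← Real.rpow_natCast, ← Real.rpow_mul hA.le, ← Real.rpow_neg hA.le]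
  rw [mul_comm (1 / 2 * _), mul_assoc]
  congr 2
  push_cast; ring

end RieszMultiplier

section RieszPlane

open scoped FourierTransform RealInnerProductSpace

variable {n : ℕ}

theorem exists_inner_rieszKer_eq (n : ℕ) : ∃ κ : ℝ, 0 < κ ∧ ∀ ε : ℝ, 0 < ε → ∀ e x : Euc n,
    (∫ s in Ioi (0 : ℝ), s ^ n * Real.exp (-(‖x‖ ^ 2 + ε ^ 2) * s ^ 2) * ⟪x, e⟫) =
      κ * ⟪rieszKer n ε x, e⟫ := by
  obtain ⟨κ, hκ, h⟩ := integral_pow_mul_exp_neg_mul_sq n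
  refine ⟨κ, hκ, fun ε hε e x => ?_⟩
  rw [integral_mul_const, h _ (by positivity), rieszKer, real_inner_smul_left]
  ring

theorem pow_mul_exp_mul_norm_le (hn : n ≠ 0) {s : ℝ} (hs : 0 < s) (ε : ℝ) (e x : Euc n) :
    |s ^ n * Real.exp (-(‖x‖ ^ 2 + ε ^ 2) * s ^ 2) * ⟪x, e⟫| ≤
      ‖e‖ * (s ^ (n - 1) * Real.exp (-ε ^ 2 * s ^ 2)) := by
  obtain ⟨m, rfl⟩ := Nat.exists_eq_succ_of_ne_zero hn
  have h1 : s * ‖x‖ * Real.exp (-(‖x‖ ^ 2 * s ^ 2)) ≤ 1 := by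
    rw [Real.exp_neg, ← div_eq_mul_inv, div_le_one (Real.exp_pos _)]
    have := Real.add_one_le_exp (‖x‖ ^ 2 * s ^ 2)
    nlinarith [sq_nonneg (s * ‖x‖ - 1)]
  rw [abs_mul, abs_of_nonneg (by positivity : 0 ≤ s ^ (m + 1) * Real.exp _)]
  have h2 : Real.exp (-(‖x‖ ^ 2 + ε ^ 2) * s ^ 2) =
      Real.exp (-(‖x‖ ^ 2 * s ^ 2)) * Real.exp (-ε ^ 2 * s ^ 2) := by
    rw [← Real.exp_add]; congr 1; ring
  calc _ ≤ s ^ (m + 1) * Real.exp (-(‖x‖ ^ 2 + ε ^ 2) * s ^ 2) * (‖x‖ * ‖e‖) := by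
        gcongr
        exact abs_real_inner_le_norm x e
    _ = (s * ‖x‖ * Real.exp (-(‖x‖ ^ 2 * s ^ 2))) *
        (‖e‖ * (s ^ m * Real.exp (-ε ^ 2 * s ^ 2))) := by rw [h2, pow_succ]; ring
    _ ≤ 1 * (‖e‖ * (s ^ m * Real.exp (-ε ^ 2 * s ^ 2))) := by gcongr
    _ = _ := by simp

/-- The bilinear form of the Riesz transform in `ℝⁿ` is bounded on `L²`. -/
theorem exists_sq_enorm_riesz_form_le (hn : n ≠ 0) : ∃ C : ℝ≥0∞, C ≠ ⊤ ∧ ∀ ε : ℝ, 0 < ε →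
    ∀ e : Euc n, ‖e‖ = 1 → ∀ f g : Euc n → ℝ, Measurable f → Measurable g → Integrable f →
    Integrable g →
    ‖∫ p : Euc n × Euc n, ⟪rieszKer n ε (p.1 - p.2), e⟫ * (g p.1 * f p.2)
      ∂(volume.prod volume)‖ₑ ^ 2 ≤ C * ((∫⁻ v, ‖f v‖ₑ ^ 2) * ∫⁻ v, ‖g v‖ₑ ^ 2) := by
  obtain ⟨κ, hκ, hK⟩ := exists_inner_rieszKer_eq n
  set D : ℝ≥0∞ :=
    ENNReal.ofReal (Real.pi ^ (Module.finrank ℝ (Euc n) / 2 : ℝ) * Real.pi * 1) with hD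
  refine ⟨(ENNReal.ofReal κ⁻¹) ^ 2 * D ^ 2, by finiteness,
    fun ε hε e he f g hfm hgm hf hg => ?_⟩
  set k : ℝ → Euc n → ℝ := fun s x =>
    s ^ n * Real.exp (-(‖x‖ ^ 2 + ε ^ 2) * s ^ 2) * ⟪x, e⟫ with hk
  have hfc : Integrable fun y => (f y : ℂ) := hf.ofReal
  have hgc : Integrable fun y => (g y : ℂ) := hg.ofReal
  set Φ : Euc n → ℝ≥0∞ := fun v => ‖𝓕 (fun y => (f (-y) : ℂ)) v‖ₑ with hΦ
  set Ψ : Euc n → ℝ≥0∞ := fun v => ‖𝓕 (fun y => (g y : ℂ)) v‖ₑ with hΨ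
  have hΦm : Measurable Φ :=
    (Real.continuous_fourier_of_integrable hfc.comp_neg).measurable.enorm
  have hΨm : Measurable Ψ := (Real.continuous_fourier_of_integrable hgc).measurable.enorm
  -- the kernel as a superposition of Gaussians
  have h1 : ∫ p : Euc n × Euc n, ⟪rieszKer n ε (p.1 - p.2), e⟫ * (g p.1 * f p.2)
      ∂(volume.prod volume) = κ⁻¹ * ∫ s in Ioi (0 : ℝ),
        ∫ p : Euc n × Euc n, k s (p.1 - p.2) * (g p.1 * f p.2) ∂(volume.prod volume) := by
    rw [integral_integral_swap, ← integral_const_mul]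
    · congr 1; ext p
      rw [integral_mul_const, hK ε hε e]
      field_simp
    · have hi : IntegrableOn (fun s : ℝ => s ^ (n - 1) * Real.exp (-ε ^ 2 * s ^ 2)) (Ioi 0) := by
        have := integrableOn_rpow_mul_exp_neg_mul_sq (b := ε ^ 2) (by positivity)
          (s := ((n - 1 : ℕ) : ℝ)) (by
            have : (0 : ℝ) ≤ ((n - 1 : ℕ) : ℝ) := Nat.cast_nonneg _
            linarith)
        simpa only [Real.rpow_natCast] using this
      have hgf : Integrable (fun p : Euc n × Euc n => g p.1 * f p.2) (volume.prod volume) :=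
        hg.mul_prod hf
      have hb := Integrable.mul_prod hi.integrable hgf.norm
      refine hb.mono' ?_ ?_
      · refine Measurable.aestronglyMeasurable ?_
        rw [hk]
        fun_prop
      · rw [Measure.ae_prod_iff_ae_ae]
        · filter_upwards [ae_restrict_mem measurableSet_Ioi] with s hs
          refine Eventually.of_forall fun p => ?_
          simp only [Function.uncurry]
          rw [norm_mul]
          gcongr
          have := pow_mul_exp_mul_norm_le hn (mem_Ioi.1 hs) ε e (p.1 - p.2)
          rwa [he, one_mul] at this
        · rw [hk]
          refine measurableSet_le ?_ ?_
          · unfold Function.uncurry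
            fun_prop
          · fun_prop
  -- the estimate for each Gaussian
  have h2 : ∀ s ∈ Ioi (0 : ℝ),
      ‖∫ p : Euc n × Euc n, k s (p.1 - p.2) * (g p.1 * f p.2) ∂(volume.prod volume)‖ₑ ≤
        ∫⁻ v, ‖gaussMultiplier e s v‖ₑ * (Φ v * Ψ v) := by
    intro s hs
    have h3 : ((∫ p : Euc n × Euc n, k s (p.1 - p.2) * (g p.1 * f p.2)
        ∂(volume.prod volume) : ℝ) : ℂ) = Real.exp (-ε ^ 2 * s ^ 2) *
        ∫ v, gaussMultiplier e s v * 𝓕 (fun y => (f (-y) : ℂ)) v * 𝓕 (fun y => (g y : ℂ)) v := by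
      rw [← integral_prod_fourier_sub_mul (integrable_gaussMultiplier e hs) hfc hgc,
        ← integral_const_mul, ← integral_complex_ofReal]
      congr 1; ext p
      rw [fourier_gaussMultiplier e hs, finrank_euclideanSpace_fin, hk]
      simp only
      rw [show -(‖p.1 - p.2‖ ^ 2 + ε ^ 2) * s ^ 2 =
        -ε ^ 2 * s ^ 2 + -s ^ 2 * ‖p.1 - p.2‖ ^ 2 by ring, Real.exp_add]
      push_cast; ring
    rw [← ofReal_norm, ← Complex.norm_real, ofReal_norm, h3, enorm_mul]
    calc _ ≤ 1 * ∫⁻ v, ‖gaussMultiplier e s v * 𝓕 (fun y => (f (-y) : ℂ)) v *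
          𝓕 (fun y => (g y : ℂ)) v‖ₑ := by
          gcongr
          · rw [← ofReal_norm, Complex.norm_real, Real.norm_of_nonneg (Real.exp_pos _).le,
              ENNReal.ofReal_le_one, Real.exp_le_one_iff]
            have : 0 ≤ ε ^ 2 * s ^ 2 := by positivity
            linarith
          · exact enorm_integral_le_lintegral_enorm _
      _ = _ := by
          rw [one_mul]
          congr 1; ext v
          rw [enorm_mul, enorm_mul, mul_assoc]
  have hmul : Measurable (Function.uncurry fun (s : ℝ) (v : Euc n) =>
      ‖gaussMultiplier e s v‖ₑ) := by
    unfold gaussMultiplier Function.uncurry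
    fun_prop
  have hmul' : ∀ v : Euc n, Measurable fun s : ℝ => ‖gaussMultiplier e s v‖ₑ := by
    intro v
    unfold gaussMultiplier
    fun_prop
  have hmul'' : Measurable (Function.uncurry fun (s : ℝ) (v : Euc n) =>
      ‖gaussMultiplier e s v‖ₑ * (Φ v * Ψ v)) := by
    unfold Function.uncurry at hmul ⊢
    have h5 : Measurable fun q : ℝ × Euc n => Φ q.2 := hΦm.comp measurable_snd
    have h6 : Measurable fun q : ℝ × Euc n => Ψ q.2 := hΨm.comp measurable_snd
    exact hmul.mul (h5.mul h6)
  clear_value Φ Ψ D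
  have h4 : ‖∫ p : Euc n × Euc n, ⟪rieszKer n ε (p.1 - p.2), e⟫ * (g p.1 * f p.2)
      ∂(volume.prod volume)‖ₑ ≤ ENNReal.ofReal κ⁻¹ * (D * ∫⁻ v, Φ v * Ψ v) := by
    rw [h1, enorm_mul]
    gcongr
    · rw [← ofReal_norm, Real.norm_of_nonneg (by positivity)]
    calc _ ≤ ∫⁻ s in Ioi (0 : ℝ), ∫⁻ v, ‖gaussMultiplier e s v‖ₑ * (Φ v * Ψ v) :=
          (enorm_integral_le_lintegral_enorm _).trans (setLIntegral_mono' measurableSet_Ioi h2)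
      _ = ∫⁻ v, (∫⁻ s in Ioi (0 : ℝ), ‖gaussMultiplier e s v‖ₑ) * (Φ v * Ψ v) := by
          rw [lintegral_lintegral_swap]
          · refine lintegral_congr fun v => ?_
            rw [lintegral_mul_const _ (hmul' v)]
          · exact hmul''.aemeasurable
      _ ≤ ∫⁻ v, D * (Φ v * Ψ v) := by
          refine lintegral_mono fun v => ?_
          gcongr
          rw [hD, ← he]
          exact lintegral_enorm_gaussMultiplier_le e v
      _ = _ := lintegral_const_mul' _ _ (by rw [hD]; exact ENNReal.ofReal_ne_top)
  have h6 : ∫⁻ v, Φ v ^ 2 ≤ ∫⁻ v, ‖f v‖ₑ ^ 2 := by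
    rw [hΦ]
    refine (lintegral_sq_fourier_le (f := fun y => f (-y)) (by fun_prop) hf.comp_neg).trans ?_
    exact (lintegral_neg_eq_self (fun v => ‖f v‖ₑ ^ 2)).le
  have h7 : ∫⁻ v, Ψ v ^ 2 ≤ ∫⁻ v, ‖g v‖ₑ ^ 2 := by
    rw [hΨ]
    exact lintegral_sq_fourier_le hgm hg
  have h5 := sq_lintegral_mul_le volume hΦm.aemeasurable hΨm.aemeasurable
  calc _ ≤ (ENNReal.ofReal κ⁻¹ * (D * ∫⁻ v, Φ v * Ψ v)) ^ 2 := by gcongr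
    _ = ENNReal.ofReal κ⁻¹ ^ 2 * D ^ 2 * (∫⁻ v, Φ v * Ψ v) ^ 2 := by ring
    _ ≤ _ := by
      exact mul_le_mul' le_rfl (h5.trans (mul_le_mul' h6 h7))

end RieszPlane

theorem SmoothRieszBounded.smul_measure {n d : ℕ} {ν : Measure (Euc d)}
    (h : SmoothRieszBounded n ν) {a : ℝ≥0∞} (ha : a ≠ 0) (ha' : a ≠ ⊤) :
    SmoothRieszBounded n (a • ν) := by
  obtain ⟨C, hC, h⟩ := h
  refine ⟨a ^ 2 * C, by finiteness, fun ε hε f hf hf2 => ?_⟩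
  rw [lintegral_smul_measure, smul_eq_mul] at hf2 ⊢
  have hf3 : ∫⁻ x, ‖f x‖ₑ ^ 2 ∂ν ≠ ⊤ := fun h0 => hf2 (by rw [h0, ENNReal.mul_top ha])
  have h1 : ∀ x, ‖smoothRiesz n (a • ν) ε f x‖ₑ ^ 2 = a ^ 2 * ‖smoothRiesz n ν ε f x‖ₑ ^ 2 := by
    intro x
    rw [smoothRiesz, integral_smul_measure, enorm_smul, mul_pow, ← ofReal_norm a.toReal,
      Real.norm_of_nonneg ENNReal.toReal_nonneg, ENNReal.ofReal_toReal ha', smoothRiesz]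
  simp_rw [h1]
  rw [lintegral_const_mul' _ _ (by finiteness), lintegral_smul_measure, smul_eq_mul]
  calc _ ≤ a * (a ^ 2 * (C * ∫⁻ x, ‖f x‖ₑ ^ 2 ∂ν)) := by gcongr; exact h ε hε f hf hf3
    _ = _ := by ring

theorem measurable_smoothRiesz (n : ℕ) {d : ℕ} {μ : Measure (Euc d)} [SFinite μ] {ε : ℝ}
    (hε : 0 < ε) {f : Euc d → ℝ} (hf : Measurable f) : Measurable (smoothRiesz n μ ε f) := by
  have hk := (continuous_rieszKer n (d := d) hε).measurable
  have h : StronglyMeasurable (Function.uncurry fun x y : Euc d => f y • rieszKer n ε (x - y)) := by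
    unfold Function.uncurry
    exact Measurable.stronglyMeasurable (by fun_prop)
  exact h.integral_prod_right.measurable

theorem smoothRieszBounded_of_subsingleton (n : ℕ) {d : ℕ} [Subsingleton (Euc d)]
    (μ : Measure (Euc d)) : SmoothRieszBounded n μ := by
  refine ⟨0, by simp, fun ε hε f hf hf2 => ?_⟩
  have : ∀ x, smoothRiesz n μ ε f x = 0 := fun x => Subsingleton.elim _ _
  simp [this]

open scoped RealInnerProductSpace in
/-- The `n`-dimensional Riesz transform is bounded in `L²` of bounded pieces of `ℝⁿ`. -/
theorem smoothRieszBounded_volume_restrict {n : ℕ} {B : Set (Euc n)} (hB : MeasurableSet B)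
    (hBv : volume B ≠ ⊤) : SmoothRieszBounded n (volume.restrict B) := by
  rcases eq_or_ne n 0 with rfl | hn
  · exact smoothRieszBounded_of_subsingleton 0 _
  have : IsFiniteMeasure (volume.restrict B : Measure (Euc n)) :=
    ⟨by simpa [lt_top_iff_ne_top] using hBv⟩
  obtain ⟨C, hC, hform⟩ := exists_sq_enorm_riesz_form_le hn
  refine ⟨n * C, by finiteness, fun ε hε f hf hf2 => ?_⟩
  have hfi : Integrable f (volume.restrict B) :=
    integrable_of_lintegral_sq_ne_top hf.aestronglyMeasurable hf2
  set S := smoothRiesz n (volume.restrict B) ε f with hS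
  have hSm : Measurable S := measurable_smoothRiesz n hε hf
  have hk := (continuous_rieszKer n (d := n) hε).measurable
  have hSint : ∀ x, Integrable (fun y => f y • rieszKer n ε (x - y)) (volume.restrict B) := by
    intro x
    refine (hfi.norm.mul_const (ε ^ n)⁻¹).mono' (Measurable.aestronglyMeasurable (by fun_prop))
      (Eventually.of_forall fun y => ?_)
    rw [norm_smul]
    gcongr
    exact norm_rieszKer_le n hε _
  have hSb : ∀ x, ‖S x‖ ≤ (∫ y in B, ‖f y‖) * (ε ^ n)⁻¹ := by
    intro x
    rw [← integral_mul_const]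
    refine norm_integral_le_of_norm_le (hfi.norm.mul_const _) (Eventually.of_forall fun y => ?_)
    rw [norm_smul]
    gcongr
    exact norm_rieszKer_le n hε _
  have key : ∀ e : Euc n, ‖e‖ = 1 →
      ∫⁻ x in B, ‖⟪S x, e⟫‖ₑ ^ 2 ≤ C * ∫⁻ x in B, ‖f x‖ₑ ^ 2 := by
    intro e he
    have hgb : ∀ x, ‖⟪S x, e⟫‖ ≤ (∫ y in B, ‖f y‖) * (ε ^ n)⁻¹ := fun x => by
      refine (norm_inner_le_norm (𝕜 := ℝ) _ _).trans ?_
      rw [he, mul_one]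
      exact hSb x
    have hgm : Measurable fun x => ⟪S x, e⟫ := by fun_prop
    have hgi : Integrable (fun x => ⟪S x, e⟫) (volume.restrict B) :=
      Integrable.mono' (integrable_const _) hgm.aestronglyMeasurable (Eventually.of_forall hgb)
    have hg2 : ∫⁻ x in B, ‖⟪S x, e⟫‖ₑ ^ 2 ≠ ⊤ := by
      refine ne_top_of_le_ne_top (b := ∫⁻ x in B,
        ENNReal.ofReal ((∫ y in B, ‖f y‖) * (ε ^ n)⁻¹) ^ 2) ?_ (lintegral_mono fun x => ?_)
      · rw [lintegral_const]
        finiteness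
      · gcongr
        rw [← ofReal_norm]
        exact ENNReal.ofReal_le_ofReal (hgb x)
    have h1 := hform ε hε e he (B.indicator f) (B.indicator fun x => ⟪S x, e⟫)
      (hf.indicator hB) (hgm.indicator hB) ((integrable_indicator_iff hB).2 hfi)
      ((integrable_indicator_iff hB).2 hgi)
    have hsq : ∀ h : Euc n → ℝ, ∫⁻ v, ‖B.indicator h v‖ₑ ^ 2 = ∫⁻ v in B, ‖h v‖ₑ ^ 2 := by
      intro h
      rw [← lintegral_indicator hB]
      congr 1; ext v
      by_cases hv : v ∈ B <;> simp [hv]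
    rw [hsq, hsq] at h1
    have h2 : ∫ p : Euc n × Euc n, ⟪rieszKer n ε (p.1 - p.2), e⟫ *
        (B.indicator (fun x => ⟪S x, e⟫) p.1 * B.indicator f p.2) ∂(volume.prod volume) =
        ∫ x in B, ⟪S x, e⟫ ^ 2 := by
      have h3 : (fun p : Euc n × Euc n => ⟪rieszKer n ε (p.1 - p.2), e⟫ *
          (B.indicator (fun x => ⟪S x, e⟫) p.1 * B.indicator f p.2)) =
          (B ×ˢ B).indicator fun p => ⟪rieszKer n ε (p.1 - p.2), e⟫ *
          (⟪S p.1, e⟫ * f p.2) := by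
        ext p
        by_cases h1 : p.1 ∈ B <;> by_cases h2 : p.2 ∈ B <;> simp [indicator, h1, h2]
      rw [h3, integral_indicator (hB.prod hB), ← Measure.prod_restrict, integral_prod]
      · refine integral_congr_ae (Eventually.of_forall fun x => ?_)
        simp only
        have h4 : ∀ y, ⟪rieszKer n ε (x - y), e⟫ * (⟪S x, e⟫ * f y) =
            ⟪S x, e⟫ * ⟪e, f y • rieszKer n ε (x - y)⟫ := by
          intro y
          rw [real_inner_smul_right, real_inner_comm e]; ring
        simp_rw [h4]
        rw [integral_const_mul, integral_inner (hSint x), real_inner_comm, sq, hS, smoothRiesz]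
      · have h5 := (Integrable.mul_prod hgi hfi).norm.mul_const (ε ^ n)⁻¹
        refine h5.mono' (Measurable.aestronglyMeasurable (by fun_prop))
          (Eventually.of_forall fun p => ?_)
        rw [norm_mul, mul_comm]
        gcongr
        refine (norm_inner_le_norm (𝕜 := ℝ) _ _).trans ?_
        rw [he, mul_one]
        exact norm_rieszKer_le n hε _
    have h6 : ‖∫ x in B, ⟪S x, e⟫ ^ 2‖ₑ = ∫⁻ x in B, ‖⟪S x, e⟫‖ₑ ^ 2 := by
      rw [← ofReal_norm, Real.norm_of_nonneg (integral_nonneg fun x => sq_nonneg _),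
        integral_eq_lintegral_of_nonneg_ae (Eventually.of_forall fun x => sq_nonneg _)
          (by fun_prop)]
      have h7 : ∀ x, ENNReal.ofReal (⟪S x, e⟫ ^ 2) = ‖⟪S x, e⟫‖ₑ ^ 2 := by
        intro x
        rw [← ofReal_norm, ← ENNReal.ofReal_pow (norm_nonneg _), Real.norm_eq_abs, sq_abs]
      simp_rw [h7]
      exact ENNReal.ofReal_toReal hg2
    rw [h2, h6, ← mul_assoc] at h1
    exact ENNReal.le_of_sq_le_mul hg2 h1
  have hsum : ∀ x, ‖S x‖ₑ ^ 2 =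
      ∑ i : Fin n, ‖⟪S x, EuclideanSpace.single i (1 : ℝ)⟫‖ₑ ^ 2 := by
    intro x
    have h8 : ∀ t : ℝ, ‖t‖ₑ ^ 2 = ENNReal.ofReal (t ^ 2) := fun t => by
      rw [← ofReal_norm, ← ENNReal.ofReal_pow (norm_nonneg _), Real.norm_eq_abs, sq_abs]
    simp_rw [h8]
    rw [← ENNReal.ofReal_sum_of_nonneg fun i _ => sq_nonneg _, ← ofReal_norm,
      ← ENNReal.ofReal_pow (norm_nonneg _), EuclideanSpace.norm_sq_eq]
    congr 2; ext i
    simp [EuclideanSpace.inner_single_right]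
  simp_rw [hsum]
  rw [lintegral_finsetSum _ fun i _ => by fun_prop]
  calc _ ≤ ∑ i : Fin n, C * ∫⁻ x in B, ‖f x‖ₑ ^ 2 :=
        Finset.sum_le_sum fun i _ => key _ (by simp)
    _ = _ := by simp [mul_assoc]

/-- The normalized Lebesgue measure on the unit ball of `ℝⁿ`. -/
noncomputable def unitBallMeasure (n : ℕ) : Measure (Euc n) :=
  (volume (closedBall (0 : Euc n) 1))⁻¹ • volume.restrict (closedBall 0 1)

theorem volume_closedBall_one_ne_zero (n : ℕ) : volume (closedBall (0 : Euc n) 1) ≠ 0 :=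
  (measure_closedBall_pos _ _ one_pos).ne'

instance (n : ℕ) : IsProbabilityMeasure (unitBallMeasure n) :=
  ⟨by
    rw [unitBallMeasure, Measure.smul_apply, Measure.restrict_apply_univ, smul_eq_mul]
    exact ENNReal.inv_mul_cancel (volume_closedBall_one_ne_zero n) measure_closedBall_lt_top.ne⟩

theorem smoothRieszBounded_unitBallMeasure (n : ℕ) : SmoothRieszBounded n (unitBallMeasure n) :=
  (smoothRieszBounded_volume_restrict measurableSet_closedBall
    measure_closedBall_lt_top.ne).smul_measure
    (ENNReal.inv_ne_zero.2 measure_closedBall_lt_top.ne)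
    (ENNReal.inv_ne_top.2 (volume_closedBall_one_ne_zero n))

theorem ae_mem_closedBall_unitBallMeasure (n : ℕ) :
    ∀ᵐ u ∂unitBallMeasure n, u ∈ closedBall (0 : Euc n) 1 :=
  Measure.ae_smul_measure (ae_restrict_mem measurableSet_closedBall) _

theorem unitBallMeasure_closedBall_le {n : ℕ} (u : Euc n) {r : ℝ} (hr : 0 ≤ r) :
    unitBallMeasure n (closedBall u r) ≤ ENNReal.ofReal (r ^ n) := by
  rw [unitBallMeasure, Measure.smul_apply, smul_eq_mul]
  calc _ ≤ (volume (closedBall (0 : Euc n) 1))⁻¹ * volume (closedBall u r) := by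
        gcongr
        exact Measure.restrict_le_self
    _ = ENNReal.ofReal (r ^ n) := by
        rw [Measure.addHaar_closedBall' _ _ hr, finrank_euclideanSpace_fin, mul_left_comm,
          ENNReal.inv_mul_cancel (volume_closedBall_one_ne_zero n) measure_closedBall_lt_top.ne,
          mul_one]

theorem le_unitBallMeasure_closedBall {n : ℕ} {u : Euc n} (hu : ‖u‖ ≤ 1) {r : ℝ} (hr : 0 ≤ r)
    (hr2 : r ≤ 2) : ENNReal.ofReal ((r / 2) ^ n) ≤ unitBallMeasure n (closedBall u r) := by
  have h1 : closedBall ((1 - r / 2) • u) (r / 2) ⊆ closedBall u r ∩ closedBall 0 1 := by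
    intro v hv
    rw [mem_closedBall, dist_eq_norm] at hv
    have h2 : ‖(r / 2) • u‖ ≤ r / 2 := by
      rw [norm_smul, Real.norm_of_nonneg (by linarith)]
      nlinarith
    have h3 : ‖(1 - r / 2) • u‖ ≤ 1 - r / 2 := by
      rw [norm_smul, Real.norm_of_nonneg (by linarith)]
      nlinarith
    constructor
    · rw [mem_closedBall, dist_eq_norm]
      calc ‖v - u‖ = ‖(v - (1 - r / 2) • u) - (r / 2) • u‖ := by
            congr 1; module
        _ ≤ _ := norm_sub_le _ _
        _ ≤ r := by linarith
    · rw [mem_closedBall, dist_zero_right]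
      calc ‖v‖ = ‖(v - (1 - r / 2) • u) + (1 - r / 2) • u‖ := by simp
        _ ≤ _ := norm_add_le _ _
        _ ≤ 1 := by linarith
  rw [unitBallMeasure, Measure.smul_apply, smul_eq_mul,
    Measure.restrict_apply measurableSet_closedBall]
  calc ENNReal.ofReal ((r / 2) ^ n)
      = (volume (closedBall (0 : Euc n) 1))⁻¹ * volume (closedBall ((1 - r / 2) • u) (r / 2)) := by
        rw [Measure.addHaar_closedBall' _ ((1 - r / 2) • u) (by linarith),
          finrank_euclideanSpace_fin, mul_left_comm,
          ENNReal.inv_mul_cancel (volume_closedBall_one_ne_zero n) measure_closedBall_lt_top.ne,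
          mul_one]
    _ ≤ _ := by gcongr

theorem le_unitBallMeasure_closedBall' {n : ℕ} {u : Euc n} (hu : ‖u‖ ≤ 1) {M r : ℝ} (hr : 0 ≤ r)
    (hM : 2 ≤ M) (hrM : r ≤ M) :
    ENNReal.ofReal ((r / M) ^ n) ≤ unitBallMeasure n (closedBall u r) := by
  rcases le_total r 2 with h | h
  · refine le_trans ?_ (le_unitBallMeasure_closedBall hu hr h)
    gcongr
  · calc _ ≤ ENNReal.ofReal ((2 / 2 : ℝ) ^ n) := by
          refine ENNReal.ofReal_le_ofReal (pow_le_pow_left₀ (by positivity) ?_ n)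
          rw [div_self two_ne_zero, div_le_one (by linarith)]
          exact hrM
      _ ≤ _ := le_unitBallMeasure_closedBall hu zero_le_two le_rfl
      _ ≤ _ := by gcongr

theorem rieszKer_smul_map {n d : ℕ} (L : Euc n →ₗᵢ[ℝ] Euc d) (ε : ℝ) {s : ℝ}
    (hs : 0 < s) (v : Euc n) :
    rieszKer n ε (s • L v) = (s ^ n)⁻¹ • L (rieszKer n (ε / s) v) := by
  have h : √(‖s • L v‖ ^ 2 + ε ^ 2) = s * √(‖v‖ ^ 2 + (ε / s) ^ 2) := by
    rw [norm_smul, L.norm_map, Real.norm_of_nonneg hs.le]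
    rw [show (s * ‖v‖) ^ 2 + ε ^ 2 = s ^ 2 * (‖v‖ ^ 2 + (ε / s) ^ 2) by field_simp,
      Real.sqrt_mul (sq_nonneg s), Real.sqrt_sq hs.le]
  rw [rieszKer, h, rieszKer, map_smul, smul_smul, smul_smul]
  congr 1
  rw [mul_pow, pow_succ s]
  field_simp

@[simp]
theorem rieszKer_zero (n : ℕ) {d : ℕ} (ε : ℝ) : rieszKer n ε (0 : Euc d) = 0 := by
  simp [rieszKer]

theorem sq_lintegral_le {α : Type*} [MeasurableSpace α] (μ : Measure α) {f : α → ℝ≥0∞}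
    (hf : AEMeasurable f μ) : (∫⁻ x, f x ∂μ) ^ 2 ≤ μ univ * ∫⁻ x, f x ^ 2 ∂μ := by
  have := sq_lintegral_mul_le μ (f := fun _ => 1) aemeasurable_const hf
  simpa using this

/-- `c` collapses the points `y ∈ P` with `0 < ρ y` onto countably many well-separated centres. -/
structure CellMap {d : ℕ} (P : Set (Euc d)) (c : Euc d → Euc d) (ρ : Euc d → ℝ) : Prop where
  measurableSet : MeasurableSet P
  measurable_center : Measurable c
  measurable_radius : Measurable ρ
  nonneg : ∀ y, 0 ≤ ρ y
  norm_sub_le : ∀ y ∈ P, ‖y - c y‖ ≤ ρ y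
  le_norm_sub : ∀ y ∈ P, ∀ y' ∈ P, c y ≠ c y' → 2 * (ρ y + ρ y') ≤ ‖c y - c y'‖
  radius_eq : ∀ y ∈ P, ∀ y' ∈ P, c y = c y' → ρ y = ρ y'
  countable : (c '' (P ∩ {y | 0 < ρ y})).Countable

namespace CellMap

variable {d n : ℕ} {P : Set (Euc d)} {c : Euc d → Euc d} {ρ : Euc d → ℝ}

theorem lintegral_le (h : CellMap P c ρ) (μ : Measure (Euc d)) {F H : Euc d → ℝ≥0∞} {C : ℝ≥0∞}
    (h0 : ∀ y ∈ P, ρ y = 0 → F y = 0)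
    (hC : ∀ y₀ ∈ P, 0 < ρ y₀ → ∫⁻ y in P ∩ {y | c y = c y₀}, F y ∂μ ≤
      C * ∫⁻ y in P ∩ {y | c y = c y₀}, H y ∂μ) :
    ∫⁻ y in P, F y ∂μ ≤ C * ∫⁻ y in P, H y ∂μ := by
  set U := c '' (P ∩ {y | 0 < ρ y}) with hU
  have hmeas : ∀ x, MeasurableSet (P ∩ {y | c y = x}) := fun x =>
    h.measurableSet.inter (h.measurable_center (measurableSet_singleton x))
  have hdisj : U.PairwiseDisjoint fun x => P ∩ {y | c y = x} := by
    intro x _ x' _ hne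
    refine Set.disjoint_left.2 fun y hy hy' => hne ?_
    exact hy.2.symm.trans hy'.2
  set S := ⋃ x ∈ U, P ∩ {y | c y = x} with hS
  have hSm : MeasurableSet S := MeasurableSet.biUnion h.countable fun x _ => hmeas x
  have hSP : S ⊆ P := iUnion₂_subset fun x _ => inter_subset_left
  have h1 : ∫⁻ y in P, F y ∂μ = ∫⁻ y in S, F y ∂μ := by
    rw [← lintegral_inter_add_sdiff F P hSm, inter_eq_self_of_subset_right hSP,
      setLIntegral_congr_fun (g := fun _ => 0) (h.measurableSet.diff hSm)]
    · simp
    · intro y hy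
      refine h0 y hy.1 (le_antisymm (not_lt.1 fun hlt => hy.2 ?_) (h.nonneg y))
      exact mem_iUnion₂.2 ⟨c y, ⟨y, ⟨hy.1, hlt⟩, rfl⟩, hy.1, rfl⟩
  calc _ = ∑' x : U, ∫⁻ y in P ∩ {y | c y = x}, F y ∂μ := by
        rw [h1, hS, lintegral_biUnion h.countable (fun x _ => hmeas x) hdisj]
    _ ≤ ∑' x : U, C * ∫⁻ y in P ∩ {y | c y = x}, H y ∂μ := by
        refine ENNReal.tsum_le_tsum fun x => ?_
        obtain ⟨_, y₀, ⟨hy, hpos⟩, rfl⟩ := x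
        exact hC y₀ hy hpos
    _ = C * ∫⁻ y in S, H y ∂μ := by
        rw [ENNReal.tsum_mul_left, hS, lintegral_biUnion h.countable (fun x _ => hmeas x) hdisj]
    _ ≤ _ := by gcongr

/-- The map replacing the cell centred at `c y` by an `n`-dimensional disc. -/
noncomputable def discMap (c : Euc d → Euc d) (ρ : Euc d → ℝ) (L : Euc n →ₗᵢ[ℝ] Euc d)
    (z : Euc d × Euc n) : Euc d :=
  c z.1 + ρ z.1 • L z.2

variable {L : Euc n →ₗᵢ[ℝ] Euc d}

theorem measurable_discMap (h : CellMap P c ρ) : Measurable (discMap c ρ L) := by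
  have h1 := h.measurable_center
  have h2 := h.measurable_radius
  have h3 := L.continuous.measurable
  unfold discMap
  fun_prop

theorem norm_discMap_sub_le (h : CellMap P c ρ) {z : Euc d × Euc n} (hz : ‖z.2‖ ≤ 1) :
    ‖discMap c ρ L z - c z.1‖ ≤ ρ z.1 := by
  rw [discMap, add_sub_cancel_left, norm_smul, L.norm_map, Real.norm_of_nonneg (h.nonneg _)]
  exact mul_le_of_le_one_right (h.nonneg _) hz

theorem norm_rieszKer_sub_le (h : CellMap P c ρ) {ε : ℝ} (hε : 0 < ε) {z z' : Euc d × Euc n}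
    (hz : z.1 ∈ P) (hz' : z'.1 ∈ P) (hu : ‖z.2‖ ≤ 1) (hu' : ‖z'.2‖ ≤ 1) (hne : c z.1 ≠ c z'.1) :
    ‖rieszKer n ε (discMap c ρ L z - discMap c ρ L z') - rieszKer n ε (z.1 - z'.1)‖ ≤
      2 * (n + 2) * 3 ^ (n + 1) *
        (poissonBump n (ρ z'.1) ‖z.1 - z'.1‖ + poissonBump n (ρ z.1) ‖z.1 - z'.1‖) := by
  set p := discMap c ρ L z with hp
  set p' := discMap c ρ L z' with hp'
  set y := z.1
  set y' := z'.1
  have a1 : ‖p - c y‖ ≤ ρ y := h.norm_discMap_sub_le hu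
  have a2 : ‖p' - c y'‖ ≤ ρ y' := h.norm_discMap_sub_le hu'
  have a3 := h.norm_sub_le y hz
  have a4 := h.norm_sub_le y' hz'
  have a5 := h.le_norm_sub y hz y' hz' hne
  have hpos : 0 < ‖c y - c y'‖ := norm_pos_iff.2 (sub_ne_zero.2 hne)
  have r0 := h.nonneg y
  have r1 := h.nonneg y'
  have b1 : ‖y - y'‖ ≤ ‖c y - c y'‖ + ρ y + ρ y' := by
    calc ‖y - y'‖ = ‖(c y - c y') + (y - c y) - (y' - c y')‖ := by congr 1; abel
      _ ≤ ‖(c y - c y') + (y - c y)‖ + ‖y' - c y'‖ := _root_.norm_sub_le _ _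
      _ ≤ ‖c y - c y'‖ + ‖y - c y‖ + ‖y' - c y'‖ := by gcongr; exact norm_add_le _ _
      _ ≤ _ := by gcongr
  have b2 : ‖c y - c y'‖ ≤ ‖y - y'‖ + ρ y + ρ y' := by
    calc ‖c y - c y'‖ = ‖(y - y') - (y - c y) + (y' - c y')‖ := by congr 1; abel
      _ ≤ ‖(y - y') - (y - c y)‖ + ‖y' - c y'‖ := norm_add_le _ _
      _ ≤ ‖y - y'‖ + ‖y - c y‖ + ‖y' - c y'‖ := by gcongr; exact _root_.norm_sub_le _ _
      _ ≤ _ := by gcongr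
  have b3 : ‖c y - c y'‖ ≤ ‖p - p'‖ + ρ y + ρ y' := by
    calc ‖c y - c y'‖ = ‖(p - p') - (p - c y) + (p' - c y')‖ := by congr 1; abel
      _ ≤ ‖(p - p') - (p - c y)‖ + ‖p' - c y'‖ := norm_add_le _ _
      _ ≤ ‖p - p'‖ + ‖p - c y‖ + ‖p' - c y'‖ := by gcongr; exact _root_.norm_sub_le _ _
      _ ≤ _ := by gcongr
  have b4 : ‖(p - p') - (y - y')‖ ≤ 2 * (ρ y + ρ y') := by
    calc ‖(p - p') - (y - y')‖ = ‖((p - c y) - (p' - c y')) - ((y - c y) - (y' - c y'))‖ := by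
          congr 1; abel
      _ ≤ ‖(p - c y) - (p' - c y')‖ + ‖(y - c y) - (y' - c y')‖ := _root_.norm_sub_le _ _
      _ ≤ (‖p - c y‖ + ‖p' - c y'‖) + (‖y - c y‖ + ‖y' - c y'‖) := by
          gcongr <;> exact _root_.norm_sub_le _ _
      _ ≤ _ := by linarith
  set t := ‖y - y'‖ with ht
  set M := max t (ρ y + ρ y') with hM
  have tpos : 0 < t := by linarith
  have hMpos : 0 < M := tpos.trans_le (le_max_left _ _)
  have c1 : M / 3 ≤ ‖p - p'‖ := by
    rw [div_le_iff₀ three_pos]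
    exact max_le (by linarith) (by linarith)
  have c2 : M / 3 ≤ t := by
    rw [div_le_iff₀ three_pos]
    exact max_le (by linarith) (by linarith)
  refine (_root_.norm_rieszKer_sub_le n hε (by positivity) c1 c2).trans ?_
  have e1 : ρ y / M ^ (n + 1) ≤ poissonBump n (ρ y) t := by
    rcases r0.eq_or_lt with h0 | h0
    · rw [← h0]; simp [poissonBump]
    · unfold poissonBump
      have : max t (ρ y) ≤ M := max_le_max le_rfl (by linarith)
      gcongr
  have e2 : ρ y' / M ^ (n + 1) ≤ poissonBump n (ρ y') t := by
    unfold poissonBump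
    have : max t (ρ y') ≤ M := max_le_max le_rfl (by linarith)
    gcongr
  calc _ ≤ (n + 2) * (2 * (ρ y + ρ y')) / (M / 3) ^ (n + 1) := by gcongr
    _ = 2 * (n + 2) * 3 ^ (n + 1) * (ρ y' / M ^ (n + 1) + ρ y / M ^ (n + 1)) := by
        rw [div_pow]; field_simp; ring
    _ ≤ _ := by gcongr

end CellMap

namespace CellMap

variable {d n : ℕ} {P : Set (Euc d)} {c : Euc d → Euc d} {ρ : Euc d → ℝ} {L : Euc n →ₗᵢ[ℝ] Euc d}

theorem measure_cell_le (h : CellMap P c ρ) {μ : Measure (Euc d)} {C : ℝ} (hμ : GrowthDeg n μ C)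
    {y : Euc d} (hy : y ∈ P) (hpos : 0 < ρ y) :
    μ (P ∩ {y' | c y' = c y}) ≤ ENNReal.ofReal (C * ρ y ^ n) := by
  refine (measure_mono fun y' hy' => ?_).trans (hμ (c y) (ρ y) hpos)
  have hc : c y' = c y := hy'.2
  rw [mem_closedBall, dist_eq_norm, ← hc, ← h.radius_eq y' hy'.1 y hy hc]
  exact h.norm_sub_le y' hy'.1

/-- The part of a lifted Riesz transform coming from the cell of the point itself. -/
noncomputable def nearRiesz (P : Set (Euc d)) (c : Euc d → Euc d) (p : Euc d × Euc n → Euc d)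
    (μ : Measure (Euc d)) (ε : ℝ) (g : Euc d × Euc n → ℝ) (z : Euc d × Euc n) : Euc d :=
  ∫ z' in {z' | c z'.1 = c z.1}, g z' • rieszKer n ε (p z - p z')
    ∂((μ.restrict P).prod (unitBallMeasure n))

theorem measurable_nearRiesz (h : CellMap P c ρ) {p : Euc d × Euc n → Euc d} (hp : Measurable p)
    {μ : Measure (Euc d)} [IsFiniteMeasure μ]
    {ε : ℝ} (hε : 0 < ε) {g : Euc d × Euc n → ℝ} (hg : Measurable g) :
    Measurable (nearRiesz P c p μ ε g) := by
  have hk := (continuous_rieszKer n (d := d) hε).measurable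
  have hc := h.measurable_center
  have hset : MeasurableSet {q : (Euc d × Euc n) × (Euc d × Euc n) | c q.2.1 = c q.1.1} :=
    measurableSet_eq_fun (by fun_prop) (by fun_prop)
  have h1 : StronglyMeasurable (indicator
      {q : (Euc d × Euc n) × (Euc d × Euc n) | c q.2.1 = c q.1.1} fun q =>
      g q.2 • rieszKer n ε (p q.1 - p q.2)) :=
    Measurable.stronglyMeasurable (Measurable.indicator (by fun_prop) hset)
  have h2 := (h1.integral_prod_right'
    (ν := (μ.restrict P).prod (unitBallMeasure n))).measurable
  convert h2 using 1
  ext1 z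
  have hs : MeasurableSet {z' : Euc d × Euc n | c z'.1 = c z.1} :=
    measurableSet_eq_fun (by fun_prop) (by fun_prop)
  rw [nearRiesz, ← integral_indicator hs]
  rfl

theorem nearRiesz_eq_zero (h : CellMap P c ρ) {μ : Measure (Euc d)} [IsFiniteMeasure μ]
    {ε : ℝ} {g : Euc d × Euc n → ℝ} {z : Euc d × Euc n} (hz : z.1 ∈ P) (h0 : ρ z.1 = 0) :
    nearRiesz P c (discMap c ρ L) μ ε g z = 0 := by
  have hs : MeasurableSet {z' : Euc d × Euc n | c z'.1 = c z.1} :=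
    measurableSet_eq_fun (h.measurable_center.comp measurable_fst) measurable_const
  have hP : ∀ᵐ z' ∂((μ.restrict P).prod (unitBallMeasure n)), z'.1 ∈ P :=
    Measure.quasiMeasurePreserving_fst.ae (ae_restrict_mem h.measurableSet)
  refine integral_eq_zero_of_ae ?_
  filter_upwards [ae_restrict_of_ae hP, ae_restrict_mem hs] with z' h1 h2
  have h3 : ρ z'.1 = 0 := by rw [h.radius_eq _ h1 _ hz h2, h0]
  have h2' : c z'.1 = c z.1 := h2
  simp [discMap, h3, h0, h2']

theorem nearRiesz_eq (h : CellMap P c ρ) {μ : Measure (Euc d)} [IsFiniteMeasure μ]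
    {ε : ℝ} (hε : 0 < ε) {g : Euc d × Euc n → ℝ} (hgm : Measurable g)
    (hg : Integrable g ((μ.restrict P).prod (unitBallMeasure n)))
    {y₀ : Euc d} (hy₀ : y₀ ∈ P) (hpos : 0 < ρ y₀) {y : Euc d} (hy : y ∈ P ∩ {y | c y = c y₀})
    (u : Euc n) :
    nearRiesz P c (discMap c ρ L) μ ε g (y, u) = (ρ y₀ ^ n)⁻¹ • L (smoothRiesz n (unitBallMeasure n)
      (ε / ρ y₀) (fun u' => ∫ y' in P ∩ {y | c y = c y₀}, g (y', u') ∂μ) u) := by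
  have hcy : c y = c y₀ := hy.2
  have hT : MeasurableSet {y | c y = c y₀} := h.measurable_center (measurableSet_singleton _)
  have hQ : MeasurableSet (P ∩ {y | c y = c y₀}) := h.measurableSet.inter hT
  have hρ : ∀ y' ∈ P ∩ {y | c y = c y₀}, ρ y' = ρ y₀ := fun y' hy' =>
    h.radius_eq _ hy'.1 _ hy₀ hy'.2
  have hset : {z' : Euc d × Euc n | c z'.1 = c y₀} = {y | c y = c y₀} ×ˢ univ := by
    ext z'; simp
  have hmeas : ((μ.restrict P).prod (unitBallMeasure n)).restrict
      {z' : Euc d × Euc n | c z'.1 = c y₀} =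
      (μ.restrict (P ∩ {y | c y = c y₀})).prod (unitBallMeasure n) := by
    rw [hset, ← Measure.prod_restrict, Measure.restrict_univ, Measure.restrict_restrict hT,
      inter_comm]
  have hgi : Integrable g ((μ.restrict (P ∩ {y | c y = c y₀})).prod (unitBallMeasure n)) := by
    rw [← hmeas]; exact hg.restrict
  have hk := (continuous_rieszKer n (d := n) (div_pos hε hpos)).measurable
  have hL := L.continuous.measurable
  unfold nearRiesz
  simp only [hcy]
  rw [hmeas]
  have h1 : ∀ᵐ z' ∂((μ.restrict (P ∩ {y | c y = c y₀})).prod (unitBallMeasure n)),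
      g z' • rieszKer n ε (discMap c ρ L (y, u) - discMap c ρ L z') =
      (ρ y₀ ^ n)⁻¹ • (g z' • L (rieszKer n (ε / ρ y₀) (u - z'.2))) := by
    filter_upwards [Measure.quasiMeasurePreserving_fst.ae (ae_restrict_mem hQ)] with z' hz'
    have hc' : c z'.1 = c y₀ := hz'.2
    rw [smul_comm, ← rieszKer_smul_map L ε hpos]
    simp only [discMap, hcy, hc', hρ y hy, hρ _ hz', add_sub_add_left_eq_sub, map_sub, smul_sub]
  rw [integral_congr_ae h1, integral_smul, integral_prod_symm]
  · congr 1
    rw [smoothRiesz, ← LinearIsometry.integral_comp_comm]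
    congr 1; ext1 u'
    simp only
    rw [integral_smul_const, map_smul]
  · refine (hgi.norm.mul_const ((ε / ρ y₀) ^ n)⁻¹).mono'
      (Measurable.aestronglyMeasurable (by fun_prop)) (Eventually.of_forall fun z' => ?_)
    rw [norm_smul, L.norm_map]
    gcongr
    exact norm_rieszKer_le n (div_pos hε hpos) _

theorem exists_lintegral_sq_nearRiesz_le (h : CellMap P c ρ) {μ : Measure (Euc d)}
    [IsFiniteMeasure μ] {C : ℝ} (hμ : GrowthDeg n μ C) :
    ∃ D : ℝ≥0∞, D ≠ ⊤ ∧ ∀ ε : ℝ, 0 < ε → ∀ g : Euc d × Euc n → ℝ, Measurable g →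
      ∫⁻ z, ‖g z‖ₑ ^ 2 ∂((μ.restrict P).prod (unitBallMeasure n)) ≠ ⊤ →
      ∫⁻ z, ‖nearRiesz P c (discMap c ρ L) μ ε g z‖ₑ ^ 2
        ∂((μ.restrict P).prod (unitBallMeasure n)) ≤
        D * ∫⁻ z, ‖g z‖ₑ ^ 2 ∂((μ.restrict P).prod (unitBallMeasure n)) := by
  obtain ⟨B, hB, hbound⟩ := smoothRieszBounded_unitBallMeasure n
  refine ⟨ENNReal.ofReal C ^ 2 * B, by finiteness, fun ε hε g hg hg2 => ?_⟩
  have hgi := integrable_of_lintegral_sq_ne_top hg.aestronglyMeasurable hg2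
  have hAm := h.measurable_nearRiesz (h.measurable_discMap (L := L)) (μ := μ) hε hg
  rw [lintegral_prod _ (by fun_prop), lintegral_prod _ (by fun_prop)] at *
  refine h.lintegral_le μ (fun y hy h0 => ?_) fun y₀ hy₀ hpos => ?_
  · simp [h.nearRiesz_eq_zero (z := (y, _)) hy h0]
  set Q := P ∩ {y | c y = c y₀} with hQdef
  have hQ : MeasurableSet Q :=
    h.measurableSet.inter (h.measurable_center (measurableSet_singleton _))
  set s := ρ y₀
  set H : Euc n → ℝ := fun u' => ∫ y' in Q, g (y', u') ∂μ with hH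
  have hHm : Measurable H := by
    have : StronglyMeasurable (Function.uncurry fun (u : Euc n) (y : Euc d) => g (y, u)) := by
      unfold Function.uncurry
      exact Measurable.stronglyMeasurable (by fun_prop)
    exact (this.integral_prod_right (ν := μ.restrict Q)).measurable
  have hH2 : ∫⁻ u, ‖H u‖ₑ ^ 2 ∂unitBallMeasure n ≤
      μ Q * ∫⁻ y in Q, ∫⁻ u, ‖g (y, u)‖ₑ ^ 2 ∂unitBallMeasure n ∂μ := by
    rw [lintegral_lintegral_swap (by unfold Function.uncurry; fun_prop),
      ← lintegral_const_mul _ (Measurable.lintegral_prod_left (by fun_prop))]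
    refine lintegral_mono fun u => ?_
    calc _ ≤ (∫⁻ y in Q, ‖g (y, u)‖ₑ ∂μ) ^ 2 := by
          gcongr
          exact enorm_integral_le_lintegral_enorm _
      _ ≤ _ := by
          refine (sq_lintegral_le _ (by fun_prop)).trans_eq ?_
          rw [Measure.restrict_apply_univ]
  have hHtop : ∫⁻ u, ‖H u‖ₑ ^ 2 ∂unitBallMeasure n ≠ ⊤ := by
    refine ne_top_of_le_ne_top (ENNReal.mul_ne_top (measure_ne_top μ Q) ?_) hH2
    exact ne_top_of_le_ne_top hg2 (lintegral_mono' (Measure.restrict_mono inter_subset_left le_rfl)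
      le_rfl)
  have h1 : ∀ y ∈ Q, ∫⁻ u, ‖nearRiesz P c (discMap c ρ L) μ ε g (y, u)‖ₑ ^ 2 ∂unitBallMeasure n =
      ENNReal.ofReal (s ^ n)⁻¹ ^ 2 *
        ∫⁻ u, ‖smoothRiesz n (unitBallMeasure n) (ε / s) H u‖ₑ ^ 2 ∂unitBallMeasure n := by
    intro y hy
    rw [← lintegral_const_mul' _ _ (by finiteness)]
    refine lintegral_congr fun u => ?_
    rw [h.nearRiesz_eq hε hg hgi hy₀ hpos hy, enorm_smul, L.enorm_map, mul_pow,
      ← ofReal_norm (s ^ n)⁻¹, Real.norm_of_nonneg (by positivity)]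
  rw [setLIntegral_congr_fun hQ h1, lintegral_const, Measure.restrict_apply_univ]
  calc _ ≤ ENNReal.ofReal (s ^ n)⁻¹ ^ 2 * (B * (μ Q *
          ∫⁻ y in Q, ∫⁻ u, ‖g (y, u)‖ₑ ^ 2 ∂unitBallMeasure n ∂μ)) * μ Q := by
        gcongr
        exact (hbound _ (div_pos hε hpos) H hHm hHtop).trans (by gcongr)
    _ = (ENNReal.ofReal (s ^ n)⁻¹ * μ Q) ^ 2 * B *
          ∫⁻ y in Q, ∫⁻ u, ‖g (y, u)‖ₑ ^ 2 ∂unitBallMeasure n ∂μ := by ring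
    _ ≤ _ := by
        gcongr
        calc _ ≤ ENNReal.ofReal (s ^ n)⁻¹ * ENNReal.ofReal (C * s ^ n) := by
              gcongr
              exact h.measure_cell_le hμ hy₀ hpos
          _ = ENNReal.ofReal C := by
              rw [← ENNReal.ofReal_mul (by positivity)]
              congr 1
              field_simp

end CellMap

theorem lintegral_add_sq_le {α : Type*} [MeasurableSpace α] {μ : Measure α} {f g : α → ℝ≥0∞}
    (hf : Measurable f) {A B X : ℝ≥0∞} (hA : ∫⁻ x, f x ^ 2 ∂μ ≤ A * X)
    (hB : ∫⁻ x, g x ^ 2 ∂μ ≤ B * X) : ∫⁻ x, (f x + g x) ^ 2 ∂μ ≤ 2 * (A + B) * X := by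
  calc _ ≤ ∫⁻ x, 2 * (f x ^ 2 + g x ^ 2) ∂μ :=
        lintegral_mono fun x => ENNReal.add_sq_le_two_mul _ _
    _ = 2 * (∫⁻ x, f x ^ 2 ∂μ + ∫⁻ x, g x ^ 2 ∂μ) := by
        rw [lintegral_const_mul' _ _ (by simp), lintegral_add_left (by fun_prop)]
    _ ≤ 2 * (A * X + B * X) := by gcongr
    _ = _ := by ring

theorem lintegral_sq_enorm_indicator {α : Type*} [MeasurableSpace α] {μ : Measure α} {S : Set α}
    (hS : MeasurableSet S) (f : α → ℝ) :
    ∫⁻ x, ‖S.indicator f x‖ₑ ^ 2 ∂μ = ∫⁻ x in S, ‖f x‖ₑ ^ 2 ∂μ := by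
  rw [← lintegral_indicator hS]
  congr 1; ext x
  by_cases hx : x ∈ S <;> simp [hx]

theorem integrable_smul_rieszKer {α : Type*} [MeasurableSpace α] {m : Measure α} {n d : ℕ} {ε : ℝ}
    (hε : 0 < ε) {g : α → ℝ} (hgm : Measurable g) (hg : Integrable g m) {q : α → Euc d}
    (hq : Measurable q) : Integrable (fun z => g z • rieszKer n ε (q z)) m := by
  have hk := (continuous_rieszKer n (d := d) hε).measurable
  refine (hg.norm.mul_const (ε ^ n)⁻¹).mono' (Measurable.aestronglyMeasurable (by fun_prop))
    (Eventually.of_forall fun z => ?_)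
  rw [norm_smul]
  gcongr
  exact norm_rieszKer_le n hε _

namespace CellMap

variable {d n : ℕ} {P : Set (Euc d)} {c : Euc d → Euc d} {ρ : Euc d → ℝ} {L : Euc n →ₗᵢ[ℝ] Euc d}
  {μ : Measure (Euc d)} [IsFiniteMeasure μ] {ε : ℝ} {g : Euc d × Euc n → ℝ}

theorem nearRiesz_fst_eq (h : CellMap P c ρ) (hε : 0 < ε) (hgm : Measurable g)
    (hg : Integrable g ((μ.restrict P).prod (unitBallMeasure n))) (z : Euc d × Euc n) :
    nearRiesz P c Prod.fst μ ε g z = smoothRiesz n μ ε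
      ((P ∩ {y | c y = c z.1}).indicator fun y => ∫ u, g (y, u) ∂unitBallMeasure n) z.1 := by
  have hT : MeasurableSet {y | c y = c z.1} := h.measurable_center (measurableSet_singleton _)
  have hset : {z' : Euc d × Euc n | c z'.1 = c z.1} = {y | c y = c z.1} ×ˢ univ := by
    ext z'; simp
  have hmeas : ((μ.restrict P).prod (unitBallMeasure n)).restrict
      {z' : Euc d × Euc n | c z'.1 = c z.1} =
      (μ.restrict (P ∩ {y | c y = c z.1})).prod (unitBallMeasure n) := by
    rw [hset, ← Measure.prod_restrict, Measure.restrict_univ, Measure.restrict_restrict hT,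
      inter_comm]
  have hgi : Integrable g ((μ.restrict (P ∩ {y | c y = c z.1})).prod (unitBallMeasure n)) := by
    rw [← hmeas]; exact hg.restrict
  rw [nearRiesz, hmeas, integral_prod _ (integrable_smul_rieszKer hε hgm hgi (by fun_prop)),
    smoothRiesz, ← integral_indicator (h.measurableSet.inter hT)]
  congr 1; ext1 y
  by_cases hy : y ∈ P ∩ {y | c y = c z.1}
  · rw [indicator_of_mem hy, indicator_of_mem hy]
    simp only
    rw [integral_smul_const]
  · rw [indicator_of_notMem hy, indicator_of_notMem hy, zero_smul]

theorem lintegral_sq_nearRiesz_fst_le (h : CellMap P c ρ) {B : ℝ≥0∞}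
    (hB : ∀ f : Euc d → ℝ, Measurable f → ∫⁻ x, ‖f x‖ₑ ^ 2 ∂μ ≠ ⊤ →
      ∫⁻ x, ‖smoothRiesz n μ ε f x‖ₑ ^ 2 ∂μ ≤ B * ∫⁻ x, ‖f x‖ₑ ^ 2 ∂μ)
    (hε : 0 < ε) (hgm : Measurable g)
    (hg : Integrable g ((μ.restrict P).prod (unitBallMeasure n)))
    {G : Euc d → ℝ} (hG : G = fun y => ∫ u, g (y, u) ∂unitBallMeasure n) (hGm : Measurable G)
    (hG2 : ∫⁻ y in P, ‖G y‖ₑ ^ 2 ∂μ ≠ ⊤) :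
    ∫⁻ z, ‖nearRiesz P c Prod.fst μ ε g z‖ₑ ^ 2 ∂((μ.restrict P).prod (unitBallMeasure n)) ≤
      B * ∫⁻ y in P, ‖G y‖ₑ ^ 2 ∂μ := by
  have hm := h.measurable_nearRiesz (p := Prod.fst) (by fun_prop) (μ := μ) hε hgm
  rw [lintegral_prod _ (by fun_prop)]
  simp_rw [h.nearRiesz_fst_eq hε hgm hg, ← hG, lintegral_const, measure_univ, mul_one]
  refine h.lintegral_le μ (fun y hy h0 => ?_) fun y₀ hy₀ hpos => ?_
  · have : smoothRiesz n μ ε ((P ∩ {y' | c y' = c y}).indicator G) y = 0 := by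
      refine integral_eq_zero_of_ae (Eventually.of_forall fun y' => ?_)
      by_cases hy' : y' ∈ P ∩ {y' | c y' = c y}
      · have e1 := h.norm_sub_le y hy
        have e2 := h.norm_sub_le y' hy'.1
        rw [h.radius_eq y' hy'.1 y hy hy'.2, h0, norm_le_zero_iff, sub_eq_zero] at e2
        rw [h0, norm_le_zero_iff, sub_eq_zero] at e1
        have : y' = y := by rw [e2, e1]; exact hy'.2
        simp [this]
      · simp only [indicator_of_notMem hy', zero_smul, Pi.zero_apply]
    simp [this]
  · set Q := P ∩ {y | c y = c y₀} with hQdef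
    have hQ : MeasurableSet Q :=
      h.measurableSet.inter (h.measurable_center (measurableSet_singleton _))
    have h1 : ∀ y ∈ Q, ‖smoothRiesz n μ ε ((P ∩ {y' | c y' = c y}).indicator G) y‖ₑ ^ 2 =
        ‖smoothRiesz n μ ε (Q.indicator G) y‖ₑ ^ 2 := by
      intro y hy
      have : c y = c y₀ := hy.2
      rw [this]
    rw [setLIntegral_congr_fun hQ h1]
    refine (setLIntegral_le_lintegral _ _).trans ((hB _ (hGm.indicator hQ) ?_).trans_eq ?_)
    · rw [lintegral_sq_enorm_indicator hQ]
      exact ne_top_of_le_ne_top hG2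
        (lintegral_mono' (Measure.restrict_mono inter_subset_left le_rfl) le_rfl)
    · rw [lintegral_sq_enorm_indicator hQ]

/-- The far part of the Riesz transform of the disc measure is a perturbation of that of `μ`. -/
theorem enorm_riesz_discMap_le (h : CellMap P c ρ) (hε : 0 < ε) (hgm : Measurable g)
    (hg : Integrable g ((μ.restrict P).prod (unitBallMeasure n))) {z : Euc d × Euc n}
    (hz : z.1 ∈ P) (hu : ‖z.2‖ ≤ 1) :
    ‖∫ z', g z' • rieszKer n ε (discMap c ρ L z - discMap c ρ L z')
      ∂((μ.restrict P).prod (unitBallMeasure n))‖ₑ ≤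
    ‖smoothRiesz n μ ε (P.indicator fun y => ∫ u, g (y, u) ∂unitBallMeasure n) z.1‖ₑ +
    (‖nearRiesz P c (discMap c ρ L) μ ε g z‖ₑ + (‖nearRiesz P c Prod.fst μ ε g z‖ₑ +
    ENNReal.ofReal (2 * (n + 2) * 3 ^ (n + 1)) * (
      (∫⁻ y', ENNReal.ofReal (poissonBump n (ρ y') ‖z.1 - y'‖) *
        P.indicator (fun y => ∫⁻ u, ‖g (y, u)‖ₑ ∂unitBallMeasure n) y' ∂μ) +
      ∫⁻ y', ENNReal.ofReal (poissonBump n (ρ z.1) ‖z.1 - y'‖) *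
        P.indicator (fun y => ∫⁻ u, ‖g (y, u)‖ₑ ∂unitBallMeasure n) y' ∂μ))) := by
  set m := (μ.restrict P).prod (unitBallMeasure n) with hm
  have hp := h.measurable_discMap (L := L)
  have hρ := h.measurable_radius
  have hc := h.measurable_center
  set N := {z' : Euc d × Euc n | c z'.1 = c z.1} with hN
  have hNm : MeasurableSet N := measurableSet_eq_fun (by fun_prop) (by fun_prop)
  set K₁ : Euc d × Euc n → Euc d :=
    fun z' => g z' • rieszKer n ε (discMap c ρ L z - discMap c ρ L z') with hK₁
  set K₂ : Euc d × Euc n → Euc d := fun z' => g z' • rieszKer n ε (z.1 - z'.1) with hK₂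
  have i1 : Integrable K₁ m := integrable_smul_rieszKer hε hgm hg (by fun_prop)
  have i2 : Integrable K₂ m := integrable_smul_rieszKer hε hgm hg (by fun_prop)
  have hT : ∫ z', K₂ z' ∂m =
      smoothRiesz n μ ε (P.indicator fun y => ∫ u, g (y, u) ∂unitBallMeasure n) z.1 := by
    rw [hm, integral_prod _ i2, smoothRiesz, ← integral_indicator h.measurableSet]
    congr 1; ext1 y
    by_cases hy : y ∈ P
    · rw [indicator_of_mem hy, indicator_of_mem hy, hK₂]
      simp only
      rw [integral_smul_const]
    · rw [indicator_of_notMem hy, indicator_of_notMem hy, zero_smul]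
  have hsplit : ∫ z', K₁ z' ∂m = ∫ z', K₂ z' ∂m + (∫ z' in N, K₁ z' ∂m +
      (-(∫ z' in N, K₂ z' ∂m) + ∫ z' in Nᶜ, (K₁ z' - K₂ z') ∂m)) := by
    rw [← integral_add_compl hNm i1, ← integral_add_compl hNm i2,
      integral_sub i1.restrict i2.restrict]
    abel
  rw [hsplit, hT]
  refine (enorm_add_le _ _).trans (add_le_add le_rfl ?_)
  refine (enorm_add_le _ _).trans (add_le_add le_rfl ?_)
  refine (enorm_add_le _ _).trans (add_le_add ?_ ?_)
  · rw [enorm_neg]; rfl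
  have hae : ∀ᵐ z' ∂m, z'.1 ∈ P ∧ ‖z'.2‖ ≤ 1 := by
    filter_upwards [Measure.quasiMeasurePreserving_fst.ae (ae_restrict_mem h.measurableSet),
      Measure.quasiMeasurePreserving_snd.ae (ae_mem_closedBall_unitBallMeasure n)] with z' h1 h2
    exact ⟨h1, by simpa using h2⟩
  set D := ENNReal.ofReal (2 * (n + 2) * 3 ^ (n + 1)) with hD
  calc _ ≤ ∫⁻ z' in Nᶜ, ‖K₁ z' - K₂ z'‖ₑ ∂m := enorm_integral_le_lintegral_enorm _
    _ ≤ ∫⁻ z' in Nᶜ, D * ((ENNReal.ofReal (poissonBump n (ρ z'.1) ‖z.1 - z'.1‖) +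
          ENNReal.ofReal (poissonBump n (ρ z.1) ‖z.1 - z'.1‖)) * ‖g z'‖ₑ) ∂m := by
        refine lintegral_mono_ae ?_
        filter_upwards [ae_restrict_of_ae hae, ae_restrict_mem hNm.compl] with z' h1 h2
        rw [hK₁, hK₂]
        simp only
        rw [← smul_sub, enorm_smul, mul_comm, ← mul_assoc]
        gcongr
        rw [← ENNReal.ofReal_add (poissonBump_nonneg n (h.nonneg _))
          (poissonBump_nonneg n (h.nonneg _)), hD, ← ENNReal.ofReal_mul (by positivity),
          ← ofReal_norm]
        exact ENNReal.ofReal_le_ofReal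
          (h.norm_rieszKer_sub_le hε hz h1.1 hu h1.2 fun h3 => h2 h3.symm)
    _ ≤ ∫⁻ z', D * ((ENNReal.ofReal (poissonBump n (ρ z'.1) ‖z.1 - z'.1‖) +
          ENNReal.ofReal (poissonBump n (ρ z.1) ‖z.1 - z'.1‖)) * ‖g z'‖ₑ) ∂m :=
        setLIntegral_le_lintegral _ _
    _ = D * ∫⁻ y in P, (ENNReal.ofReal (poissonBump n (ρ y) ‖z.1 - y‖) +
          ENNReal.ofReal (poissonBump n (ρ z.1) ‖z.1 - y‖)) *
          ∫⁻ u, ‖g (y, u)‖ₑ ∂unitBallMeasure n ∂μ := by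
        rw [lintegral_const_mul' _ _ (by finiteness), hm, lintegral_prod _ (by fun_prop)]
        congr 1
        refine lintegral_congr fun y => ?_
        simp only
        rw [lintegral_const_mul' _ _ (by finiteness)]
    _ = _ := by
        rw [← lintegral_indicator h.measurableSet, ← lintegral_add_left]
        · congr 2; ext1 y
          by_cases hy : y ∈ P
          · simp only [indicator_of_mem hy, add_mul]
          · simp only [indicator_of_notMem hy, mul_zero, add_zero]
        · refine Measurable.mul (by fun_prop) (Measurable.indicator ?_ h.measurableSet)
          exact Measurable.lintegral_prod_right (by fun_prop)

end CellMap

namespace CellMap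

variable {d n : ℕ} {P : Set (Euc d)} {c : Euc d → Euc d} {ρ : Euc d → ℝ} {L : Euc n →ₗᵢ[ℝ] Euc d}
  {μ : Measure (Euc d)} [IsFiniteMeasure μ]

/-- The measure obtained from `μ` restricted to `P` by spreading each cell over an
`n`-dimensional disc. -/
noncomputable def discMeasure (P : Set (Euc d)) (c : Euc d → Euc d) (ρ : Euc d → ℝ)
    (L : Euc n →ₗᵢ[ℝ] Euc d) (μ : Measure (Euc d)) : Measure (Euc d) :=
  ((μ.restrict P).prod (unitBallMeasure n)).map (discMap c ρ L)

instance : IsFiniteMeasure (discMeasure P c ρ L μ) := by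
  unfold discMeasure
  infer_instance

theorem smoothRieszBounded_discMeasure (h : CellMap P c ρ) {C : ℝ} (hC0 : 0 ≤ C)
    (hμ : GrowthDeg n μ C) (hR : SmoothRieszBounded n μ) :
    SmoothRieszBounded n (discMeasure P c ρ L μ) := by
  obtain ⟨B, hB, hR⟩ := hR
  obtain ⟨B', hB', hnear⟩ := h.exists_lintegral_sq_nearRiesz_le (L := L) hμ
  set D := ENNReal.ofReal (2 * (n + 2) * 3 ^ (n + 1)) with hD
  set Q : ℝ≥0∞ := (2 * ENNReal.ofReal (2 ^ (n + 1)) * ENNReal.ofReal (C * 2 ^ (n + 1))) ^ 2 with hQ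
  have hρ := h.measurable_radius
  have hQtop : Q ≠ ⊤ := by rw [hQ]; finiteness
  refine ⟨2 * (B + 2 * (B' + 2 * (B + D ^ 2 * (2 * (Q + Q))))), by finiteness,
    fun ε hε f hf hf2 => ?_⟩
  have hp := h.measurable_discMap (L := L)
  set m := (μ.restrict P).prod (unitBallMeasure n) with hm
  set g : Euc d × Euc n → ℝ := fun z => f (discMap c ρ L z) with hgdef
  have hgm : Measurable g := by fun_prop
  have hk := (continuous_rieszKer n (d := d) hε).measurable
  have hsm : Measurable (smoothRiesz n (discMeasure P c ρ L μ) ε f) :=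
    measurable_smoothRiesz n hε hf
  have hgf : ∫⁻ x, ‖f x‖ₑ ^ 2 ∂(discMeasure P c ρ L μ) = ∫⁻ z, ‖g z‖ₑ ^ 2 ∂m := by
    rw [discMeasure, lintegral_map (by fun_prop) hp]
  have hSf : ∫⁻ x, ‖smoothRiesz n (discMeasure P c ρ L μ) ε f x‖ₑ ^ 2 ∂(discMeasure P c ρ L μ) =
      ∫⁻ z, ‖∫ z', g z' • rieszKer n ε (discMap c ρ L z - discMap c ρ L z') ∂m‖ₑ ^ 2 ∂m := by
    rw [show ∫⁻ x, ‖smoothRiesz n (discMeasure P c ρ L μ) ε f x‖ₑ ^ 2 ∂(discMeasure P c ρ L μ) =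
      ∫⁻ x, ‖smoothRiesz n (discMeasure P c ρ L μ) ε f x‖ₑ ^ 2 ∂(m.map (discMap c ρ L)) from rfl,
      lintegral_map (by fun_prop) hp]
    refine lintegral_congr fun z => ?_
    rw [smoothRiesz, discMeasure,
      integral_map hp.aemeasurable (Measurable.aestronglyMeasurable (by fun_prop))]
  rw [hgf] at hf2 ⊢
  rw [hSf]
  have hg : Integrable g m := integrable_of_lintegral_sq_ne_top hgm.aestronglyMeasurable hf2
  set X := ∫⁻ z, ‖g z‖ₑ ^ 2 ∂m with hX
  set G : Euc d → ℝ := fun y => ∫ u, g (y, u) ∂unitBallMeasure n with hG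
  set G' : Euc d → ℝ≥0∞ := fun y => ∫⁻ u, ‖g (y, u)‖ₑ ∂unitBallMeasure n with hG'
  have hGm : Measurable G :=
    (hgm.stronglyMeasurable.integral_prod_right' (ν := unitBallMeasure n)).measurable
  have hGm' : Measurable G' := Measurable.lintegral_prod_right (by fun_prop)
  have hG'X : ∫⁻ y in P, G' y ^ 2 ∂μ ≤ X := by
    rw [hX, hm, lintegral_prod _ (by fun_prop)]
    refine lintegral_mono fun y => ?_
    refine (sq_lintegral_le _ (by fun_prop)).trans_eq ?_
    rw [measure_univ, one_mul]
  have hGX : ∫⁻ y in P, ‖G y‖ₑ ^ 2 ∂μ ≤ X := by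
    refine le_trans (lintegral_mono fun y => ?_) hG'X
    gcongr
    exact enorm_integral_le_lintegral_enorm _
  have hGP : ∫⁻ y, P.indicator G' y ^ 2 ∂μ ≤ X := by
    refine le_trans (le_of_eq ?_) hG'X
    rw [← lintegral_indicator h.measurableSet]
    congr 1; ext y
    by_cases hy : y ∈ P <;> simp [hy]
  have hGPm : Measurable (P.indicator G') := hGm'.indicator h.measurableSet
  have hmfst : ∀ F : Euc d → ℝ≥0∞, Measurable F → ∫⁻ z, F z.1 ∂m ≤ ∫⁻ y, F y ∂μ := by
    intro F hF
    rw [hm, lintegral_prod _ (by fun_prop)]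
    simp only [lintegral_const, measure_univ, mul_one]
    exact setLIntegral_le_lintegral _ _
  -- the four contributions
  have k1 : ∫⁻ z, ‖smoothRiesz n μ ε (P.indicator G) z.1‖ₑ ^ 2 ∂m ≤ B * X := by
    have hmm : Measurable (smoothRiesz n μ ε (P.indicator G)) :=
      measurable_smoothRiesz n hε (hGm.indicator h.measurableSet)
    refine (hmfst (fun y => ‖smoothRiesz n μ ε (P.indicator G) y‖ₑ ^ 2) (by fun_prop)).trans ?_
    have := hR ε hε (P.indicator G) (hGm.indicator h.measurableSet)
    rw [lintegral_sq_enorm_indicator h.measurableSet] at this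
    exact (this (ne_top_of_le_ne_top hf2 hGX)).trans (by gcongr)
  have k2 : ∫⁻ z, ‖nearRiesz P c (discMap c ρ L) μ ε g z‖ₑ ^ 2 ∂m ≤ B' * X :=
    hnear ε hε g hgm hf2
  have k3 : ∫⁻ z, ‖nearRiesz P c Prod.fst μ ε g z‖ₑ ^ 2 ∂m ≤ B * X :=
    (h.lintegral_sq_nearRiesz_fst_le (hR ε hε) hε hgm hg hG hGm
      (ne_top_of_le_ne_top hf2 hGX)).trans (by gcongr)
  have hpk : Measurable (Function.uncurry fun y y' : Euc d =>
      ENNReal.ofReal (poissonBump n (ρ y') ‖y - y'‖)) := by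
    unfold Function.uncurry
    fun_prop
  have hpk' : Measurable (Function.uncurry fun y y' : Euc d =>
      ENNReal.ofReal (poissonBump n (ρ y) ‖y - y'‖) * P.indicator G' y') := by
    unfold Function.uncurry
    fun_prop
  have hpk2 : Measurable (Function.uncurry fun y y' : Euc d =>
      ENNReal.ofReal (poissonBump n (ρ y') ‖y - y'‖) * P.indicator G' y') := by
    unfold Function.uncurry
    fun_prop
  set P₁ : Euc d → ℝ≥0∞ := fun y => ∫⁻ y', ENNReal.ofReal (poissonBump n (ρ y') ‖y - y'‖) *
        P.indicator G' y' ∂μ with hP₁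
  set P₂ : Euc d → ℝ≥0∞ := fun y => ∫⁻ y', ENNReal.ofReal (poissonBump n (ρ y) ‖y - y'‖) *
        P.indicator G' y' ∂μ with hP₂
  have hP₁m : Measurable P₁ := hpk2.lintegral_prod_right'
  have hP₂m : Measurable P₂ := hpk'.lintegral_prod_right'
  have k4 : ∫⁻ y, P₁ y ^ 2 ∂μ ≤ Q * X :=
    (lintegral_sq_poissonBump_le hC0 hμ hρ h.nonneg hGPm).trans (by gcongr)
  have k5 : ∫⁻ y, P₂ y ^ 2 ∂μ ≤ Q * X := by
    have := lintegral_sq_kernel_transpose_le μ hpk (C := Q)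
      (fun f hf => lintegral_sq_poissonBump_le hC0 hμ hρ h.nonneg hf) hGPm
    refine le_trans (le_of_eq ?_) (this.trans (by gcongr))
    simp only [hP₂, norm_sub_rev]
  have k6 : ∫⁻ z, (D * (P₁ z.1 + P₂ z.1)) ^ 2 ∂m ≤ D ^ 2 * (2 * (Q + Q)) * X := by
    refine (hmfst (fun y => (D * (P₁ y + P₂ y)) ^ 2) (by fun_prop)).trans ?_
    simp_rw [mul_pow]
    rw [lintegral_const_mul' _ _ (by finiteness), mul_assoc]
    gcongr
    exact lintegral_add_sq_le hP₁m k4 k5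
  have n2 := h.measurable_nearRiesz hp (μ := μ) hε hgm
  have n3 := h.measurable_nearRiesz (p := Prod.fst) (by fun_prop) (μ := μ) hε hgm
  have n1 : Measurable fun z : Euc d × Euc n => smoothRiesz n μ ε (P.indicator G) z.1 :=
    (measurable_smoothRiesz n hε (hGm.indicator h.measurableSet)).comp measurable_fst
  refine le_trans (lintegral_mono_ae ?_) (lintegral_add_sq_le n1.enorm k1
    (lintegral_add_sq_le n2.enorm k2 (lintegral_add_sq_le n3.enorm k3 k6)))
  filter_upwards [Measure.quasiMeasurePreserving_fst.ae (ae_restrict_mem h.measurableSet),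
    Measure.quasiMeasurePreserving_snd.ae (ae_mem_closedBall_unitBallMeasure n)] with z h1 h2
  gcongr
  exact h.enorm_riesz_discMap_le hε hgm hg h1 (by simpa using h2)

end CellMap

namespace CellMap

variable {d n : ℕ} {P : Set (Euc d)} {c : Euc d → Euc d} {ρ : Euc d → ℝ} {L : Euc n →ₗᵢ[ℝ] Euc d}
  {μ : Measure (Euc d)}

theorem ae_mem_prod (h : CellMap P c ρ) :
    ∀ᵐ z ∂((μ.restrict P).prod (unitBallMeasure n)), z.1 ∈ P ∧ ‖z.2‖ ≤ 1 := by
  filter_upwards [Measure.quasiMeasurePreserving_fst.ae (ae_restrict_mem h.measurableSet),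
    Measure.quasiMeasurePreserving_snd.ae (ae_mem_closedBall_unitBallMeasure n)] with z h1 h2
  exact ⟨h1, by simpa using h2⟩

theorem center_eq_of_lt (h : CellMap P c ρ) {x : Euc d} {r : ℝ} {z z' : Euc d × Euc n}
    (hz : z.1 ∈ P) (hz' : z'.1 ∈ P) (hu : ‖z.2‖ ≤ 1) (hu' : ‖z'.2‖ ≤ 1)
    (hx : ‖discMap c ρ L z - x‖ ≤ r) (hx' : ‖discMap c ρ L z' - x‖ ≤ r) (hr : r < ρ z.1)
    (hr' : r < ρ z'.1) : c z'.1 = c z.1 := by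
  by_contra hne
  have h1 := h.le_norm_sub _ hz' _ hz hne
  have h2 := h.norm_discMap_sub_le (L := L) hu
  have h3 := h.norm_discMap_sub_le (L := L) hu'
  have h4 : ‖c z'.1 - c z.1‖ ≤ ρ z'.1 + r + (r + ρ z.1) := by
    calc ‖c z'.1 - c z.1‖ = ‖((discMap c ρ L z' - x) - (discMap c ρ L z' - c z'.1)) -
          ((discMap c ρ L z - x) - (discMap c ρ L z - c z.1))‖ := by congr 1; abel
      _ ≤ ‖(discMap c ρ L z' - x) - (discMap c ρ L z' - c z'.1)‖ +
          ‖(discMap c ρ L z - x) - (discMap c ρ L z - c z.1)‖ := _root_.norm_sub_le _ _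
      _ ≤ (‖discMap c ρ L z' - x‖ + ‖discMap c ρ L z' - c z'.1‖) +
          (‖discMap c ρ L z - x‖ + ‖discMap c ρ L z - c z.1‖) := by
          gcongr <;> exact _root_.norm_sub_le _ _
      _ ≤ _ := by linarith
  linarith

theorem growthDeg_discMeasure [IsFiniteMeasure μ] (h : CellMap P c ρ) {C : ℝ} (hC0 : 0 ≤ C)
    (hμ : GrowthDeg n μ C) : GrowthDeg n (discMeasure P c ρ L μ) (C * (3 ^ n + 2 ^ n)) := by
  intro x r hr
  have hp := h.measurable_discMap (L := L)
  set m := (μ.restrict P).prod (unitBallMeasure n) with hm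
  have hae : ∀ᵐ z ∂m, z.1 ∈ P ∧ ‖z.2‖ ≤ 1 := h.ae_mem_prod
  have hsmall : m {z | (z.1 ∈ P ∧ ‖z.2‖ ≤ 1) ∧ ‖discMap c ρ L z - x‖ ≤ r ∧ ρ z.1 ≤ r} ≤
      ENNReal.ofReal (C * (3 * r) ^ n) := by
    calc _ ≤ m (closedBall x (3 * r) ×ˢ univ) := by
          refine measure_mono fun z hz => ?_
          obtain ⟨⟨hz1, hz2⟩, hz3, hz4⟩ := hz
          have e1 := h.norm_discMap_sub_le (L := L) hz2
          have e2 := h.norm_sub_le _ hz1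
          refine mem_prod.2 ⟨?_, mem_univ _⟩
          rw [mem_closedBall, dist_eq_norm]
          calc ‖z.1 - x‖ = ‖(z.1 - c z.1) - (discMap c ρ L z - c z.1) + (discMap c ρ L z - x)‖ := by
                congr 1; abel
            _ ≤ ‖(z.1 - c z.1) - (discMap c ρ L z - c z.1)‖ + ‖discMap c ρ L z - x‖ :=
                norm_add_le _ _
            _ ≤ ‖z.1 - c z.1‖ + ‖discMap c ρ L z - c z.1‖ + ‖discMap c ρ L z - x‖ := by
                gcongr; exact _root_.norm_sub_le _ _
            _ ≤ _ := by linarith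
      _ ≤ μ (closedBall x (3 * r)) := by
          rw [hm, Measure.prod_prod, measure_univ, mul_one]
          exact Measure.restrict_apply_le _ _
      _ ≤ _ := hμ _ _ (by linarith)
  have hlarge : m {z | (z.1 ∈ P ∧ ‖z.2‖ ≤ 1) ∧ ‖discMap c ρ L z - x‖ ≤ r ∧ r < ρ z.1} ≤
      ENNReal.ofReal (C * (2 * r) ^ n) := by
    rcases eq_empty_or_nonempty
      {z | (z.1 ∈ P ∧ ‖z.2‖ ≤ 1) ∧ ‖discMap c ρ L z - x‖ ≤ r ∧ r < ρ z.1} with h0 | ⟨z₀, hz₀⟩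
    · rw [h0]; simp
    obtain ⟨⟨a1, a2⟩, a3, a4⟩ := hz₀
    have hs : 0 < ρ z₀.1 := hr.trans a4
    calc _ ≤ m ((P ∩ {y | c y = c z₀.1}) ×ˢ closedBall z₀.2 (2 * r / ρ z₀.1)) := by
          refine measure_mono fun z hz => ?_
          obtain ⟨⟨b1, b2⟩, b3, b4⟩ := hz
          have hc : c z.1 = c z₀.1 := h.center_eq_of_lt a1 b1 a2 b2 a3 b3 a4 b4
          refine mem_prod.2 ⟨⟨b1, hc⟩, ?_⟩
          rw [mem_closedBall, dist_eq_norm, le_div_iff₀ hs, mul_comm]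
          have e1 : discMap c ρ L z - discMap c ρ L z₀ = ρ z₀.1 • L (z.2 - z₀.2) := by
            simp only [discMap, hc, h.radius_eq _ b1 _ a1 hc, add_sub_add_left_eq_sub, map_sub,
              smul_sub]
          calc ρ z₀.1 * ‖z.2 - z₀.2‖ = ‖discMap c ρ L z - discMap c ρ L z₀‖ := by
                rw [e1, norm_smul, L.norm_map, Real.norm_of_nonneg hs.le]
            _ = ‖(discMap c ρ L z - x) - (discMap c ρ L z₀ - x)‖ := by congr 1; abel
            _ ≤ ‖discMap c ρ L z - x‖ + ‖discMap c ρ L z₀ - x‖ := _root_.norm_sub_le _ _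
            _ ≤ 2 * r := by linarith
      _ ≤ ENNReal.ofReal (C * ρ z₀.1 ^ n) * ENNReal.ofReal ((2 * r / ρ z₀.1) ^ n) := by
          rw [hm, Measure.prod_prod]
          gcongr
          · exact (Measure.restrict_apply_le _ _).trans (h.measure_cell_le hμ a1 hs)
          · exact unitBallMeasure_closedBall_le _ (by positivity)
      _ = _ := by
          rw [← ENNReal.ofReal_mul (by positivity), div_pow]
          congr 1
          field_simp
  calc discMeasure P c ρ L μ (closedBall x r)
      = m (discMap c ρ L ⁻¹' closedBall x r) := by
        rw [discMeasure, Measure.map_apply hp measurableSet_closedBall]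
    _ ≤ m ({z | (z.1 ∈ P ∧ ‖z.2‖ ≤ 1) ∧ ‖discMap c ρ L z - x‖ ≤ r ∧ ρ z.1 ≤ r} ∪
          {z | (z.1 ∈ P ∧ ‖z.2‖ ≤ 1) ∧ ‖discMap c ρ L z - x‖ ≤ r ∧ r < ρ z.1}) := by
        refine measure_mono_ae ?_
        filter_upwards [hae] with z hz hzx
        have hzx' : ‖discMap c ρ L z - x‖ ≤ r := by
          rw [← dist_eq_norm]; exact hzx
        rcases le_or_gt (ρ z.1) r with h1 | h1
        · exact Or.inl ⟨hz, hzx', h1⟩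
        · exact Or.inr ⟨hz, hzx', h1⟩
    _ ≤ ENNReal.ofReal (C * (3 * r) ^ n) + ENNReal.ofReal (C * (2 * r) ^ n) :=
        (measure_union_le _ _).trans (add_le_add hsmall hlarge)
    _ = _ := by
        rw [← ENNReal.ofReal_add (by positivity) (by positivity), mul_pow, mul_pow]
        congr 1; ring

/-- Lower regularity of the disc measure at points of the discs. -/
theorem le_discMeasure_closedBall (h : CellMap P c ρ) {E : Set (Euc d)} {a b R : ℝ}
    (hA : ∀ y ∈ P, 0 < ρ y → ENNReal.ofReal (a * ρ y ^ n) ≤ μ (P ∩ {y' | c y' = c y}))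
    (hB : ∀ e ∈ E, ∀ r, 0 < r → r ≤ R →
      ENNReal.ofReal (b * r ^ n) ≤ discMeasure P c ρ L μ (closedBall e (2 * r)))
    (hE : ∀ y ∈ P, ∃ e ∈ E, ‖c y - e‖ ≤ 40 * ρ y) (ha : 0 ≤ a) {z : Euc d × Euc n}
    (hz : z.1 ∈ P) (hu : ‖z.2‖ ≤ 1) {r : ℝ} (hr : 0 < r) (hrR : r ≤ R) :
    ENNReal.ofReal (min (a / 100 ^ n) (b / 4 ^ n) * r ^ n) ≤
      discMeasure P c ρ L μ (closedBall (discMap c ρ L z) r) := by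
  rcases le_or_gt r (100 * ρ z.1) with hle | hlt
  · have hs : 0 < ρ z.1 := by linarith
    have h1 : (P ∩ {y | c y = c z.1}) ×ˢ closedBall z.2 (r / ρ z.1) ⊆
        discMap c ρ L ⁻¹' closedBall (discMap c ρ L z) r := by
      rintro z' ⟨⟨h1, h2⟩, h3⟩
      have hc : c z'.1 = c z.1 := h2
      rw [mem_preimage, mem_closedBall, dist_eq_norm]
      rw [mem_closedBall, dist_eq_norm, le_div_iff₀ hs, mul_comm] at h3
      have e1 : discMap c ρ L z' - discMap c ρ L z = ρ z.1 • L (z'.2 - z.2) := by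
        simp only [discMap, hc, h.radius_eq _ h1 _ hz hc, add_sub_add_left_eq_sub, map_sub,
          smul_sub]
      rwa [e1, norm_smul, L.norm_map, Real.norm_of_nonneg hs.le]
    rw [discMeasure, Measure.map_apply h.measurable_discMap measurableSet_closedBall]
    refine le_trans ?_ (measure_mono h1)
    have hQ : MeasurableSet (P ∩ {y | c y = c z.1}) :=
      h.measurableSet.inter (h.measurable_center (measurableSet_singleton _))
    rw [Measure.prod_prod, Measure.restrict_apply hQ, inter_eq_self_of_subset_left
      inter_subset_left]
    calc _ ≤ ENNReal.ofReal (a / 100 ^ n * r ^ n) := by gcongr; exact min_le_left _ _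
      _ = ENNReal.ofReal (a * ρ z.1 ^ n) * ENNReal.ofReal ((r / ρ z.1 / 100) ^ n) := by
          rw [← ENNReal.ofReal_mul (by positivity)]
          congr 1
          rw [div_pow, div_pow]
          field_simp
      _ ≤ _ := by
          gcongr
          · exact hA _ hz hs
          · refine le_unitBallMeasure_closedBall' hu (by positivity) (by norm_num) ?_
            rwa [div_le_iff₀ hs]
  · obtain ⟨e, he, hec⟩ := hE _ hz
    have h1 := h.norm_discMap_sub_le (L := L) hu
    calc _ ≤ ENNReal.ofReal (b * (r / 4) ^ n) := by
          refine ENNReal.ofReal_le_ofReal ?_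
          calc _ ≤ b / 4 ^ n * r ^ n := by gcongr; exact min_le_right _ _
            _ = _ := by rw [div_pow]; ring
      _ ≤ discMeasure P c ρ L μ (closedBall e (2 * (r / 4))) :=
          hB e he _ (by linarith) (by linarith)
      _ ≤ _ := by
          refine measure_mono (closedBall_subset_closedBall' ?_)
          rw [dist_comm, dist_eq_norm]
          have : ‖discMap c ρ L z - e‖ ≤ ρ z.1 + 40 * ρ z.1 := by
            calc _ = ‖(discMap c ρ L z - c z.1) + (c z.1 - e)‖ := by congr 1; abel
              _ ≤ _ := norm_add_le _ _
              _ ≤ _ := by gcongr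
          linarith

/-- The disc measure is Ahlfors–David regular. -/
theorem aDRegular_discMeasure (h : CellMap P c ρ) {b C R : ℝ} (hb : 0 < b)
    (hup : GrowthDeg n (discMeasure P c ρ L μ) C)
    (hlow : ∀ z : Euc d × Euc n, z.1 ∈ P → ‖z.2‖ ≤ 1 → ∀ r, 0 < r → r ≤ R →
      ENNReal.ofReal (b * r ^ n) ≤ discMeasure P c ρ L μ (closedBall (discMap c ρ L z) r))
    (hR : 0 ≤ R)
    (hbd : ∀ z : Euc d × Euc n, z.1 ∈ P → ‖z.2‖ ≤ 1 → ‖discMap c ρ L z‖ ≤ R / 2) :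
    ADRegular n (discMeasure P c ρ L μ) := by
  have hp := h.measurable_discMap (L := L)
  have hae : ∀ᵐ z ∂((μ.restrict P).prod (unitBallMeasure n)), z.1 ∈ P ∧ ‖z.2‖ ≤ 1 := h.ae_mem_prod
  have hex : ∀ x ∈ measureSupport (discMeasure P c ρ L μ), ∀ r, 0 < r →
      ∃ z : Euc d × Euc n, z.1 ∈ P ∧ ‖z.2‖ ≤ 1 ∧ discMap c ρ L z ∈ ball x r := by
    intro x hx r hr
    by_contra! hcon
    have h1 : discMeasure P c ρ L μ (ball x r) = 0 := by
      rw [discMeasure, Measure.map_apply hp measurableSet_ball]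
      refine measure_mono_null (t := {z | ¬ (z.1 ∈ P ∧ ‖z.2‖ ≤ 1)}) (fun z hz hz' => ?_) hae
      exact hcon z hz'.1 hz'.2 hz
    exact (hx r hr).ne' h1
  have hsupp : measureSupport (discMeasure P c ρ L μ) ⊆ closedBall 0 (R / 2) := by
    intro x hx
    rw [mem_closedBall, dist_zero_right]
    refine le_of_forall_pos_le_add fun r hr => ?_
    obtain ⟨z, h1, h2, h3⟩ := hex x hx r hr
    rw [mem_ball, dist_comm, dist_eq_norm] at h3
    have := hbd z h1 h2
    have := norm_sub_norm_le x (discMap c ρ L z)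
    linarith
  set b' := b / 2 ^ n with hb'
  have hb'pos : 0 < b' := by positivity
  refine ⟨max (max C b'⁻¹) 1, le_max_right _ _, fun x hx r hr hdiam => ⟨?_, ?_⟩⟩
  · have hrR : r ≤ R := by
      have h1 : ENNReal.ofReal r ≤ ENNReal.ofReal R := by
        refine hdiam.trans ((ediam_mono hsupp).trans ?_)
        refine ediam_le_of_forall_dist_le fun y hy y' hy' => ?_
        rw [mem_closedBall, dist_zero_right] at hy hy'
        have := dist_le_norm_add_norm y y'
        linarith
      exact (ENNReal.ofReal_le_ofReal_iff hR).1 h1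
    obtain ⟨z, h1, h2, h3⟩ := hex x hx (r / 2) (by linarith)
    calc _ ≤ ENNReal.ofReal (b * (r / 2) ^ n) := by
          refine ENNReal.ofReal_le_ofReal ?_
          calc _ ≤ b' * r ^ n := by
                gcongr
                rw [inv_le_comm₀ (by positivity) hb'pos]
                exact (le_max_right _ _).trans (le_max_left _ _)
            _ = _ := by rw [hb', div_pow]; ring
      _ ≤ discMeasure P c ρ L μ (closedBall (discMap c ρ L z) (r / 2)) :=
          hlow z h1 h2 _ (by linarith) (by linarith)
      _ ≤ _ := by
          refine measure_mono (closedBall_subset_closedBall' ?_)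
          have := mem_ball.1 h3
          linarith
  · refine (hup x r hr).trans ?_
    gcongr
    exact (le_max_left _ _).trans (le_max_left _ _)

end CellMap

/-- Whitney-type decomposition of `F` relative to a closed subset `E`: there are separated balls
centred on `F \ E`, with radii comparable to the distance to `E`, whose enlargements cover
`F \ E`. -/
theorem exists_cellMap {d : ℕ} {E F : Set (Euc d)} {R₀ : ℝ} (hE : IsClosed E)
    (hne : E.Nonempty) (hEF : E ⊆ F) (hF : F ⊆ closedBall 0 R₀) :
    ∃ (U : Set (Euc d)) (c : Euc d → Euc d), U ⊆ F \ E ∧ U.Countable ∧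
      (U.PairwiseDisjoint fun x => closedBall x (infDist x E / 40)) ∧
      (∀ x ∈ F \ E, ∃ y ∈ U, x ∈ closedBall y (10 * (infDist y E / 40))) ∧
      (∀ y ∈ E, c y = y) ∧ (∀ x ∈ U, ∀ y ∈ closedBall x (infDist x E / 40), c y = x) ∧
      CellMap (E ∪ ⋃ x ∈ U, closedBall x (infDist x E / 40)) c (fun y => infDist (c y) E / 40) := by
  classical
  have hs0 : ∀ x : Euc d, 0 ≤ infDist x E / 40 := fun x => by
    have := infDist_nonneg (x := x) (s := E); positivity
  have hspos : ∀ x ∉ E, 0 < infDist x E / 40 := fun x hx => by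
    have := (hE.notMem_iff_infDist_pos hne).1 hx; positivity
  obtain ⟨e₀, he₀⟩ := hne
  obtain ⟨U, hUF, hdisj, hcov⟩ := Vitali.exists_disjoint_subfamily_covering_enlargement_closedBall
    (F \ E) id (fun x => 2 * (infDist x E / 40)) (2 * (2 * R₀ / 40)) (fun x hx => by
      have h1 := infDist_le_dist_of_mem (x := x) he₀
      have h2 := hF hx.1
      have h3 := hF (hEF he₀)
      rw [mem_closedBall, dist_zero_right] at h2 h3
      have := dist_le_norm_add_norm x e₀
      linarith) 5 (by norm_num)
  simp only [id] at hdisj hcov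
  set s : Euc d → ℝ := fun x => infDist x E / 40 with hs
  have hdisj' : U.PairwiseDisjoint fun x => closedBall x (s x) := by
    refine hdisj.mono_on fun x _ => closedBall_subset_closedBall ?_
    have := hs0 x
    simp only [hs]; linarith
  have hUc : U.Countable := by
    refine hdisj'.countable_of_nonempty_interior fun x hx => ⟨x, ball_subset_interior_closedBall ?_⟩
    exact mem_ball_self (hspos x (hUF hx).2)
  set T : Set (Euc d) := ⋃ x ∈ U, closedBall x (s x) with hT
  have hTm : MeasurableSet T := MeasurableSet.biUnion hUc fun _ _ => measurableSet_closedBall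
  have hdist : ∀ x ∈ U, ∀ y ∈ E, 40 * s x ≤ ‖x - y‖ := fun x _ y hy => by
    rw [← dist_eq_norm]
    have := infDist_le_dist_of_mem (x := x) hy
    simp only [hs]; linarith
  have hex : ∀ y, ∃ z, (y ∈ T → z ∈ U ∧ y ∈ closedBall z (s z)) ∧ (y ∉ T → z = y) := by
    intro y
    by_cases hy : y ∈ T
    · obtain ⟨z, hz, hyz⟩ := mem_iUnion₂.1 hy
      exact ⟨z, fun _ => ⟨hz, hyz⟩, fun h => absurd hy h⟩
    · exact ⟨y, fun h => absurd h hy, fun _ => rfl⟩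
  choose c hc1 hc2 using hex
  have hET : ∀ y ∈ E, y ∉ T := by
    intro y hy hyT
    obtain ⟨z, hz, hyz⟩ := mem_iUnion₂.1 hyT
    have h1 := hdist z hz y hy
    rw [mem_closedBall, dist_comm, dist_eq_norm] at hyz
    have := hspos z (hUF hz).2
    simp only [hs] at *
    linarith
  have hcE : ∀ y ∈ E, c y = y := fun y hy => hc2 y (hET y hy)
  have hsE : ∀ y ∈ E, s y = 0 := fun y hy => by simp [hs, infDist_zero_of_mem hy]
  have hcU : ∀ x ∈ U, ∀ y ∈ closedBall x (s x), c y = x := by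
    intro x hx y hy
    have hyT : y ∈ T := mem_iUnion₂.2 ⟨x, hx, hy⟩
    exact hdisj'.elim_set (hc1 y hyT).1 hx y (hc1 y hyT).2 hy
  have hcm : Measurable c := by
    intro A hA
    have : c ⁻¹' A = (A ∩ Tᶜ) ∪ ⋃ x ∈ U ∩ A, closedBall x (s x) := by
      ext y
      by_cases hy : y ∈ T
      · simp only [mem_preimage, mem_union, mem_inter_iff, mem_compl_iff, hy, not_true, and_false,
          false_or, mem_iUnion₂]
        constructor
        · intro h
          exact ⟨c y, ⟨(hc1 y hy).1, h⟩, (hc1 y hy).2⟩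
        · rintro ⟨x, ⟨hx, hxA⟩, hxy⟩
          rwa [hcU x hx y hxy]
      · simp only [mem_preimage, mem_union, mem_inter_iff, mem_compl_iff, hy, not_false_iff,
          and_true, hc2 y hy, mem_iUnion₂]
        constructor
        · exact Or.inl
        · rintro (h | ⟨x, ⟨hx, -⟩, hxy⟩)
          · exact h
          · exact absurd (mem_iUnion₂.2 ⟨x, hx, hxy⟩) hy
    rw [this]
    exact (hA.inter hTm.compl).union
      (MeasurableSet.biUnion (hUc.mono inter_subset_left) fun _ _ => measurableSet_closedBall)
  have hsep : ∀ y ∈ T, ∀ y' ∈ E, 2 * (s (c y) + s (c y')) ≤ ‖c y - c y'‖ := by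
    intro y hy y' hy'
    have h1 := hdist _ (hc1 y hy).1 y' hy'
    have h2 : 0 ≤ s (c y) := hs0 _
    rw [hcE y' hy', hsE y' hy']
    linarith
  refine ⟨U, c, hUF, hUc, hdisj', fun x hx => ?_, hcE, hcU,
    { measurableSet := hE.measurableSet.union hTm
      measurable_center := hcm
      measurable_radius := by
        have := (continuous_infDist_pt E).measurable
        fun_prop
      nonneg := fun y => hs0 _
      norm_sub_le := ?_
      le_norm_sub := ?_
      radius_eq := fun y _ y' _ h => by rw [h]
      countable := ?_ }⟩
  · obtain ⟨y, hy, hxy⟩ := hcov x hx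
    refine ⟨y, hy, ?_⟩
    have h1 : x ∈ closedBall x (2 * (infDist x E / 40)) := mem_closedBall_self (by
      have := hs0 x; positivity)
    have := hxy h1
    rwa [← mul_assoc, show (5 : ℝ) * 2 = 10 by norm_num] at this
  · rintro y (hy | hy)
    · simp only [hcE y hy, sub_self, norm_zero]; exact hs0 _
    · rw [← dist_eq_norm]; exact (hc1 y hy).2
  · rintro y (hy | hy) y' (hy' | hy') hne
    · rw [hcE y hy, hcE y' hy']
      have h1 := hsE y hy
      have h2 := hsE y' hy'
      simp only [hs] at h1 h2
      rw [h1, h2]; simp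
    · rw [norm_sub_rev, add_comm]; exact hsep y' hy' y hy
    · exact hsep y hy y' hy'
    · have h1 := hdisj (hc1 y hy).1 (hc1 y' hy').1 hne
      have h2 := (disjoint_closedBall_closedBall_iff (by have := hs0 (c y); positivity)
        (by have := hs0 (c y'); positivity)).1 h1
      rw [dist_eq_norm] at h2
      linarith
  · refine hUc.mono ?_
    rintro _ ⟨y, ⟨hy | hy, hy'⟩, rfl⟩
    · have h0 : (0 : ℝ) < s (c y) := hy'
      rw [hcE y hy, hsE y hy] at h0
      exact absurd h0 (lt_irrefl _)
    · exact (hc1 y hy).1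

open CellMap in
/-- If `F` has lower regularity for `μ`, and `E ⊆ F` has lower regularity for `μ` restricted to
`F`, then `μ` restricted to `E` is dominated by an Ahlfors–David regular measure with bounded
Riesz transform. -/
theorem exists_aDRegular_ge {d n : ℕ} {μ : Measure (Euc d)} [IsFiniteMeasure μ] {C : ℝ}
    (hC0 : 0 ≤ C) (hμ : GrowthDeg n μ C) (hR : SmoothRieszBounded n μ) (L : Euc n →ₗᵢ[ℝ] Euc d)
    {E F : Set (Euc d)} {R₀ a : ℝ} (ha : 0 < a) (hR₀ : 0 ≤ R₀) (hF : F ⊆ closedBall 0 R₀)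
    (hE : IsClosed E) (hne : E.Nonempty) (hEF : E ⊆ F)
    (hFa : ∀ x ∈ F, ∀ r, 0 < r → r ≤ 4 * R₀ → ENNReal.ofReal (a * r ^ n) ≤ μ (closedBall x r))
    (hEa : ∀ x ∈ E, ∀ r, 0 < r → r ≤ 4 * R₀ →
      ENNReal.ofReal (a * r ^ n) ≤ μ (F ∩ closedBall x r)) :
    ∃ σ : Measure (Euc d), IsFiniteMeasure σ ∧ μ.restrict E ≤ σ ∧ ADRegular n σ ∧
      RieszBounded n σ := by
  obtain ⟨U, c, hUF, hUc, hdisj, hcov, hcE, hcU, h⟩ := exists_cellMap hE hne hEF hF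
  set s : Euc d → ℝ := fun x => infDist x E / 40 with hs
  have hs0 : ∀ x, 0 ≤ s x := fun x => by
    have := infDist_nonneg (x := x) (s := E); simp only [hs]; positivity
  have hspos : ∀ x ∈ U, 0 < s x := fun x hx => by
    have := (hE.notMem_iff_infDist_pos hne).1 (hUF hx).2; simp only [hs]; positivity
  have hsF : ∀ x ∈ F, 20 * s x ≤ R₀ := fun x hx => by
    obtain ⟨e, he⟩ := hne
    have h1 := infDist_le_dist_of_mem (x := x) he
    have h2 := hF hx
    have h3 := hF (hEF he)
    rw [mem_closedBall, dist_zero_right] at h2 h3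
    have := dist_le_norm_add_norm x e
    simp only [hs]
    linarith
  have hdist : ∀ x : Euc d, ∀ y ∈ E, 40 * s x ≤ dist x y := fun x y hy => by
    have := infDist_le_dist_of_mem (x := x) hy
    simp only [hs]; linarith
  have hsE : ∀ y ∈ E, s (c y) = 0 := fun y hy => by
    simp [hs, hcE y hy, infDist_zero_of_mem hy]
  set ρ : Euc d → ℝ := fun y => s (c y) with hρ
  set T : Set (Euc d) := ⋃ x ∈ U, closedBall x (s x) with hT
  set P : Set (Euc d) := E ∪ T with hP
  have hcF : ∀ y ∈ P, c y ∈ F := by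
    rintro y (hy | hy)
    · rw [hcE y hy]; exact hEF hy
    · obtain ⟨x, hx, hxy⟩ := mem_iUnion₂.1 hy
      rw [hcU x hx y hxy]; exact (hUF hx).1
  have hp := h.measurable_discMap (L := L)
  have hpE : ∀ z : Euc d × Euc n, z.1 ∈ E → discMap c ρ L z = z.1 := fun z hz => by
    simp only [discMap, hρ, hsE _ hz, hcE _ hz, zero_smul, add_zero]
  have hWσ : ∀ W B : Set (Euc d), W ⊆ P → MeasurableSet B →
      (∀ z : Euc d × Euc n, z.1 ∈ W → ‖z.2‖ ≤ 1 → discMap c ρ L z ∈ B) →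
      μ W ≤ discMeasure P c ρ L μ B := by
    intro W B hWP hB hz
    rw [discMeasure, Measure.map_apply hp hB]
    calc μ W = ((μ.restrict P).prod (unitBallMeasure n)) (W ×ˢ univ) := by
          rw [Measure.prod_prod, measure_univ, mul_one, Measure.restrict_eq_self _ hWP]
      _ ≤ _ := by
          refine measure_mono_ae ?_
          filter_upwards [h.ae_mem_prod (μ := μ) (n := n)] with z hzz hzW
          exact hz z hzW.1 hzz.2
  set K : ℝ := C * 10 ^ n / a with hK
  have hK0 : 0 ≤ K := by positivity
  set b : ℝ := a / (1 + K) with hb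
  have hbpos : 0 < b := by positivity
  have hball : ∀ x ∈ U,
      μ (closedBall x (10 * s x)) ≤ ENNReal.ofReal K * μ (closedBall x (s x)) := by
    intro x hx
    have h1 := hspos x hx
    calc _ ≤ ENNReal.ofReal (C * (10 * s x) ^ n) := hμ _ _ (by positivity)
      _ = ENNReal.ofReal K * ENNReal.ofReal (a * s x ^ n) := by
          rw [← ENNReal.ofReal_mul hK0, hK, mul_pow]
          congr 1
          field_simp
      _ ≤ _ := by
          gcongr
          have := hsF x (hUF hx).1
          exact hFa x (hUF hx).1 _ h1 (by linarith)
  have hB : ∀ e ∈ E, ∀ r, 0 < r → r ≤ 4 * R₀ →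
      ENNReal.ofReal (b * r ^ n) ≤ discMeasure P c ρ L μ (closedBall e (2 * r)) := by
    intro e he r hr hrR
    set V : Set (Euc d) := {x ∈ U | (closedBall x (10 * s x) ∩ closedBall e r).Nonempty} with hV
    have hVU : V ⊆ U := fun x hx => hx.1
    have hVr : ∀ x ∈ V, 30 * s x ≤ r ∧ dist x e ≤ 10 * s x + r := by
      rintro x ⟨_, w, hw1, hw2⟩
      have h1 := hdist x e he
      rw [mem_closedBall, dist_comm] at hw1
      rw [mem_closedBall] at hw2
      have := dist_triangle x w e
      exact ⟨by linarith, by linarith⟩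
    set W : Set (Euc d) := (E ∩ closedBall e r) ∪ ⋃ x ∈ V, closedBall x (s x) with hW
    have h1 : μ W ≤ discMeasure P c ρ L μ (closedBall e (2 * r)) := by
      refine hWσ _ _ ?_ measurableSet_closedBall fun z hz hu => ?_
      · exact union_subset_union inter_subset_left (biUnion_subset_biUnion_left hVU)
      · rcases hz with hz | hz
        · rw [hpE z hz.1]
          exact closedBall_subset_closedBall (by linarith) hz.2
        · obtain ⟨x, hx, hxz⟩ := mem_iUnion₂.1 hz
          obtain ⟨h2, h3⟩ := hVr x hx
          have h4 := h.norm_discMap_sub_le (L := L) hu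
          have h5 := hcU x (hVU hx) _ hxz
          simp only [hρ, h5] at h4
          rw [← dist_eq_norm] at h4
          have := dist_triangle (discMap c ρ L z) x e
          have := hs0 x
          rw [mem_closedBall]
          linarith
    have h2 : F ∩ closedBall e r ⊆ (E ∩ closedBall e r) ∪ ⋃ x ∈ V, closedBall x (10 * s x) := by
      rintro x ⟨hxF, hxB⟩
      by_cases hxE : x ∈ E
      · exact Or.inl ⟨hxE, hxB⟩
      · obtain ⟨y, hy, hxy⟩ := hcov x ⟨hxF, hxE⟩
        exact Or.inr (mem_iUnion₂.2 ⟨y, ⟨hy, x, hxy, hxB⟩, hxy⟩)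
    have h3 : μ (⋃ x ∈ V, closedBall x (10 * s x)) ≤ ENNReal.ofReal K * μ W := by
      calc _ ≤ ∑' x : V, μ (closedBall (x : Euc d) (10 * s x)) :=
            measure_biUnion_le μ (hUc.mono hVU) _
        _ ≤ ∑' x : V, ENNReal.ofReal K * μ (closedBall (x : Euc d) (s x)) :=
            ENNReal.tsum_le_tsum fun x => hball _ (hVU x.2)
        _ = ENNReal.ofReal K * μ (⋃ x ∈ V, closedBall x (s x)) := by
            rw [ENNReal.tsum_mul_left, measure_biUnion (hUc.mono hVU) (hdisj.subset hVU)
              fun _ _ => measurableSet_closedBall]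
        _ ≤ _ := by gcongr; exact subset_union_right
    have h4 : ENNReal.ofReal (a * r ^ n) ≤ ENNReal.ofReal (1 + K) * μ W := by
      calc _ ≤ μ (F ∩ closedBall e r) := hEa e he r hr hrR
        _ ≤ μ (E ∩ closedBall e r) + μ (⋃ x ∈ V, closedBall x (10 * s x)) :=
            (measure_mono h2).trans (measure_union_le _ _)
        _ ≤ μ W + ENNReal.ofReal K * μ W :=
            add_le_add (measure_mono subset_union_left) h3
        _ = _ := by rw [ENNReal.ofReal_add (by norm_num) hK0, ENNReal.ofReal_one, add_mul, one_mul]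
    calc ENNReal.ofReal (b * r ^ n) = ENNReal.ofReal (1 + K)⁻¹ * ENNReal.ofReal (a * r ^ n) := by
          rw [← ENNReal.ofReal_mul (by positivity), hb]
          congr 1
          ring
      _ ≤ ENNReal.ofReal (1 + K)⁻¹ * (ENNReal.ofReal (1 + K) * μ W) := by gcongr
      _ = μ W := by
          rw [← mul_assoc, ← ENNReal.ofReal_mul (by positivity), inv_mul_cancel₀ (by positivity),
            ENNReal.ofReal_one, one_mul]
      _ ≤ _ := h1
  have hup := h.growthDeg_discMeasure (L := L) hC0 hμ
  refine ⟨discMeasure P c ρ L μ, inferInstance, ?_, ?_, ?_⟩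
  · refine Measure.le_iff.2 fun A hA => ?_
    rw [Measure.restrict_apply hA]
    refine hWσ _ _ (inter_subset_right.trans subset_union_left) hA fun z hz _ => ?_
    rw [hpE z hz.2]
    exact hz.1
  · refine h.aDRegular_discMeasure (R := 4 * R₀) (b := min (a / 100 ^ n) (b / 4 ^ n))
      (by positivity) hup (fun z hz hu r hr hrR => ?_) (by linarith) fun z hz hu => ?_
    · refine h.le_discMeasure_closedBall (E := E) (fun y hy hy0 => ?_) hB (fun y hy => ?_)
        ha.le hz hu
        hr hrR
      · rcases hy with hyE | hyT
        · simp only [hρ, hsE y hyE, lt_irrefl] at hy0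
        · obtain ⟨x, hx, hxy⟩ := mem_iUnion₂.1 hyT
          have h5 := hcU x hx y hxy
          have h6 := hsF x (hUF hx).1
          have h7 := hspos x hx
          simp only [hρ, h5]
          refine (hFa x (hUF hx).1 _ h7 (by linarith)).trans (measure_mono fun w hw => ?_)
          exact ⟨Or.inr (mem_iUnion₂.2 ⟨x, hx, hw⟩), hcU x hx w hw⟩
      · obtain ⟨e, he, hee⟩ := hE.exists_infDist_eq_dist hne (c y)
        refine ⟨e, he, ?_⟩
        rw [← dist_eq_norm, ← hee]
        simp only [hρ, hs]
        linarith
    · have h1 := h.norm_discMap_sub_le (L := L) hu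
      have h2 := hcF _ hz
      have h3 := hsF _ h2
      have h4 := hF h2
      rw [mem_closedBall, dist_zero_right] at h4
      have h5 := norm_sub_norm_le (discMap c ρ L z) (c z.1)
      simp only [hρ] at h1 h5 ⊢
      linarith
  · exact (h.smoothRieszBounded_discMeasure hC0 hμ hR).riesz (by positivity) hup

theorem GrowthDeg.eq_zero_of_lt {d n : ℕ} {μ : Measure (Euc d)} {C : ℝ} (hμ : GrowthDeg n μ C)
    (hdn : d < n) : μ = 0 := by
  set D : ℝ≥0∞ := ENNReal.ofReal (max C 1) with hD
  have hD0 : D ≠ 0 := by simp [hD]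
  have hDt : D ≠ ⊤ := ENNReal.ofReal_ne_top
  have hball : ∀ (x : Euc d) (r : ℝ), 0 < r → μ (closedBall x r) ≤ D * ENNReal.ofReal (r ^ n) := by
    intro x r hr
    rw [hD, ← ENNReal.ofReal_mul (by positivity)]
    refine (hμ x r hr).trans (ENNReal.ofReal_le_ofReal ?_)
    gcongr
    exact le_max_left _ _
  have h1 : D⁻¹ • μ ≤ μH[(n : ℝ)] := by
    refine Measure.le_hausdorffMeasure _ _ 1 one_pos fun s hs => ?_
    rw [Measure.smul_apply, smul_eq_mul, ENNReal.rpow_natCast]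
    rcases s.eq_empty_or_nonempty with rfl | ⟨x, hx⟩
    · simp
    have hst : ediam s ≠ ⊤ := ne_top_of_le_ne_top ENNReal.one_ne_top hs
    have hle : ∀ δ : ℝ, 0 < δ → D⁻¹ * μ s ≤ ENNReal.ofReal (((ediam s).toReal + δ) ^ n) := by
      intro δ hδ
      have hss : s ⊆ closedBall x ((ediam s).toReal + δ) := by
        intro y hy
        have := dist_le_diam_of_mem' hst hy hx
        rw [mem_closedBall]
        exact this.trans (by simp only [Metric.diam]; linarith)
      calc _ ≤ D⁻¹ * (D * ENNReal.ofReal (((ediam s).toReal + δ) ^ n)) := by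
            gcongr
            exact (measure_mono hss).trans (hball _ _ (by positivity))
        _ = _ := by rw [← mul_assoc, ENNReal.inv_mul_cancel hD0 hDt, one_mul]
    have hlim : Tendsto (fun δ : ℝ => ENNReal.ofReal (((ediam s).toReal + δ) ^ n)) (𝓝[>] 0)
        (𝓝 (ENNReal.ofReal (((ediam s).toReal + 0) ^ n))) := by
      refine Tendsto.mono_left ?_ nhdsWithin_le_nhds
      exact (ENNReal.continuous_ofReal.comp (by fun_prop)).tendsto 0
    have h2 := ge_of_tendsto hlim (eventually_mem_nhdsWithin.mono fun δ hδ => hle δ hδ)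
    rwa [add_zero, ENNReal.ofReal_pow ENNReal.toReal_nonneg, ENNReal.ofReal_toReal hst] at h2
  have h3 : μH[(n : ℝ)] (univ : Set (Euc d)) = 0 := by
    have h4 : dimH (univ : Set (Euc d)) < ((n : ℝ≥0) : ℝ≥0∞) := by
      rw [Real.dimH_univ_eq_finrank, finrank_euclideanSpace_fin]
      exact_mod_cast hdn
    simpa using hausdorffMeasure_of_dimH_lt h4
  have h5 : D⁻¹ * μ univ = 0 := le_antisymm ((h1 univ).trans_eq h3) (zero_le)
  rw [mul_eq_zero, ENNReal.inv_eq_zero] at h5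
  exact Measure.measure_univ_eq_zero.1 (h5.resolve_left hDt)

/-- The set of points of `closedBall 0 R₀` at which `ν` has lower regularity with constant `a` up
to scale `4 * R₀`. -/
def lowerRegularSet (n : ℕ) {d : ℕ} (ν : Measure (Euc d)) (R₀ a : ℝ) : Set (Euc d) :=
  {x | x ∈ closedBall 0 R₀ ∧
    ∀ r, 0 < r → r ≤ 4 * R₀ → ENNReal.ofReal (a * r ^ n) ≤ ν (closedBall x r)}

section LowerRegular

variable {d n : ℕ} {ν : Measure (Euc d)} {R₀ a : ℝ}

theorem isClosed_lowerRegularSet [IsFiniteMeasure ν] : IsClosed (lowerRegularSet n ν R₀ a) := by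
  have : lowerRegularSet n ν R₀ a = closedBall 0 R₀ ∩ ⋂ (r : ℝ) (_ : 0 < r) (_ : r ≤ 4 * R₀),
      {x | ENNReal.ofReal (a * r ^ n) ≤ ν (closedBall x r)} := by
    ext x
    simp [lowerRegularSet]
  rw [this]
  refine isClosed_closedBall.inter (isClosed_iInter fun r => isClosed_iInter fun hr =>
    isClosed_iInter fun _ => isClosed_of_closure_subset fun x hx => ?_)
  have h1 : ∀ δ : ℝ, r < δ → ENNReal.ofReal (a * r ^ n) ≤ ν (closedBall x δ) := by
    intro δ hδ
    obtain ⟨y, hy, hyA⟩ := Metric.mem_closure_iff.1 hx (δ - r) (by linarith)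
    refine hy.trans (measure_mono (closedBall_subset_closedBall' ?_))
    rw [dist_comm]; linarith
  have h2 : Tendsto (fun δ => ν (closedBall x δ)) (𝓝[>] r) (𝓝 (ν (⋂ δ > r, closedBall x δ))) :=
    tendsto_measure_biInter_gt (fun δ _ => measurableSet_closedBall.nullMeasurableSet)
      (fun _ _ _ hij => closedBall_subset_closedBall hij) ⟨r + 1, by linarith, measure_ne_top _ _⟩
  have h3 : ⋂ δ > r, closedBall x δ = closedBall x r := by
    ext y
    simp only [mem_iInter, mem_closedBall]
    exact ⟨fun h => le_of_forall_gt_imp_ge_of_dense h, fun h δ hδ => h.trans (le_of_lt hδ)⟩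
  rw [h3] at h2
  exact ge_of_tendsto h2 (eventually_mem_nhdsWithin.mono fun δ hδ => h1 δ hδ)

theorem mem_iUnion_lowerRegularSet (hR₀ : 0 < R₀) {x : Euc d} (hx : x ∈ closedBall 0 R₀) {t : ℝ}
    (ht : 0 < t)
    (h : ∀ᶠ r in 𝓝[>] (0 : ℝ), ENNReal.ofReal (t * r ^ n) ≤ ν (closedBall x r)) :
    x ∈ ⋃ k : ℕ, lowerRegularSet n ν R₀ (1 / (k + 1)) := by
  obtain ⟨δ, hδ0, hδ⟩ := mem_nhdsGT_iff_exists_Ioc_subset.1 h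
  have hδ0' : (0 : ℝ) < δ := hδ0
  set q : ℝ := min t (t * δ ^ n / (4 * R₀) ^ n) with hq
  have hq0 : 0 < q := by positivity
  obtain ⟨k, hk⟩ := exists_nat_one_div_lt hq0
  refine mem_iUnion.2 ⟨k, hx, fun r hr hrR => ?_⟩
  rcases le_or_gt r δ with h1 | h1
  · refine le_trans (ENNReal.ofReal_le_ofReal ?_) (hδ ⟨hr, h1⟩)
    gcongr
    exact hk.le.trans (min_le_left _ _)
  · refine le_trans (ENNReal.ofReal_le_ofReal ?_) ((hδ ⟨hδ0, le_rfl⟩).trans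
      (measure_mono (closedBall_subset_closedBall h1.le)))
    calc _ ≤ t * δ ^ n / (4 * R₀) ^ n * (4 * R₀) ^ n :=
          mul_le_mul (hk.le.trans (min_le_right _ _)) (by gcongr) (by positivity) (by positivity)
      _ = _ := by field_simp

theorem mem_iUnion_lowerRegularSet_of_lowerDensity_pos (hR₀ : 0 < R₀) {x : Euc d}
    (hx : x ∈ closedBall 0 R₀) (h : 0 < lowerDensity n ν x) :
    x ∈ ⋃ k : ℕ, lowerRegularSet n ν R₀ (1 / (k + 1)) := by
  obtain ⟨t, ht0, ht⟩ := ENNReal.lt_iff_exists_nnreal_btwn.1 h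
  refine mem_iUnion_lowerRegularSet hR₀ hx (t := t) (by exact_mod_cast ht0) ?_
  filter_upwards [eventually_lt_of_lt_liminf ht, eventually_mem_nhdsWithin] with r hr hr0
  have hr0' : (0 : ℝ) < r := hr0
  rw [ENNReal.ofReal_mul (by positivity), ENNReal.ofReal_coe_nnreal]
  exact (ENNReal.le_div_iff_mul_le (Or.inl (by simpa using pow_pos hr0' n)) (Or.inl (by simp))).1
    hr.le

theorem ae_mem_iUnion_lowerRegularSet_restrict [IsFiniteMeasure ν] (hR₀ : 0 < R₀) (ha : 0 < a) :
    ∀ᵐ x ∂ν, x ∈ lowerRegularSet n ν R₀ a →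
      x ∈ ⋃ l : ℕ, lowerRegularSet n (ν.restrict (lowerRegularSet n ν R₀ a)) R₀ (1 / (l + 1)) := by
  have hF := (isClosed_lowerRegularSet (n := n) (ν := ν) (R₀ := R₀) (a := a)).measurableSet
  set F := lowerRegularSet n ν R₀ a with hFdef
  filter_upwards [(ae_restrict_iff' hF).1 (Besicovitch.ae_tendsto_measure_inter_div ν F)]
    with x hx hxF
  refine mem_iUnion_lowerRegularSet hR₀ hxF.1 (t := a / 2) (by positivity) ?_
  have h1 : ∀ᶠ r in 𝓝[>] (0 : ℝ), (2⁻¹ : ℝ≥0∞) < ν (F ∩ closedBall x r) / ν (closedBall x r) :=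
    (hx hxF).eventually_const_lt ENNReal.one_half_lt_one
  filter_upwards [h1, Ioc_mem_nhdsGT (by linarith : (0 : ℝ) < 4 * R₀)] with r hr hrR
  rw [Measure.restrict_apply measurableSet_closedBall, inter_comm]
  have h2 := hxF.2 r hrR.1 hrR.2
  have h3 : ν (closedBall x r) ≠ 0 := by
    refine ne_of_gt (lt_of_lt_of_le ?_ h2)
    rw [ENNReal.ofReal_pos]
    have := pow_pos hrR.1 n
    positivity
  calc ENNReal.ofReal (a / 2 * r ^ n) = 2⁻¹ * ENNReal.ofReal (a * r ^ n) := by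
        rw [show a / 2 * r ^ n = 2⁻¹ * (a * r ^ n) by ring, ENNReal.ofReal_mul (by norm_num),
          ENNReal.ofReal_inv_of_pos (by norm_num), ENNReal.ofReal_ofNat]
    _ ≤ 2⁻¹ * ν (closedBall x r) := by gcongr
    _ ≤ _ := (ENNReal.le_div_iff_mul_le (Or.inl h3) (Or.inl (measure_ne_top _ _))).1 hr.le

end LowerRegular

theorem aDRegular_zero (n d : ℕ) : ADRegular n (0 : Measure (Euc d)) :=
  ⟨1, le_rfl, fun x hx => absurd (hx 1 one_pos) (by simp)⟩

theorem rieszBounded_zero (n d : ℕ) : RieszBounded n (0 : Measure (Euc d)) :=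
  ⟨1, one_pos, fun ε _ f _ => by simp⟩

theorem nonempty_linearIsometry_euc {n d : ℕ} (h : n ≤ d) : Nonempty (Euc n →ₗᵢ[ℝ] Euc d) := by
  set b := (EuclideanSpace.basisFun (Fin n) ℝ).toBasis
  set v : Fin n → Euc d := EuclideanSpace.basisFun (Fin d) ℝ ∘ Fin.castLE h
  have hv : Orthonormal ℝ v :=
    (EuclideanSpace.basisFun (Fin d) ℝ).orthonormal.comp _ (Fin.castLE_injective h)
  have hb : b.constr ℝ v ∘ b = v := funext fun i => b.constr_basis ℝ v i
  exact ⟨(b.constr ℝ v).isometryOfOrthonormal (v := b) (by simp [b]) (by rwa [hb])⟩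

/-- **Main Lemma.** Let `μ` be a compactly supported finite Borel measure in `ℝ^d` with growth
of degree `n` and positive lower `n`-density `μ`-a.e., whose Riesz transform is bounded in
`L²(μ)`. Then there are finite Borel measures `μ_k` with `μ ≤ Σ_k μ_k`, each `μ_k`
AD-regular of dimension `n`, and each `R_{μ_k}` bounded in `L²(μ_k)`. -/
theorem main_lemma (d n : ℕ) (μ : Measure (Euc d)) [IsFiniteMeasure μ]
    (hcomp : ∃ K : Set (Euc d), IsCompact K ∧ μ Kᶜ = 0)
    (hgrowth : ∃ c : ℝ, GrowthDeg n μ c)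
    (hdens : ∀ᵐ x ∂μ, 0 < lowerDensity n μ x)
    (hR : RieszBounded n μ) :
    ∃ μk : ℕ → Measure (Euc d),
      (∀ k, IsFiniteMeasure (μk k)) ∧
      μ ≤ Measure.sum μk ∧
      (∀ k, ADRegular n (μk k)) ∧
      (∀ k, RieszBounded n (μk k)) := by
  obtain ⟨C', hC'⟩ := hgrowth
  rcases lt_or_ge d n with hdn | hnd
  · exact ⟨fun _ => 0, fun _ => inferInstance, by simp [hC'.eq_zero_of_lt hdn],
      fun _ => aDRegular_zero n d, fun _ => rieszBounded_zero n d⟩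
  obtain ⟨L⟩ : Nonempty (Euc n →ₗᵢ[ℝ] Euc d) := nonempty_linearIsometry_euc hnd
  set C := max C' 0 with hCdef
  have hC0 : 0 ≤ C := le_max_right _ _
  have hμ : GrowthDeg n μ C := fun x r hr => (hC' x r hr).trans
    (ENNReal.ofReal_le_ofReal (by gcongr; exact le_max_left _ _))
  have hRs : SmoothRieszBounded n μ := hR.smooth hC0 hμ
  obtain ⟨K, hK, hμK⟩ := hcomp
  obtain ⟨R₀, hR₀, hKR⟩ := hK.isBounded.subset_closedBall_lt 0 0
  set F : ℕ → Set (Euc d) := fun k => lowerRegularSet n μ R₀ (1 / (k + 1)) with hF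
  set E : ℕ × ℕ → Set (Euc d) := fun i =>
    lowerRegularSet n (μ.restrict (F i.1)) R₀ (1 / (i.2 + 1)) ∩ F i.1 with hE
  have hFc : ∀ k, IsClosed (F k) := fun k => isClosed_lowerRegularSet
  have hEc : ∀ i, IsClosed (E i) := fun i => isClosed_lowerRegularSet.inter (hFc _)
  have hae : ∀ᵐ x ∂μ, x ∈ ⋃ i, E i := by
    have h1 : ∀ᵐ x ∂μ, ∀ k : ℕ, x ∈ F k →
        x ∈ ⋃ l : ℕ, lowerRegularSet n (μ.restrict (F k)) R₀ (1 / (l + 1)) :=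
      ae_all_iff.2 fun k => ae_mem_iUnion_lowerRegularSet_restrict hR₀ (by positivity)
    filter_upwards [hdens, h1, mem_ae_iff.2 hμK] with x hx hx1 hxK
    obtain ⟨k, hk⟩ := mem_iUnion.1
      (mem_iUnion_lowerRegularSet_of_lowerDensity_pos hR₀ (hKR hxK) hx)
    obtain ⟨l, hl⟩ := mem_iUnion.1 (hx1 k hk)
    exact mem_iUnion.2 ⟨(k, l), hl, hk⟩
  have hex : ∀ i, ∃ σ : Measure (Euc d), IsFiniteMeasure σ ∧ μ.restrict (E i) ≤ σ ∧
      ADRegular n σ ∧ RieszBounded n σ := by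
    intro i
    rcases (E i).eq_empty_or_nonempty with h0 | hne
    · exact ⟨0, inferInstance, by simp [h0], aDRegular_zero n d, rieszBounded_zero n d⟩
    have hle : ∀ (m : ℕ) (r : ℝ), m ≤ i.1 + i.2 → 0 < r →
        ENNReal.ofReal (1 / ((i.1 : ℝ) + i.2 + 1) * r ^ n) ≤
          ENNReal.ofReal (1 / ((m : ℝ) + 1) * r ^ n) := by
      intro m r hm hr
      have : (m : ℝ) ≤ i.1 + i.2 := by exact_mod_cast hm
      gcongr
    refine exists_aDRegular_ge hC0 hμ hRs L (E := E i) (F := F i.1) (R₀ := R₀)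
      (a := 1 / ((i.1 : ℝ) + i.2 + 1)) (by positivity) hR₀.le (fun x hx => hx.1) (hEc i) hne
      inter_subset_right (fun x hx r hr hrR => ?_) (fun x hx r hr hrR => ?_)
    · exact (hle _ r (Nat.le_add_right _ _) hr).trans (hx.2 r hr hrR)
    · refine (hle _ r (Nat.le_add_left _ _) hr).trans ((hx.1.2 r hr hrR).trans_eq ?_)
      rw [Measure.restrict_apply measurableSet_closedBall, inter_comm]
  choose σ hσ1 hσ2 hσ3 hσ4 using hex
  refine ⟨fun k => σ k.unpair, fun k => hσ1 _, ?_, fun k => hσ3 _, fun k => hσ4 _⟩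
  have hae' : ∀ᵐ x ∂μ, x ∈ ⋃ k : ℕ, E k.unpair := by
    filter_upwards [hae] with x hx
    obtain ⟨i, hi⟩ := mem_iUnion.1 hx
    exact mem_iUnion.2 ⟨Nat.pair i.1 i.2, by rwa [Nat.unpair_pair]⟩
  calc μ = μ.restrict (⋃ k : ℕ, E k.unpair) := (Measure.restrict_eq_self_of_ae_mem hae').symm
    _ ≤ Measure.sum fun k : ℕ => μ.restrict (E k.unpair) := Measure.restrict_iUnion_le
    _ ≤ _ := Measure.le_iff.2 fun A hA => by
        simp only [Measure.sum_apply _ hA]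
        exact ENNReal.tsum_le_tsum fun k => hσ2 _ A
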